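/- Let d ≥ 2 and suppose the following path-modification property holds in dimension d: for every m ≥ 1 there exists r > 0 such that whenever P_R and P_G are induced paths in ℤ^d, each starting at a point of ℓ1-norm greater than r+2 and ending at a point adjacent to the origin, neither containing the origin, with no vertex of P_R adjacent to any vertex of P_G, there exist induced paths Q_R, Q_G with the same respective starting points, agreeing with P_R, P_G respectively outside B¹_r, one ending at e_m and the other at −e_m, each meeting B¹_m only in its final vertex, and with no vertex of Q_R adjacent to any vertex of Q_G. Then for every r' ≥ 1, every enhancement E₀ : Set(ℤ^d) → Set(ℤ^d) of range r' (E₀(ω) determined by ω ∩ B^∞_{r'} and E₀(ω) ⊆ B^∞_{r'}) that is essential (some configuration ω with no doubly infinite path has a doubly infinite path in ω ∪ E₀(ω)), and every s with 0 < s < 1, there exists π(s) < p_c such that θ(p, s) > 0 for all p with π(s) < p < p_c. -/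

import Mathlib

open MeasureTheory

/-- The `ℓ1`-norm of a point of `ℤ^d`. -/
def norm1 {d : ℕ} (x : Fin d → ℤ) : ℤ := ∑ i, |x i|

/-- Grid adjacency in `ℤ^d`: `u` and `v` are adjacent iff `‖u - v‖₁ = 1`. -/
def Adj {d : ℕ} (u v : Fin d → ℤ) : Prop := norm1 (u - v) = 1

/-- The `ℓ∞`-ball `B^∞_r = {v : ‖v‖_∞ ≤ r}` in `ℤ^d`. -/
def Binf (d : ℕ) (r : ℤ) : Set (Fin d → ℤ) := {x | ∀ i, |x i| ≤ r}

/-- The point `e_m = (m, 0, …, 0)` of `ℤ^d`. -/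
def eVec (d : ℕ) (m : ℤ) : Fin d → ℤ := fun i => if (i : ℕ) = 0 then m else 0

/-- A (self-avoiding) path in the grid graph `ℤ^d`: a nonempty list of distinct
points in which consecutive points are adjacent. -/
def IsPath {d : ℕ} (P : List (Fin d → ℤ)) : Prop :=
  P ≠ [] ∧ P.Nodup ∧ P.Chain' Adj

/-- An induced path in `ℤ^d`: a path in which two of its points are adjacent
iff they are consecutive. -/
def IsInducedPath {d : ℕ} (P : List (Fin d → ℤ)) : Prop :=
  IsPath P ∧ ∀ i j : Fin P.length, (i : ℕ) + 1 < (j : ℕ) → ¬ Adj (P.get i) (P.get j)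

/-- The path-modification property in dimension `d` (the combinatorial
Conjecture replacing the Aizenman–Grimmett rewiring claim). -/
def PathModificationProperty (d : ℕ) : Prop :=
  ∀ m : ℤ, 1 ≤ m → ∃ r : ℤ, 0 < r ∧
    ∀ (PR PG : List (Fin d → ℤ)) (hRne : PR ≠ []) (hGne : PG ≠ []),
      IsInducedPath PR → IsInducedPath PG →
      norm1 (PR.head hRne) > r + 2 → norm1 (PG.head hGne) > r + 2 →
      Adj (PR.getLast hRne) 0 → Adj (PG.getLast hGne) 0 →
      (0 : Fin d → ℤ) ∉ PR → (0 : Fin d → ℤ) ∉ PG →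
      (∀ x ∈ PR, ∀ y ∈ PG, ¬ Adj x y) →
      ∃ (QR QG : List (Fin d → ℤ)) (hQRne : QR ≠ []) (hQGne : QG ≠ []),
        IsInducedPath QR ∧ IsInducedPath QG ∧
        QR.head hQRne = PR.head hRne ∧
        QG.head hQGne = PG.head hGne ∧
        (∀ x : Fin d → ℤ, norm1 x > r → (x ∈ QR ↔ x ∈ PR)) ∧
        (∀ x : Fin d → ℤ, norm1 x > r → (x ∈ QG ↔ x ∈ PG)) ∧
        ((QR.getLast hQRne = eVec d m ∧ QG.getLast hQGne = eVec d (-m)) ∨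
          (QR.getLast hQRne = eVec d (-m) ∧ QG.getLast hQGne = eVec d m)) ∧
        (∀ x ∈ QR, norm1 x ≤ m → x = QR.getLast hQRne) ∧
        (∀ x ∈ QG, norm1 x ≤ m → x = QG.getLast hQGne) ∧
        (∀ x ∈ QR, ∀ y ∈ QG, ¬ Adj x y)

/-- The configuration (set of open sites) of `ω : ℤ^d → Bool`. -/
def toConfig {d : ℕ} (ω : (Fin d → ℤ) → Bool) : Set (Fin d → ℤ) := {v | ω v = true}

/-- The enhanced configuration `E(ω, α) = ω ∪ ⋃_{v ∈ α} (E₀(ω − v) + v)`. -/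
def enhancedConfig {d : ℕ} (E0 : Set (Fin d → ℤ) → Set (Fin d → ℤ))
    (ω α : Set (Fin d → ℤ)) : Set (Fin d → ℤ) :=
  ω ∪ ⋃ v ∈ α, (fun y => y + v) '' E0 ((fun x => x - v) '' ω)

/-- `σ` contains a path joining `x` to `y`: a finite sequence of distinct points of `σ`,
starting at `x` and ending at `y`, with consecutive points adjacent. -/
def HasPathJoining {d : ℕ} (σ : Set (Fin d → ℤ)) (x y : Fin d → ℤ) : Prop :=
  ∃ (L : List (Fin d → ℤ)) (h : L ≠ []),
    L.Nodup ∧ L.Chain' Adj ∧ (∀ z ∈ L, z ∈ σ) ∧ L.head h = x ∧ L.getLast h = y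

/-- `σ` contains a doubly infinite path: an injective `f : ℤ → ℤ^d` with `f i ∈ σ`
and `f i` adjacent to `f (i+1)` for every `i`. -/
def HasDoublyInfinitePath {d : ℕ} (σ : Set (Fin d → ℤ)) : Prop :=
  ∃ f : ℤ → Fin d → ℤ, Function.Injective f ∧ ∀ i : ℤ, f i ∈ σ ∧ Adj (f i) (f (i + 1))

/-- The origin lies in an infinite cluster of the configuration `σ`. -/
def OriginInInfiniteCluster {d : ℕ} (σ : Set (Fin d → ℤ)) : Prop :=
  (0 : Fin d → ℤ) ∈ σ ∧ {x | HasPathJoining σ 0 x}.Infinite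

/-- `μ` is the product over the sites of `ℤ^d` of Bernoulli(`p`) measures:
a probability measure giving each cylinder event its product probability. -/
def IsBernoulliProduct (d : ℕ) (p : ℝ) (μ : Measure ((Fin d → ℤ) → Bool)) : Prop :=
  IsProbabilityMeasure μ ∧
    ∀ (F : Finset (Fin d → ℤ)) (g : (Fin d → ℤ) → Bool),
      μ {ω | ∀ v ∈ F, ω v = g v} =
        ∏ v ∈ F, (if g v then ENNReal.ofReal p else ENNReal.ofReal (1 - p))

/-- `θ(p, s)` for given disorder measures `μ = μ_p`, `ν = μ_s`: the probability that
the origin lies in an infinite cluster of the enhanced configuration. -/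
noncomputable def theta {d : ℕ} (E0 : Set (Fin d → ℤ) → Set (Fin d → ℤ))
    (μ ν : Measure ((Fin d → ℤ) → Bool)) : ENNReal :=
  (μ.prod ν)
    {ωα | OriginInInfiniteCluster (enhancedConfig E0 (toConfig ωα.1) (toConfig ωα.2))}

/-- `θ₀(p)` for a given disorder measure `μ = μ_p`: the probability that the origin
lies in an infinite cluster of the (unenhanced) random configuration. -/
noncomputable def theta0 {d : ℕ} (μ : Measure ((Fin d → ℤ) → Bool)) : ENNReal :=
  μ {ω | OriginInInfiniteCluster (toConfig ω)}

/-- The critical probability `p_c = inf {p ∈ [0,1] : θ₀(p) > 0}`, given the family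
`p ↦ μ_p` of disorder measures. -/
noncomputable def pc {d : ℕ} (μ : ℝ → Measure ((Fin d → ℤ) → Bool)) : ℝ :=
  sInf {p : ℝ | p ∈ Set.Icc (0 : ℝ) 1 ∧ 0 < theta0 (μ p)}

set_option linter.unusedVariables false
open MeasureTheory

/-! ### Basic facts about the norm and adjacency -/

section Basics
variable {d : ℕ}

lemma norm1_nonneg (x : Fin d → ℤ) : 0 ≤ norm1 x :=
  Finset.sum_nonneg fun _ _ => abs_nonneg _

lemma norm1_zero : norm1 (0 : Fin d → ℤ) = 0 := by simp [norm1]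

lemma norm1_neg (x : Fin d → ℤ) : norm1 (-x) = norm1 x := by simp [norm1]

lemma norm1_sub_comm (x y : Fin d → ℤ) : norm1 (x - y) = norm1 (y - x) := by
  rw [← norm1_neg, neg_sub]

lemma norm1_add_le (x y : Fin d → ℤ) : norm1 (x + y) ≤ norm1 x + norm1 y := by
  unfold norm1
  rw [← Finset.sum_add_distrib]
  exact Finset.sum_le_sum fun i _ => abs_add_le _ _

lemma norm1_tri (x y : Fin d → ℤ) : norm1 x ≤ norm1 y + norm1 (x - y) := by
  have := norm1_add_le y (x - y)
  simpa using this

lemma abs_le_norm1 (x : Fin d → ℤ) (i : Fin d) : |x i| ≤ norm1 x :=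
  Finset.single_le_sum (f := fun i => |x i|) (fun _ _ => abs_nonneg _) (Finset.mem_univ i)

lemma Adj.symm {x y : Fin d → ℤ} (h : Adj x y) : Adj y x := by
  unfold Adj at *; rw [norm1_sub_comm]; exact h

lemma Adj.ne {x y : Fin d → ℤ} (h : Adj x y) : x ≠ y := by
  rintro rfl; simp [Adj, norm1_zero] at h

lemma Adj.norm_le {x y : Fin d → ℤ} (h : Adj x y) : norm1 x ≤ norm1 y + 1 := by
  have := norm1_tri x y
  unfold Adj at h; omega

lemma adj_sub_iff {x y : Fin d → ℤ} (v : Fin d → ℤ) : Adj (x - v) (y - v) ↔ Adj x y := by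
  simp [Adj]

lemma adj_add_iff {x y : Fin d → ℤ} (v : Fin d → ℤ) : Adj (x + v) (y + v) ↔ Adj x y := by
  simp [Adj]

lemma norm1_le_of_mem_Binf {r : ℤ} {x : Fin d → ℤ} (h : x ∈ Binf d r) : norm1 x ≤ d * r := by
  unfold norm1
  calc _ ≤ ∑ _i : Fin d, r := Finset.sum_le_sum fun i _ => h i
    _ = _ := by simp

/-- The `ℓ1`-ball as a finset. -/
noncomputable def ballF (d : ℕ) (n : ℤ) : Finset (Fin d → ℤ) :=
  (Finset.Icc (fun _ => -n) (fun _ => n)).filter fun x => norm1 x ≤ n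

lemma mem_ballF {n : ℤ} {x : Fin d → ℤ} : x ∈ ballF d n ↔ norm1 x ≤ n := by
  simp only [ballF, Finset.mem_filter, Finset.mem_Icc, and_iff_right_iff_imp]
  intro h
  constructor
  · intro i; have := abs_le.1 ((abs_le_norm1 x i).trans h); exact this.1
  · intro i; have := abs_le.1 ((abs_le_norm1 x i).trans h); exact this.2

/-- `v` can be reached from `u` by steps landing in `S`. -/
def Reach (S : Set (Fin d → ℤ)) (u v : Fin d → ℤ) : Prop :=
  Relation.ReflTransGen (fun a b => Adj a b ∧ b ∈ S) u v

lemma Reach.refl {S : Set (Fin d → ℤ)} (u : Fin d → ℤ) : Reach S u u :=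
  Relation.ReflTransGen.refl

lemma Reach.trans {S : Set (Fin d → ℤ)} {u v w : Fin d → ℤ} (h : Reach S u v)
    (h' : Reach S v w) : Reach S u w := Relation.ReflTransGen.trans h h'

lemma Reach.mono {S T : Set (Fin d → ℤ)} (hST : S ⊆ T) {u v : Fin d → ℤ} (h : Reach S u v) :
    Reach T u v := Relation.ReflTransGen.mono (fun _ _ h => ⟨h.1, hST h.2⟩) _ _ h

lemma Reach.step {S : Set (Fin d → ℤ)} {u v w : Fin d → ℤ} (h : Reach S u v)
    (h' : Adj v w) (hw : w ∈ S) : Reach S u w := Relation.ReflTransGen.tail h ⟨h', hw⟩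

lemma Reach.single {S : Set (Fin d → ℤ)} {u v : Fin d → ℤ}
    (h' : Adj u v) (hw : v ∈ S) : Reach S u v := (Reach.refl u).step h' hw

lemma Reach.mem {S : Set (Fin d → ℤ)} {u v : Fin d → ℤ} (h : Reach S u v) (hu : u ∈ S) :
    v ∈ S := by
  induction h with
  | refl => exact hu
  | tail _ h _ => exact h.2

lemma Reach.symm {S : Set (Fin d → ℤ)} {u v : Fin d → ℤ} (h : Reach S u v) (hu : u ∈ S) :
    Reach S v u := by
  induction h with
  | refl => exact Reach.refl _
  | @tail b c hb hc ih =>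
    exact (Reach.single hc.1.symm (Reach.mem hb hu)).trans ih

lemma Reach.closed {S K : Set (Fin d → ℤ)} {u v : Fin d → ℤ} (h : Reach S u v) (hu : u ∈ K)
    (hK : ∀ a ∈ K, ∀ b ∈ S, Adj a b → b ∈ K) : v ∈ K := by
  induction h with
  | refl => exact hu
  | tail _ h ih => exact hK _ ih _ h.2 h.1

lemma Reach.translate {S T : Set (Fin d → ℤ)} {u v : Fin d → ℤ} (x : Fin d → ℤ)
    (h : Reach S u v) (hST : ∀ y ∈ S, y + x ∈ T) : Reach T (u + x) (v + x) := by
  induction h with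
  | refl => exact Reach.refl _
  | tail _ h ih => exact ih.step ((adj_add_iff x).2 h.1) (hST _ h.2)

lemma reach_of_chain {S : Set (Fin d → ℤ)} (L : List (Fin d → ℤ)) (hne : L ≠ [])
    (hc : L.IsChain Adj) (hS : ∀ z ∈ L, z ∈ S) {z : Fin d → ℤ} (hz : z ∈ L) :
    Reach S (L.head hne) z := by
  induction L with
  | nil => exact absurd rfl hne
  | cons a T ih =>
    rcases List.mem_cons.1 hz with rfl | hz
    · exact Reach.refl _
    · cases T with
      | nil => simp at hz
      | cons b T' =>
        rw [List.isChain_cons_cons] at hc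
        have := ih (by simp) hc.2 (fun z hz => hS z (List.mem_cons_of_mem _ hz)) hz
        exact (Reach.single hc.1 (hS b (by simp))).trans this

/-- Recursive form of induced path. -/
def Ind : List (Fin d → ℤ) → Prop
  | [] => True
  | u :: T => Ind T ∧ u ∉ T ∧ (∀ h : T ≠ [], Adj u (T.head h)) ∧ ∀ v ∈ T.tail, ¬ Adj u v

lemma Ind.chain : ∀ {L : List (Fin d → ℤ)}, Ind L → L.IsChain Adj
  | [], _ => List.IsChain.nil
  | [_], _ => List.IsChain.singleton _
  | a :: b :: T, h => by
    rw [List.isChain_cons_cons]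
    exact ⟨by simpa using h.2.2.1 (by simp), Ind.chain h.1⟩

lemma Ind.nodup : ∀ {L : List (Fin d → ℤ)}, Ind L → L.Nodup
  | [], _ => List.nodup_nil
  | a :: T, h => List.nodup_cons.2 ⟨h.2.1, Ind.nodup h.1⟩

lemma Ind.get : ∀ {L : List (Fin d → ℤ)}, Ind L → ∀ i j : ℕ, (hi : i < L.length) →
    (hj : j < L.length) → i + 1 < j → ¬ Adj L[i] L[j]
  | [], _, i, j, hi, hj, h => by simp at hi
  | a :: T, h, 0, j, hi, hj, hij => by
    obtain ⟨j, rfl⟩ : ∃ k, j = k + 2 := ⟨j - 2, by omega⟩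
    simp only [List.getElem_cons_zero, List.getElem_cons_succ]
    apply h.2.2.2
    cases T with
    | nil => simp at hj
    | cons b T' => simp
  | a :: T, h, i + 1, j, hi, hj, hij => by
    obtain ⟨j, rfl⟩ : ∃ k, j = k + 1 := ⟨j - 1, by omega⟩
    simp only [List.getElem_cons_succ]
    exact Ind.get h.1 i j _ _ (by omega)

lemma Ind.isInduced {L : List (Fin d → ℤ)} (h : Ind L) (hne : L ≠ []) : IsInducedPath L :=
  ⟨⟨hne, h.nodup, h.chain⟩, fun i j hij => by simpa using h.get i j i.2 j.2 hij⟩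

lemma Ind.extend : ∀ (L : List (Fin d → ℤ)) (hne : L ≠ []) (_ : Ind L) (w : Fin d → ℤ)
    (_ : ∃ z ∈ L, z = w ∨ Adj z w),
    ∃ (L' : List (Fin d → ℤ)) (hne' : L' ≠ []), Ind L' ∧ L'.head hne' = L.head hne ∧
      L'.getLast hne' = w ∧ ∀ z ∈ L', z ∈ L ∨ z = w
  | [], hne, _, _, _ => absurd rfl hne
  | u :: T, hne, h, w, hz => by
    by_cases huw : u = w
    · subst huw
      exact ⟨[u], by simp, by simp [Ind], rfl, rfl, by simp⟩
    by_cases hadj : Adj u w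
    · exact ⟨[u, w], by simp, by simp [Ind, huw, hadj], rfl, rfl, by simp⟩
    obtain ⟨z, hz, hzw⟩ := hz
    rcases List.mem_cons.1 hz with rfl | hzT
    · tauto
    have hT : T ≠ [] := List.ne_nil_of_mem hzT
    obtain ⟨L', hne', hI, hhead, hlast, hsub⟩ := Ind.extend T hT h.1 w ⟨z, hzT, hzw⟩
    refine ⟨u :: L', by simp, ⟨hI, ?_, ?_, ?_⟩, rfl, ?_, ?_⟩
    · intro hu
      rcases hsub u hu with hu | hu
      · exact h.2.1 hu
      · exact huw hu
    · intro _
      rw [hhead]; exact h.2.2.1 hT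
    · intro v hv
      rcases hsub v (List.mem_of_mem_tail hv) with hv' | rfl
      · have hnd := hI.nodup
        obtain ⟨a, T', rfl⟩ := List.exists_cons_of_ne_nil hT
        obtain ⟨b, L'', rfl⟩ := List.exists_cons_of_ne_nil hne'
        simp only [List.head_cons] at hhead
        subst hhead
        rcases List.mem_cons.1 hv' with rfl | hv'
        · simp at hv hnd; exact absurd hv hnd.1
        · exact h.2.2.2 v hv'
      · exact hadj
    · rw [List.getLast_cons hne']; exact hlast
    · intro z hz
      rcases List.mem_cons.1 hz with rfl | hz
      · simp
      · rcases hsub z hz with h | h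
        · exact Or.inl (List.mem_cons_of_mem _ h)
        · exact Or.inr h

lemma Reach.exists_ind {S : Set (Fin d → ℤ)} {u v : Fin d → ℤ} (h : Reach S u v) (hu : u ∈ S) :
    ∃ (L : List (Fin d → ℤ)) (hne : L ≠ []), Ind L ∧ L.head hne = u ∧ L.getLast hne = v ∧
      ∀ z ∈ L, z ∈ S := by
  induction h with
  | refl => exact ⟨[u], by simp, by simp [Ind], rfl, rfl, by simpa using hu⟩
  | @tail b c hb hc ih =>
    obtain ⟨L, hne, hI, hh, hl, hs⟩ := ih
    obtain ⟨L', hne', hI', hh', hl', hs'⟩ := Ind.extend L hne hI c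
      ⟨b, hl ▸ List.getLast_mem hne, Or.inr hc.1⟩
    exact ⟨L', hne', hI', hh'.trans hh, hl', fun z hz => (hs' z hz).elim (hs z)
      (fun h => h ▸ hc.2)⟩

lemma Ind.map_sub (x : Fin d → ℤ) : ∀ {L : List (Fin d → ℤ)}, Ind L → Ind (L.map (· - x))
  | [], _ => trivial
  | u :: T, h => by
    refine ⟨Ind.map_sub x h.1, ?_, ?_, ?_⟩
    · simpa using h.2.1
    · intro hT
      have hT' : T ≠ [] := by simpa using hT
      have := h.2.2.1 hT'
      change Adj (u - x) _
      rw [List.head_map]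
      exact (adj_sub_iff x).2 this
    · intro v hv
      rw [← List.map_tail] at hv
      obtain ⟨w, hw, rfl⟩ := List.mem_map.1 hv
      rw [adj_sub_iff]
      exact h.2.2.2 w hw

lemma hasPathJoining_iff {S : Set (Fin d → ℤ)} {u v : Fin d → ℤ} :
    HasPathJoining S u v ↔ u ∈ S ∧ Reach S u v := by
  constructor
  · rintro ⟨L, hne, hnd, hc, hS, rfl, rfl⟩
    exact ⟨hS _ (List.head_mem hne), reach_of_chain L hne hc hS (List.getLast_mem hne)⟩
  · rintro ⟨hu, h⟩
    obtain ⟨L, hne, hI, hh, hl, hs⟩ := h.exists_ind hu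
    exact ⟨L, hne, hI.nodup, hI.chain, hs, hh, hl⟩

/-- The origin is joined to the sphere of radius `n` inside the ball. -/
def Arm (n : ℤ) (S : Set (Fin d → ℤ)) : Prop :=
  (0 : Fin d → ℤ) ∈ S ∧ ∃ y, norm1 y = n ∧ Reach (S ∩ {z | norm1 z ≤ n}) 0 y

lemma Arm.mono {n : ℤ} {S T : Set (Fin d → ℤ)} (hST : S ⊆ T) (h : Arm n S) : Arm n T :=
  ⟨hST h.1, h.2.imp fun _ hy => ⟨hy.1, hy.2.mono (Set.inter_subset_inter_left _ hST)⟩⟩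

lemma arm_of_reach {n : ℤ} (hn : 0 ≤ n) {S : Set (Fin d → ℤ)} (h0 : (0 : Fin d → ℤ) ∈ S)
    {y : Fin d → ℤ} (hy : n ≤ norm1 y) (h : Reach S 0 y) : Arm n S := by
  refine ⟨h0, ?_⟩
  by_contra hcon
  push Not at hcon
  have key : ∀ z, Reach S 0 z → norm1 z < n ∧ Reach (S ∩ {z | norm1 z ≤ n}) 0 z := by
    intro z hz
    induction hz with
    | refl =>
      refine ⟨?_, Reach.refl _⟩
      rw [norm1_zero]
      rcases hn.lt_or_eq with h | h
      · exact h
      · exact absurd (Reach.refl _) (hcon 0 (by rw [norm1_zero]; exact h))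
    | @tail b c hb hc ih =>
      have h1 := hc.1.symm.norm_le
      have h2 : Reach (S ∩ {z | norm1 z ≤ n}) 0 c :=
        ih.2.step hc.1 ⟨hc.2, by simp only [Set.mem_ofPred_eq]; omega⟩
      refine ⟨?_, h2⟩
      have : norm1 c ≠ n := fun h => hcon c h h2
      omega
  have := (key y h).1
  omega

lemma Arm.anti {n m : ℤ} (hm : 0 ≤ m) (hmn : m ≤ n) {S : Set (Fin d → ℤ)} (h : Arm n S) :
    Arm m S := by
  obtain ⟨h0, y, hy, hr⟩ := h
  exact arm_of_reach hm h0 (hmn.trans hy.ge) (hr.mono Set.inter_subset_left)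

lemma origin_iff_arm {S : Set (Fin d → ℤ)} :
    OriginInInfiniteCluster S ↔ ∀ n : ℕ, Arm (n : ℤ) S := by
  constructor
  · rintro ⟨h0, hinf⟩ n
    have : ∃ y ∈ {x | HasPathJoining S 0 x}, y ∉ (ballF d n : Set (Fin d → ℤ)) := by
      by_contra hcon
      push Not at hcon
      exact hinf ((ballF d n).finite_toSet.subset hcon)
    obtain ⟨y, hy, hyn⟩ := this
    rw [Finset.mem_coe, mem_ballF] at hyn
    exact arm_of_reach (by positivity) h0 (by omega) (hasPathJoining_iff.1 hy).2
  · intro h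
    refine ⟨(h 0).1, fun hfin => ?_⟩
    obtain ⟨N, hN⟩ := (hfin.image norm1).bddAbove
    obtain ⟨h0, y, hy, hr⟩ := h (N.toNat + 1)
    have := hN ⟨y, hasPathJoining_iff.2 ⟨h0, hr.mono Set.inter_subset_left⟩, rfl⟩
    have := Int.self_le_toNat N
    push_cast at hy
    omega

lemma arm_congr {n : ℤ} (hn : 0 ≤ n) {S T : Set (Fin d → ℤ)}
    (h : ∀ x, norm1 x ≤ n → (x ∈ S ↔ x ∈ T)) :
    Arm n S ↔ Arm n T := by
  have : S ∩ {z | norm1 z ≤ n} = T ∩ {z | norm1 z ≤ n} := by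
    ext x; simp only [Set.mem_inter_iff, Set.mem_ofPred_eq]
    constructor
    · rintro ⟨a, b⟩; exact ⟨(h x b).1 a, b⟩
    · rintro ⟨a, b⟩; exact ⟨(h x b).2 a, b⟩
  unfold Arm
  rw [this, h 0 (by rw [norm1_zero]; exact hn)]

end Basics

open MeasureTheory

/-! ### Routing two paths to the poles -/

section Routing
variable {d : ℕ}

lemma norm1_mono {x y : Fin d → ℤ} (h : ∀ c, |x c| ≤ |y c|) : norm1 x ≤ norm1 y :=
  Finset.sum_le_sum fun i _ => h i

lemma adj_update (x : Fin d → ℤ) (k : Fin d) (u : ℤ) :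
    Adj (Function.update x k u) (Function.update x k (u + 1)) := by
  unfold Adj norm1
  rw [Finset.sum_eq_single k]
  · simp
  · intro b _ hb; simp [hb]
  · simp

lemma seg_up {S : Set (Fin d → ℤ)} (x : Fin d → ℤ) (k : Fin d) {v w : ℤ} (hvw : v ≤ w)
    (hS : ∀ u, v ≤ u → u ≤ w → Function.update x k u ∈ S) :
    Reach S (Function.update x k v) (Function.update x k w) := by
  induction w, hvw using Int.leInduction with
  | base => exact Reach.refl _
  | succ n hn ih =>
    exact (ih fun u h1 h2 => hS u h1 (by omega)).step (adj_update x k n)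
      (hS _ (by omega) le_rfl)

lemma seg_down {S : Set (Fin d → ℤ)} (x : Fin d → ℤ) (k : Fin d) {v w : ℤ} (hvw : v ≤ w)
    (hS : ∀ u, v ≤ u → u ≤ w → Function.update x k u ∈ S) :
    Reach S (Function.update x k w) (Function.update x k v) :=
  (seg_up x k hvw hS).symm (hS v le_rfl hvw)

/-- First stage: the two end points have been separated in the direction `k`. -/
def Stage1 (L : ℤ) (a b : Fin d → ℤ) : Prop :=
  ∃ (k : Fin d) (A B : Set (Fin d → ℤ)) (a' b' : Fin d → ℤ),
    a ∈ A ∧ b ∈ B ∧ Reach A a a' ∧ Reach B b b' ∧ L + 3 ≤ a' k ∧ b' k ≤ -(L + 3) ∧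
    (∀ z ∈ A, -(L + 1) ≤ z k) ∧ (∀ z ∈ B, z k ≤ L + 1) ∧
    (∀ z ∈ A, ∀ c, |z c| ≤ L + 3) ∧ (∀ z ∈ B, ∀ c, |z c| ≤ L + 3) ∧
    (∀ z ∈ A, z = a ∨ ∃ c, L + 2 ≤ |z c|) ∧ (∀ z ∈ B, z = b ∨ ∃ c, L + 2 ≤ |z c|) ∧
    (∀ z ∈ A, ∀ w ∈ B, 2 ≤ norm1 (z - w))

lemma two_le_of_coord {z w : Fin d → ℤ} (c : Fin d) (h : 2 ≤ |z c - w c|) :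
    2 ≤ norm1 (z - w) := h.trans (abs_le_norm1 (z - w) c)

lemma two_le_of_dom {a b z w : Fin d → ℤ} (hab : 2 ≤ norm1 (a - b))
    (h : ∀ c, |a c - b c| ≤ |z c - w c|) : 2 ≤ norm1 (z - w) :=
  hab.trans (norm1_mono h)

/-- The straight segment in direction `i` from height `L + 1` to height `L + 3`. -/
def raySet (L : ℤ) (a : Fin d → ℤ) (i : Fin d) (s : ℤ) : Set (Fin d → ℤ) :=
  {z | ∃ v, L + 1 ≤ v ∧ v ≤ L + 3 ∧ z = Function.update a i (s * v)}

lemma ray_reach {L : ℤ} {a : Fin d → ℤ} {i : Fin d} {s : ℤ} (hs : s = 1 ∨ s = -1)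
    (hi : a i = s * (L + 1)) {S : Set (Fin d → ℤ)} (hS : raySet L a i s ⊆ S) :
    Reach S a (Function.update a i (s * (L + 3))) := by
  have h0 : a = Function.update a i (s * (L + 1)) := by rw [← hi]; simp
  conv_lhs => rw [h0]
  rcases hs with rfl | rfl
  · apply seg_up _ _ (by omega)
    intro u h1 h2
    exact hS ⟨u, by omega, by omega, by simp⟩
  · apply seg_down _ _ (by omega)
    intro u h1 h2
    exact hS ⟨-u, by omega, by omega, by simp⟩

lemma stage1_opp {L : ℤ} (hL : 0 ≤ L) {a b : Fin d → ℤ} (ha : ∀ c, |a c| ≤ L + 1)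
    (hb : ∀ c, |b c| ≤ L + 1) (i : Fin d) (hai : a i = L + 1) (hbi : b i = -(L + 1)) :
    Stage1 L a b := by
  have hai' : a i = 1 * (L + 1) := by omega
  have hbi' : b i = -1 * (L + 1) := by omega
  refine ⟨i, raySet L a i 1, raySet L b i (-1), Function.update a i (1 * (L + 3)),
    Function.update b i (-1 * (L + 3)), ⟨L + 1, by omega, by omega, by rw [← hai']; simp⟩,
    ⟨L + 1, by omega, by omega, by rw [← hbi']; simp⟩, ray_reach (by simp) hai' le_rfl,
    ray_reach (by simp) hbi' le_rfl, by simp, by simp, ?_, ?_, ?_, ?_, ?_, ?_, ?_⟩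
  · rintro _ ⟨v, h1, h2, rfl⟩; simp; omega
  · rintro _ ⟨v, h1, h2, rfl⟩; simp; omega
  · rintro _ ⟨v, h1, h2, rfl⟩ c
    have := ha c
    rw [Function.update_apply]; split_ifs <;> (rw [abs_le] at *; omega)
  · rintro _ ⟨v, h1, h2, rfl⟩ c
    have := hb c
    rw [Function.update_apply]; split_ifs <;> (rw [abs_le] at *; omega)
  · rintro _ ⟨v, h1, h2, rfl⟩
    by_cases hv : v = L + 1
    · left; rw [hv, ← hai']; simp
    · right; refine ⟨i, ?_⟩; simp only [Function.update_self]; rw [le_abs]; omega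
  · rintro _ ⟨v, h1, h2, rfl⟩
    by_cases hv : v = L + 1
    · left; rw [hv, ← hbi']; simp
    · right; refine ⟨i, ?_⟩; simp only [Function.update_self]; rw [le_abs]; omega
  · rintro _ ⟨v, h1, h2, rfl⟩ _ ⟨w, h3, h4, rfl⟩
    apply two_le_of_coord i
    simp only [Function.update_self]; rw [le_abs]; omega

/-- second segment -/
def legSet (L : ℤ) (a : Fin d → ℤ) (k : Fin d) (s : ℤ) : Set (Fin d → ℤ) :=
  {z | ∃ v, s * a k ≤ v ∧ v ≤ L + 3 ∧ z = Function.update a k (s * v)}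

lemma leg_reach {L : ℤ} {a : Fin d → ℤ} {k : Fin d} {s : ℤ} (hs : s = 1 ∨ s = -1)
    (hk : |a k| ≤ L + 3) {S : Set (Fin d → ℤ)} (hS : legSet L a k s ⊆ S) :
    Reach S a (Function.update a k (s * (L + 3))) := by
  rw [abs_le] at hk
  have h0 : a = Function.update a k (a k) := by simp
  conv_lhs => rw [h0]
  rcases hs with rfl | rfl
  · apply seg_up _ _ (by omega)
    intro u h1 h2
    exact hS ⟨u, by omega, by omega, by simp⟩
  · apply seg_down _ _ (by omega)
    intro u h1 h2
    exact hS ⟨-u, by omega, by omega, by simp⟩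

lemma stage1_same {L : ℤ} (hL : 0 ≤ L) {a b : Fin d → ℤ} (hab : 2 ≤ norm1 (a - b))
    (ha : ∀ c, |a c| ≤ L + 1)
    (hb : ∀ c, |b c| ≤ L + 1) (i : Fin d) {s : ℤ} (hs : s = 1 ∨ s = -1)
    (hai : a i = s * (L + 1)) (hbi : b i = s * (L + 1)) (k : Fin d) (hk : b k < a k) :
    Stage1 L a b := by
  have hki : k ≠ i := by rintro rfl; omega
  have hsL : |s * (L + 3)| = L + 3 := by
    rcases hs with rfl | rfl <;> rw [abs_eq] <;> omega
  set a1 := Function.update a i (s * (L + 3)) with ha1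
  set b1 := Function.update b i (s * (L + 3)) with hb1
  have ha1k : a1 k = a k := by simp [ha1, hki]
  have hb1k : b1 k = b k := by simp [hb1, hki]
  have hak := abs_le.1 (ha k)
  have hbk := abs_le.1 (hb k)
  have hcoord : ∀ (x : Fin d → ℤ), (∀ c, |x c| ≤ L + 1) → ∀ v c, |v| ≤ L + 3 →
      |Function.update x i v c| ≤ L + 3 := by
    intro x hx v c hv
    have := hx c
    rw [Function.update_apply]; split_ifs <;> omega
  refine ⟨k, raySet L a i s ∪ legSet L a1 k 1, raySet L b i s ∪ legSet L b1 k (-1),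
    Function.update a1 k (1 * (L + 3)),
    Function.update b1 k (-1 * (L + 3)), Or.inl ⟨L + 1, by omega, by omega, by rw [← hai]; simp⟩,
    Or.inl ⟨L + 1, by omega, by omega, by rw [← hbi]; simp⟩,
    (ray_reach hs hai Set.subset_union_left).trans
      (leg_reach (by simp) (by rw [← ha1, ha1k, abs_le]; omega) Set.subset_union_right),
    (ray_reach hs hbi Set.subset_union_left).trans
      (leg_reach (by simp) (by rw [← hb1, hb1k, abs_le]; omega) Set.subset_union_right),
    by simp, by simp, ?_, ?_, ?_, ?_, ?_, ?_, ?_⟩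
  · rintro _ (⟨v, h1, h2, rfl⟩ | ⟨v, h1, h2, rfl⟩)
    · simp only [Function.update_of_ne hki]; omega
    · simp; omega
  · rintro _ (⟨v, h1, h2, rfl⟩ | ⟨v, h1, h2, rfl⟩)
    · simp only [Function.update_of_ne hki]; omega
    · simp; omega
  · rintro _ (⟨v, h1, h2, rfl⟩ | ⟨v, h1, h2, rfl⟩) c
    · apply hcoord a ha; rcases hs with rfl | rfl <;> rw [abs_le] <;> omega
    · rw [Function.update_apply]; split_ifs
      · rw [abs_le]; omega
      · exact hcoord a ha _ _ hsL.le
  · rintro _ (⟨v, h1, h2, rfl⟩ | ⟨v, h1, h2, rfl⟩) c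
    · apply hcoord b hb; rcases hs with rfl | rfl <;> rw [abs_le] <;> omega
    · rw [Function.update_apply]; split_ifs
      · rw [abs_le]; omega
      · exact hcoord b hb _ _ hsL.le
  · rintro _ (⟨v, h1, h2, rfl⟩ | ⟨v, h1, h2, rfl⟩)
    · by_cases hv : v = L + 1
      · left; rw [hv, ← hai]; simp
      · right; refine ⟨i, ?_⟩; simp only [Function.update_self]; rw [le_abs]
        rcases hs with rfl | rfl <;> omega
    · right; refine ⟨i, ?_⟩; simp only [Function.update_of_ne hki.symm, ha1, Function.update_self]
      omega
  · rintro _ (⟨v, h1, h2, rfl⟩ | ⟨v, h1, h2, rfl⟩)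
    · by_cases hv : v = L + 1
      · left; rw [hv, ← hbi]; simp
      · right; refine ⟨i, ?_⟩; simp only [Function.update_self]; rw [le_abs]
        rcases hs with rfl | rfl <;> omega
    · right; refine ⟨i, ?_⟩; simp only [Function.update_of_ne hki.symm, hb1, Function.update_self]
      omega
  · rintro _ (⟨v, h1, h2, rfl⟩ | ⟨v, h1, h2, rfl⟩) _ (⟨w, h3, h4, rfl⟩ | ⟨w, h3, h4, rfl⟩) <;>
    · apply two_le_of_dom hab
      intro c
      by_cases hci : c = i
      · subst hci
        rw [hai, hbi, sub_self, abs_zero]; exact abs_nonneg _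
      by_cases hck : c = k
      · subst hck
        simp only [ha1, hb1, Function.update_self, Function.update_of_ne hki] at *
        rw [abs_le, le_abs, neg_le, le_abs]
        omega
      · simp only [ha1, hb1, Function.update_of_ne hci, Function.update_of_ne hck]
        exact le_rfl

lemma stage1_diffL {L : ℤ} (hL : 0 ≤ L) {a b : Fin d → ℤ} (hab : 2 ≤ norm1 (a - b))
    (ha : ∀ c, |a c| ≤ L + 1)
    (hb : ∀ c, |b c| ≤ L + 1) (i j : Fin d) (hij : i ≠ j) {s : ℤ} (hs : s = 1 ∨ s = -1)
    (hai : a i = s * (L + 1)) (hbj : b j = -1 * (L + 1)) :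
    Stage1 L a b := by
  have hsL : |s * (L + 3)| = L + 3 := by
    rcases hs with rfl | rfl <;> rw [abs_eq] <;> omega
  set a1 := Function.update a i (s * (L + 3)) with ha1
  have ha1k : a1 j = a j := by simp [ha1, hij.symm]
  have haj := abs_le.1 (ha j)
  have hbi := abs_le.1 (hb i)
  refine ⟨j, raySet L a i s ∪ legSet L a1 j 1, raySet L b j (-1),
    Function.update a1 j (1 * (L + 3)),
    Function.update b j (-1 * (L + 3)), Or.inl ⟨L + 1, by omega, by omega, by rw [← hai]; simp⟩,
    ⟨L + 1, by omega, by omega, by rw [← hbj]; simp⟩,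
    (ray_reach hs hai Set.subset_union_left).trans
      (leg_reach (by simp) (by rw [← ha1, ha1k, abs_le]; omega) Set.subset_union_right),
    (ray_reach (by simp) hbj le_rfl),
    by simp, by simp, ?_, ?_, ?_, ?_, ?_, ?_, ?_⟩
  · rintro _ (⟨v, h1, h2, rfl⟩ | ⟨v, h1, h2, rfl⟩)
    · simp only [Function.update_of_ne hij.symm]; omega
    · simp; omega
  · rintro _ ⟨v, h1, h2, rfl⟩
    simp; omega
  · have hcoord : ∀ (x : Fin d → ℤ), (∀ c, |x c| ≤ L + 1) → ∀ v c, |v| ≤ L + 3 →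
        |Function.update x i v c| ≤ L + 3 := by
      intro x hx v c hv
      have := hx c
      rw [Function.update_apply]; split_ifs <;> omega
    rintro _ (⟨v, h1, h2, rfl⟩ | ⟨v, h1, h2, rfl⟩) c
    · apply hcoord a ha; rcases hs with rfl | rfl <;> rw [abs_le] <;> omega
    · rw [Function.update_apply]; split_ifs
      · rw [abs_le]; omega
      · exact hcoord a ha _ _ hsL.le
  · rintro _ ⟨v, h1, h2, rfl⟩ c
    have := hb c
    rw [Function.update_apply]; split_ifs <;> (rw [abs_le] at *; omega)
  · rintro _ (⟨v, h1, h2, rfl⟩ | ⟨v, h1, h2, rfl⟩)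
    · by_cases hv : v = L + 1
      · left; rw [hv, ← hai]; simp
      · right; refine ⟨i, ?_⟩; simp only [Function.update_self]; rw [le_abs]
        rcases hs with rfl | rfl <;> omega
    · right; refine ⟨i, ?_⟩; simp only [Function.update_of_ne hij, ha1, Function.update_self]
      omega
  · rintro _ ⟨v, h1, h2, rfl⟩
    by_cases hv : v = L + 1
    · left; rw [hv, ← hbj]; simp
    · right; refine ⟨j, ?_⟩; simp only [Function.update_self]; rw [le_abs]; omega
  · rintro _ (⟨v, h1, h2, rfl⟩ | ⟨v, h1, h2, rfl⟩) _ ⟨w, h3, h4, rfl⟩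
    · apply two_le_of_dom hab
      intro c
      by_cases hci : c = i
      · subst hci
        simp only [Function.update_self, Function.update_of_ne hij]
        rw [hai]
        rw [abs_le, le_abs, neg_le, le_abs]
        rcases hs with rfl | rfl <;> omega
      by_cases hck : c = j
      · subst hck
        simp only [Function.update_self, Function.update_of_ne hci]
        rw [abs_le, le_abs, neg_le, le_abs]
        omega
      · simp only [Function.update_of_ne hci, Function.update_of_ne hck]
        exact le_rfl
    · apply two_le_of_coord i
      simp only [Function.update_of_ne hij, ha1, Function.update_self]
      rw [le_abs]
      rcases hs with rfl | rfl <;> omega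

lemma stage1_diffR {L : ℤ} (hL : 0 ≤ L) {a b : Fin d → ℤ} (hab : 2 ≤ norm1 (a - b))
    (ha : ∀ c, |a c| ≤ L + 1)
    (hb : ∀ c, |b c| ≤ L + 1) (i j : Fin d) (hij : i ≠ j) {s : ℤ} (hs : s = 1 ∨ s = -1)
    (hai : a i = s * (L + 1)) (hbj : b j = 1 * (L + 1)) :
    Stage1 L b a := by
  have hsL : |s * (L + 3)| = L + 3 := by
    rcases hs with rfl | rfl <;> rw [abs_eq] <;> omega
  set a1 := Function.update a i (s * (L + 3)) with ha1
  have ha1k : a1 j = a j := by simp [ha1, hij.symm]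
  have haj := abs_le.1 (ha j)
  have hbi := abs_le.1 (hb i)
  refine ⟨j, raySet L b j 1, raySet L a i s ∪ legSet L a1 j (-1),
    Function.update b j (1 * (L + 3)),
    Function.update a1 j (-1 * (L + 3)),
    ⟨L + 1, by omega, by omega, by rw [← hbj]; simp⟩,
    Or.inl ⟨L + 1, by omega, by omega, by rw [← hai]; simp⟩,
    (ray_reach (by simp) hbj le_rfl),
    (ray_reach hs hai Set.subset_union_left).trans
      (leg_reach (by simp) (by rw [← ha1, ha1k, abs_le]; omega) Set.subset_union_right),
    by simp, by simp, ?_, ?_, ?_, ?_, ?_, ?_, ?_⟩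
  · rintro _ ⟨v, h1, h2, rfl⟩
    simp; omega
  · rintro _ (⟨v, h1, h2, rfl⟩ | ⟨v, h1, h2, rfl⟩)
    · simp only [Function.update_of_ne hij.symm]; omega
    · simp; omega
  · rintro _ ⟨v, h1, h2, rfl⟩ c
    have := hb c
    rw [Function.update_apply]; split_ifs <;> (rw [abs_le] at *; omega)
  · have hcoord : ∀ (x : Fin d → ℤ), (∀ c, |x c| ≤ L + 1) → ∀ v c, |v| ≤ L + 3 →
        |Function.update x i v c| ≤ L + 3 := by
      intro x hx v c hv
      have := hx c
      rw [Function.update_apply]; split_ifs <;> omega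
    rintro _ (⟨v, h1, h2, rfl⟩ | ⟨v, h1, h2, rfl⟩) c
    · apply hcoord a ha; rcases hs with rfl | rfl <;> rw [abs_le] <;> omega
    · rw [Function.update_apply]; split_ifs
      · rw [abs_le]; omega
      · exact hcoord a ha _ _ hsL.le
  · rintro _ ⟨v, h1, h2, rfl⟩
    by_cases hv : v = L + 1
    · left; rw [hv, ← hbj]; simp
    · right; refine ⟨j, ?_⟩; simp only [Function.update_self]; rw [le_abs]; omega
  · rintro _ (⟨v, h1, h2, rfl⟩ | ⟨v, h1, h2, rfl⟩)
    · by_cases hv : v = L + 1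
      · left; rw [hv, ← hai]; simp
      · right; refine ⟨i, ?_⟩; simp only [Function.update_self]; rw [le_abs]
        rcases hs with rfl | rfl <;> omega
    · right; refine ⟨i, ?_⟩; simp only [Function.update_of_ne hij, ha1, Function.update_self]
      omega
  · rintro _ ⟨w, h3, h4, rfl⟩ _ (⟨v, h1, h2, rfl⟩ | ⟨v, h1, h2, rfl⟩)
    · rw [norm1_sub_comm]
      apply two_le_of_dom hab
      intro c
      by_cases hci : c = i
      · subst hci
        simp only [Function.update_self, Function.update_of_ne hij]
        rw [hai]
        rw [abs_le, le_abs, neg_le, le_abs]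
        rcases hs with rfl | rfl <;> omega
      by_cases hck : c = j
      · subst hck
        simp only [Function.update_self, Function.update_of_ne hci]
        rw [abs_le, le_abs, neg_le, le_abs]
        omega
      · simp only [Function.update_of_ne hci, Function.update_of_ne hck]
        exact le_rfl
    · apply two_le_of_coord i
      simp only [Function.update_of_ne hij, ha1, Function.update_self]
      rw [le_abs]
      rcases hs with rfl | rfl <;> omega

lemma stage1_all {L : ℤ} (hL : 0 ≤ L) {a b : Fin d → ℤ} (hab : 2 ≤ norm1 (a - b))
    (ha : ∀ c, |a c| ≤ L + 1) (hb : ∀ c, |b c| ≤ L + 1)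
    (ha' : ∃ i, L < |a i|) (hb' : ∃ j, L < |b j|) : Stage1 L a b ∨ Stage1 L b a := by
  have hab' : 2 ≤ norm1 (b - a) := by rw [norm1_sub_comm]; exact hab
  have sgn : ∀ (x : Fin d → ℤ) (i : Fin d), |x i| ≤ L + 1 → L < |x i| →
      ∃ s : ℤ, (s = 1 ∨ s = -1) ∧ x i = s * (L + 1) := by
    intro x i h1 h2
    rw [abs_le] at h1
    rw [lt_abs] at h2
    rcases h2 with h2 | h2
    · exact ⟨1, by simp, by omega⟩
    · exact ⟨-1, by simp, by omega⟩
  obtain ⟨i, hi⟩ := ha'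
  obtain ⟨j, hj⟩ := hb'
  obtain ⟨s, hs, hai⟩ := sgn a i (ha i) hi
  obtain ⟨t, ht, hbj⟩ := sgn b j (hb j) hj
  by_cases hij : i = j
  · subst hij
    by_cases hst : s = t
    · subst hst
      have : ∃ k, a k ≠ b k := by
        by_contra hcon
        push Not at hcon
        have : a = b := funext hcon
        subst this
        simp [norm1_zero] at hab
      obtain ⟨k, hk⟩ := this
      rcases lt_or_gt_of_ne hk with hk | hk
      · exact Or.inr (stage1_same hL hab' hb ha i hs hbj hai k hk)
      · exact Or.inl (stage1_same hL hab ha hb i hs hai hbj k hk)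
    · rcases hs with rfl | rfl <;> rcases ht with rfl | rfl
      · exact absurd rfl hst
      · exact Or.inl (stage1_opp hL ha hb i (by omega) (by omega))
      · exact Or.inr (stage1_opp hL hb ha i (by omega) (by omega))
      · exact absurd rfl hst
  · rcases ht with rfl | rfl
    · exact Or.inr (stage1_diffR hL hab ha hb i j hij hs hai hbj)
    · exact Or.inl (stage1_diffL hL hab ha hb i j hij hs hai hbj)

end Routing

open MeasureTheory

section Routing2
variable {d : ℕ}

lemma norm1_le_of_coord {x : Fin d → ℤ} {K : ℤ} (h : ∀ c, |x c| ≤ K) : norm1 x ≤ d * K :=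
  norm1_le_of_mem_Binf h

lemma norm1_eVec (hd : 2 ≤ d) (m : ℤ) : norm1 (eVec d m) = |m| := by
  unfold norm1
  rw [Finset.sum_eq_single (⟨0, by omega⟩ : Fin d)]
  · simp [eVec]
  · intro b _ hb
    have : (b : ℕ) ≠ 0 := fun h => hb (Fin.ext h)
    simp [eVec, this]
  · simp

lemma eVec_zero (hd : 2 ≤ d) (m : ℤ) : eVec d m ⟨0, by omega⟩ = m := by simp [eVec]

lemma neg_eVec (m : ℤ) : -eVec d m = eVec d (-m) := by
  funext i
  simp only [Pi.neg_apply, eVec]; split_ifs <;> simp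

/-- The polar cap together with the pole. -/
def cap (hd : 2 ≤ d) (M m : ℤ) : Set (Fin d → ℤ) :=
  {z | M ≤ z ⟨0, by omega⟩ ∧ (norm1 z < m ∨ z = eVec d m)}

lemma cap_reach (hd : 2 ≤ d) {M m : ℤ} (hM : 0 ≤ M) {z : Fin d → ℤ}
    (hz : z ∈ cap hd M m) (hm : norm1 z < m) : Reach (cap hd M m) z (eVec d m) := by
  classical
  have key : ∀ F : Finset (Fin d), (⟨0, by omega⟩ : Fin d) ∉ F →
      Reach (cap hd M m) z (fun i => if i ∈ F then 0 else z i) := by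
    intro F
    induction F using Finset.induction with
    | empty => intro _; simpa using Reach.refl z
    | insert j F hj ih =>
      intro h0
      rw [Finset.mem_insert, not_or] at h0
      refine (ih h0.2).trans ?_
      have e1 : (fun i => if i ∈ F then 0 else z i) =
          Function.update (fun i => if i ∈ F then 0 else z i) j (z j) := by
        funext i
        by_cases hi : i = j
        · rw [hi]; simp [hj]
        · rw [Function.update_of_ne hi]
      have e2 : (fun i => if i ∈ insert j F then 0 else z i) =
          Function.update (fun i => if i ∈ F then 0 else z i) j 0 := by
        funext i
        by_cases hi : i = j
        · rw [hi]; simp [hj]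
        · rw [Function.update_of_ne hi]; simp [hi]
      have hin : ∀ u, |u| ≤ |z j| →
          Function.update (fun i => if i ∈ F then 0 else z i) j u ∈ cap hd M m := by
        intro u hu
        refine ⟨?_, Or.inl (lt_of_le_of_lt (norm1_mono ?_) hm)⟩
        · rw [Function.update_of_ne h0.1]
          simp only [h0.2, if_false]
          exact hz.1
        · intro c
          rw [Function.update_apply]; split_ifs with h1 h2
          · rw [h1]; exact hu
          · simp
          · exact le_rfl
      rw [e2]
      conv_lhs => rw [e1]
      rcases le_total 0 (z j) with h | h
      · apply seg_down _ _ h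
        intro u h1 h2
        exact hin u (by rw [abs_of_nonneg h1, abs_of_nonneg h]; exact h2)
      · apply seg_up _ _ h
        intro u h1 h2
        exact hin u (by rw [abs_of_nonpos h2, abs_of_nonpos h]; omega)
  have h1 := key (Finset.univ.erase ⟨0, by omega⟩) (by simp)
  have e1 : (fun i => if i ∈ Finset.univ.erase (⟨0, by omega⟩ : Fin d) then 0 else z i) =
      Function.update (eVec d m) ⟨0, by omega⟩ (z ⟨0, by omega⟩) := by
    funext i
    rw [Function.update_apply]
    by_cases hi : i = ⟨0, by omega⟩
    · simp [hi]
    · have : (i : ℕ) ≠ 0 := fun h => hi (Fin.ext h)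
      simp [hi, eVec, this]
  have e2 : ∀ u, Function.update (eVec d m) (⟨0, by omega⟩ : Fin d) u = eVec d u := by
    intro u
    funext i
    rw [Function.update_apply]
    by_cases hi : i = ⟨0, by omega⟩
    · simp [hi, eVec]
    · have : (i : ℕ) ≠ 0 := fun h => hi (Fin.ext h)
      simp [hi, eVec, this]
  rw [e1] at h1
  refine h1.trans ?_
  have hz0 : z ⟨0, by omega⟩ < m := lt_of_le_of_lt ((le_abs_self _).trans (abs_le_norm1 z _)) hm
  have h2 : Reach (cap hd M m) (Function.update (eVec d m) ⟨0, by omega⟩ (z ⟨0, by omega⟩))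
      (Function.update (eVec d m) ⟨0, by omega⟩ m) := by
    apply seg_up _ _ hz0.le
    intro u h1 h2
    rw [e2]
    have := hz.1
    refine ⟨by rw [eVec_zero hd]; omega, ?_⟩
    rcases h2.lt_or_eq with h | h
    · left; rw [norm1_eVec hd, abs_of_nonneg (by omega)]; exact h
    · right; rw [h]
  rwa [e2 m] at h2

lemma Reach.neg {S : Set (Fin d → ℤ)} {u v : Fin d → ℤ} (h : Reach S u v) :
    Reach (-S) (-u) (-v) := by
  induction h with
  | refl => exact Reach.refl _
  | tail _ h ih =>
    refine ih.step ?_ (by simpa using h.2)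
    have := h.1.symm
    unfold Adj at *
    rw [neg_sub_neg]; exact this

/-- Two disjoint non-adjacent connections to the two poles. -/
lemma route {L : ℤ} (hd : 2 ≤ d) (hL : 0 ≤ L) {a b : Fin d → ℤ} (h : Stage1 L a b) (N : ℤ) :
    ∃ (m : ℤ) (A B : Set (Fin d → ℤ)), N < m ∧ 1 ≤ m ∧ a ∈ A ∧ b ∈ B ∧
      Reach A a (eVec d m) ∧ Reach B b (eVec d (-m)) ∧
      (∀ z ∈ A, z = a ∨ ∃ c, L + 2 ≤ |z c|) ∧ (∀ z ∈ B, z = b ∨ ∃ c, L + 2 ≤ |z c|) ∧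
      (∀ z ∈ A, norm1 z < m ∨ z = eVec d m) ∧ (∀ z ∈ B, norm1 z < m ∨ z = eVec d (-m)) ∧
      (∀ z ∈ A, ∀ w ∈ B, 2 ≤ norm1 (z - w)) := by
  obtain ⟨k, A1, B1, a', b', haA, hbB, hra, hrb, hak, hbk, hAk, hBk, hA3, hB3, hA, hB, hAB⟩ := h
  set o : Fin d := ⟨0, by omega⟩ with ho
  set M := L + 5 with hM
  set m := d * M + |N| + 1 with hm
  have hdM : (0 : ℤ) ≤ d * M := by positivity
  have hNabs := abs_nonneg N
  have hNle := le_abs_self N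
  have hdle : (d : ℤ) * (L + 3) ≤ d * M := by
    apply mul_le_mul_of_nonneg_left _ (by positivity); omega
  have ha' : ∀ c, |a' c| ≤ L + 3 := hA3 a' (hra.mem haA)
  have hb' : ∀ c, |b' c| ≤ L + 3 := hB3 b' (hrb.mem hbB)
  have ha'o := abs_le.1 (ha' o)
  have hb'o := abs_le.1 (hb' o)
  set A2 : Set (Fin d → ℤ) := {z | ∃ v, a' o ≤ v ∧ v ≤ M ∧ z = Function.update a' o v} with hA2
  set B2 : Set (Fin d → ℤ) := {z | ∃ v, -M ≤ v ∧ v ≤ b' o ∧ z = Function.update b' o v} with hB2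
  have hA2n : ∀ z ∈ A2, norm1 z < m := by
    rintro _ ⟨v, h1, h2, rfl⟩
    refine lt_of_le_of_lt (norm1_le_of_coord (K := M) fun c => ?_) (by omega)
    have := ha' c
    rw [Function.update_apply]; split_ifs
    · rw [abs_le]; omega
    · omega
  have hB2n : ∀ z ∈ B2, norm1 z < m := by
    rintro _ ⟨v, h1, h2, rfl⟩
    refine lt_of_le_of_lt (norm1_le_of_coord (K := M) fun c => ?_) (by omega)
    have := hb' c
    rw [Function.update_apply]; split_ifs
    · rw [abs_le]; omega
    · omega
  have hA2k : ∀ z ∈ A2, L + 3 ≤ z k := by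
    rintro _ ⟨v, h1, h2, rfl⟩
    rw [Function.update_apply]; split_ifs with h
    · rw [h] at hak; omega
    · omega
  have hB2k : ∀ z ∈ B2, z k ≤ -(L + 3) := by
    rintro _ ⟨v, h1, h2, rfl⟩
    rw [Function.update_apply]; split_ifs with h
    · rw [h] at hbk; omega
    · omega
  have hA2o : ∀ z ∈ A2, -(L + 3) ≤ z o := by
    rintro _ ⟨v, h1, h2, rfl⟩
    rw [Function.update_self]; omega
  have hB2o : ∀ z ∈ B2, z o ≤ L + 3 := by
    rintro _ ⟨v, h1, h2, rfl⟩
    rw [Function.update_self]; omega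
  have hB3' : ∀ z ∈ -cap hd M m, z o ≤ -M := by
    intro z hz
    have := hz.1
    simp only [Pi.neg_apply] at this
    rw [← ho] at this; omega
  have hA3' : ∀ z ∈ cap hd M m, M ≤ z o := fun z hz => hz.1
  have hA1o : ∀ z ∈ A1, -(L + 3) ≤ z o := fun z hz => (abs_le.1 (hA3 z hz o)).1
  have hB1o : ∀ z ∈ B1, z o ≤ L + 3 := fun z hz => (abs_le.1 (hB3 z hz o)).2
  refine ⟨m, A1 ∪ A2 ∪ cap hd M m, B1 ∪ B2 ∪ -cap hd M m, by omega, by omega,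
    Or.inl (Or.inl haA), Or.inl (Or.inl hbB), ?_, ?_, ?_, ?_, ?_, ?_, ?_⟩
  · have r1 : Reach (A1 ∪ A2 ∪ cap hd M m) a a' := hra.mono fun z hz => Or.inl (Or.inl hz)
    have r2 : Reach (A1 ∪ A2 ∪ cap hd M m) a' (Function.update a' o M) := by
      have : Reach A2 (Function.update a' o (a' o)) (Function.update a' o M) :=
        seg_up _ _ (by omega) fun u h1 h2 => ⟨u, h1, h2, rfl⟩
      rw [Function.update_eq_self] at this
      exact this.mono fun z hz => Or.inl (Or.inr hz)
    have hmem : Function.update a' o M ∈ A2 := ⟨M, by omega, le_rfl, rfl⟩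
    refine r1.trans (r2.trans ((cap_reach hd (by omega) ?_ (hA2n _ hmem)).mono
      Set.subset_union_right))
    exact ⟨by rw [← ho, Function.update_self], Or.inl (hA2n _ hmem)⟩
  · have r1 : Reach (B1 ∪ B2 ∪ -cap hd M m) b b' := hrb.mono fun z hz => Or.inl (Or.inl hz)
    have r2 : Reach (B1 ∪ B2 ∪ -cap hd M m) b' (Function.update b' o (-M)) := by
      have : Reach B2 (Function.update b' o (b' o)) (Function.update b' o (-M)) :=
        seg_down _ _ (by omega) fun u h1 h2 => ⟨u, h1, h2, rfl⟩
      rw [Function.update_eq_self] at this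
      exact this.mono fun z hz => Or.inl (Or.inr hz)
    have hmem : Function.update b' o (-M) ∈ B2 := ⟨-M, le_rfl, by omega, rfl⟩
    have hn : norm1 (-Function.update b' o (-M)) < m := by rw [norm1_neg]; exact hB2n _ hmem
    have r3 := (cap_reach hd (M := M) (m := m) (z := -Function.update b' o (-M)) (by omega)
      ⟨by rw [← ho, Pi.neg_apply, Function.update_self]; omega, Or.inl hn⟩ hn).neg
    rw [neg_neg, neg_eVec] at r3
    exact r1.trans (r2.trans (r3.mono Set.subset_union_right))
  · rintro z ((hz | hz) | hz)
    · exact hA z hz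
    · right; exact ⟨k, by have := hA2k z hz; rw [le_abs]; omega⟩
    · right; exact ⟨o, by have := hA3' z hz; rw [le_abs]; omega⟩
  · rintro z ((hz | hz) | hz)
    · exact hB z hz
    · right; exact ⟨k, by have := hB2k z hz; rw [le_abs]; omega⟩
    · right; exact ⟨o, by have := hB3' z hz; rw [le_abs]; omega⟩
  · rintro z ((hz | hz) | hz)
    · left; exact lt_of_le_of_lt (norm1_le_of_coord (hA3 z hz)) (by omega)
    · left; exact hA2n z hz
    · exact hz.2
  · rintro z ((hz | hz) | hz)
    · left; exact lt_of_le_of_lt (norm1_le_of_coord (hB3 z hz)) (by omega)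
    · left; exact hB2n z hz
    · have := hz.2
      rw [norm1_neg, neg_eq_iff_eq_neg, neg_eVec] at this; exact this
  · rintro z ((hz | hz) | hz) w ((hw | hw) | hw)
    · exact hAB z hz w hw
    · apply two_le_of_coord k
      have := hAk z hz; have := hB2k w hw; rw [le_abs]; omega
    · apply two_le_of_coord o
      have := hA1o z hz; have := hB3' w hw; rw [le_abs]; omega
    · apply two_le_of_coord k
      have := hA2k z hz; have := hBk w hw; rw [le_abs]; omega
    · apply two_le_of_coord k
      have := hA2k z hz; have := hB2k w hw; rw [le_abs]; omega
    · apply two_le_of_coord o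
      have := hA2o z hz; have := hB3' w hw; rw [le_abs]; omega
    · apply two_le_of_coord o
      have := hA3' z hz; have := hB1o w hw; rw [le_abs]; omega
    · apply two_le_of_coord o
      have := hA3' z hz; have := hB2o w hw; rw [le_abs]; omega
    · apply two_le_of_coord o
      have := hA3' z hz; have := hB3' w hw; rw [le_abs]; omega

end Routing2

/-! ### Rays and doubly infinite paths -/
section Rays
variable {d : ℕ}

/-- A one-sided infinite path in `S`. -/
def IsRay (S : Set (Fin d → ℤ)) (g : ℕ → Fin d → ℤ) : Prop :=
  Function.Injective g ∧ (∀ n, g n ∈ S) ∧ ∀ n, Adj (g n) (g (n + 1))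

lemma dip_of_rays {S : Set (Fin d → ℤ)} {g h : ℕ → Fin d → ℤ} (hg : IsRay S g) (hh : IsRay S h)
    (hdis : ∀ i j, g i ≠ h j) (hadj : Adj (g 0) (h 0)) : HasDoublyInfinitePath S := by
  refine ⟨fun i => match i with
    | Int.ofNat n => h n
    | Int.negSucc n => g n, ?_, ?_⟩
  · intro i j hij
    cases i with
    | ofNat n =>
      cases j with
      | ofNat k => exact congrArg Int.ofNat (hh.1 hij)
      | negSucc k => exact absurd hij.symm (hdis _ _)
    | negSucc n =>
      cases j with
      | ofNat k => exact absurd hij (hdis _ _)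
      | negSucc k => exact congrArg Int.negSucc (hg.1 hij)
  · intro i
    cases i with
    | ofNat n => exact ⟨hh.2.1 n, hh.2.2 n⟩
    | negSucc n =>
      refine ⟨hg.2.1 n, ?_⟩
      cases n with
      | zero => exact hadj
      | succ n => exact (hg.2.2 n).symm

lemma dip_of_reach {S : Set (Fin d → ℤ)} {g h : ℕ → Fin d → ℤ} (hg : IsRay S g) (hh : IsRay S h)
    (hdis : ∀ i j, g i ≠ h j) (hr : Reach S (g 0) (h 0)) : HasDoublyInfinitePath S := by
  have key : ∀ z, Reach S (g 0) z → HasDoublyInfinitePath S ∨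
      ∃ g', IsRay S g' ∧ (∀ i j, g' i ≠ h j) ∧ g' 0 = z := by
    intro z hz
    induction hz with
    | refl => exact Or.inr ⟨g, hg, hdis, rfl⟩
    | @tail b c hb hc ih =>
      rcases ih with ih | ⟨g', hg', hd', h0⟩
      · exact Or.inl ih
      by_cases hcH : ∃ j, h j = c
      · obtain ⟨j, rfl⟩ := hcH
        left
        have hh' : IsRay S fun n => h (j + n) :=
          ⟨fun a b hab => by have := hh.1 hab; omega, fun n => hh.2.1 _, fun n => hh.2.2 _⟩
        refine dip_of_rays hg' hh' (fun i k => hd' _ _) ?_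
        rw [h0]; exact hc.1
      · right
        by_cases hcg : ∃ j, g' j = c
        · obtain ⟨j, rfl⟩ := hcg
          exact ⟨fun n => g' (j + n), ⟨fun a b hab => by have := hg'.1 hab; omega,
            fun n => hg'.2.1 _, fun n => hg'.2.2 _⟩, fun i k => hd' _ _, rfl⟩
        · refine ⟨fun n => Nat.casesOn n c g', ⟨?_, ?_, ?_⟩, ?_, rfl⟩
          · intro a b hab
            cases a <;> cases b
            · rfl
            · exact absurd ⟨_, hab.symm⟩ hcg
            · exact absurd ⟨_, hab⟩ hcg
            · exact congrArg Nat.succ (hg'.1 hab)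
          · intro n
            cases n
            · exact hc.2
            · exact hg'.2.1 _
          · intro n
            cases n
            · simp only [h0]; exact hc.1.symm
            · exact hg'.2.2 _
          · intro i k
            cases i
            · exact fun hh => hcH ⟨k, hh.symm⟩
            · exact hd' _ _
  rcases key _ hr with h | ⟨g', _, h1, h2⟩
  · exact h
  · exact absurd h2 (h1 0 0)

lemma Binf_finite (r : ℤ) : (Binf d r).Finite := by
  apply (Set.finite_Icc (fun _ : Fin d => -r) (fun _ => r)).subset
  intro x hx
  exact ⟨fun i => (abs_le.1 (hx i)).1, fun i => (abs_le.1 (hx i)).2⟩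

lemma Binf_mono {r r' : ℤ} (h : r ≤ r') : Binf d r ⊆ Binf d r' := fun _ hx i => (hx i).trans h

/-- A ray started in the box leaves it; the exit point. -/
lemma exit_of_inj {g : ℕ → Fin d → ℤ} (hinj : Function.Injective g)
    (hadj : ∀ n, Adj (g n) (g (n + 1))) {L : ℤ} (h0 : g 0 ∈ Binf d L) :
    ∃ n, g (n + 1) ∉ Binf d L ∧ g (n + 1) ∈ Binf d (L + 1) ∧ ∀ k ≤ n, g k ∈ Binf d L := by
  classical
  have hex : ∃ n, g n ∉ Binf d L := by
    by_contra hcon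
    push Not at hcon
    exact Set.infinite_of_injective_forall_mem hinj hcon (Binf_finite L)
  obtain ⟨n, hn⟩ : ∃ n, Nat.find hex = n + 1 := by
    cases h : Nat.find hex with
    | zero => exact absurd h0 ((Nat.find_eq_zero hex).1 h)
    | succ n => exact ⟨n, rfl⟩
  have hlt : ∀ k ≤ n, g k ∈ Binf d L := by
    intro k hk
    have := Nat.find_min hex (m := k) (by omega)
    simpa using this
  refine ⟨n, hn ▸ Nat.find_spec hex, ?_, hlt⟩
  intro i
  have h1 := hlt n le_rfl i
  have h2 := (abs_le_norm1 _ i).trans (hadj n).le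
  rw [Pi.sub_apply] at h2
  rw [abs_le] at *
  omega

end Rays

open MeasureTheory

section Pattern
variable {d : ℕ}

lemma exits {r' : ℤ} (hr' : 1 ≤ r') {W E : Set (Fin d → ℤ)} (hE : E ⊆ Binf d r')
    (h1 : ¬ HasDoublyInfinitePath W) (h2 : HasDoublyInfinitePath (W ∪ E)) :
    ∃ (L : ℤ) (a b : Fin d → ℤ), r' ≤ L ∧ a ∈ W ∧ b ∈ W ∧
      a ∈ Binf d (L + 1) ∧ b ∈ Binf d (L + 1) ∧ a ∉ Binf d L ∧ b ∉ Binf d L ∧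
      ¬ Reach W a b ∧ Reach ((W ∩ Binf d L) ∪ {a, b} ∪ E) a b := by
  obtain ⟨f, hinj, hf⟩ := h2
  have hfin : {i | f i ∈ Binf d r'}.Finite := (Binf_finite r').preimage hinj.injOn
  obtain ⟨T0, hT0⟩ := hfin.bddAbove
  obtain ⟨T1, hT1⟩ := hfin.bddBelow
  obtain ⟨T, hT, hTpos⟩ : ∃ T : ℕ, (∀ i : ℤ, (T : ℤ) ≤ |i| → f i ∉ Binf d r') ∧ 0 < T := by
    refine ⟨(|T0| + |T1| + 1).toNat, fun i hi hmem => ?_, ?_⟩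
    · have a1 := hT0 hmem
      have a2 := hT1 hmem
      rw [Int.toNat_of_nonneg (by positivity)] at hi
      have := le_abs_self T0
      have := neg_abs_le T1
      have := abs_nonneg T0
      have := abs_nonneg T1
      rw [le_abs] at hi
      omega
    · have := abs_nonneg T0
      have := abs_nonneg T1
      omega
  have hW : ∀ i : ℤ, (T : ℤ) ≤ |i| → f i ∈ W := by
    intro i hi
    rcases (hf i).1 with h | h
    · exact h
    · exact absurd (hE h) (hT i hi)
  -- the box containing the middle part
  obtain ⟨L, hLr, hL⟩ : ∃ L : ℤ, r' ≤ L ∧ ∀ i : ℤ, |i| ≤ T → f i ∈ Binf d L := by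
    have hfin2 : ((fun i => norm1 (f i)) '' Set.Icc (-(T : ℤ)) T).Finite :=
      (Set.finite_Icc _ _).image _
    obtain ⟨N, hN⟩ := hfin2.bddAbove
    refine ⟨max N r', le_max_right _ _, fun i hi c => ?_⟩
    have := hN ⟨i, abs_le.1 hi, rfl⟩
    exact (abs_le_norm1 _ c).trans (this.trans (le_max_left _ _))
  set gp : ℕ → Fin d → ℤ := fun n => f (T + n) with hgp
  set gm : ℕ → Fin d → ℤ := fun n => f (-T - n) with hgm
  have hpinj : Function.Injective gp := fun a b hab => by
    have := hinj hab; omega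
  have hminj : Function.Injective gm := fun a b hab => by
    have := hinj hab; omega
  have hpadj : ∀ n, Adj (gp n) (gp (n + 1)) := by
    intro n
    have := (hf (T + n)).2
    simp only [hgp]; push_cast
    rw [← add_assoc]; exact this
  have hmadj : ∀ n, Adj (gm n) (gm (n + 1)) := by
    intro n
    have := (hf (-T - (n + 1))).2.symm
    simp only [hgm]; push_cast
    rw [show (-(T : ℤ) - (n + 1) + 1) = -T - n by ring] at this
    exact this
  have hpray : IsRay W gp := ⟨hpinj, fun n => hW _ (by rw [le_abs]; omega), hpadj⟩
  have hmray : IsRay W gm := ⟨hminj, fun n => hW _ (by rw [le_abs]; omega), hmadj⟩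
  have hdis : ∀ i j, gp i ≠ gm j := fun i j hij => by
    have := hinj hij; omega
  have hnr : ¬ Reach W (gp 0) (gm 0) := fun h => h1 (dip_of_reach hpray hmray hdis h)
  obtain ⟨n, hn1, hn2, hn3⟩ := exit_of_inj hpinj hpadj (L := L)
    (hL _ (by simp))
  obtain ⟨k, hk1, hk2, hk3⟩ := exit_of_inj hminj hmadj (L := L)
    (hL _ (by simp))
  have rayreach : ∀ (g : ℕ → Fin d → ℤ), IsRay W g → ∀ n, Reach W (g 0) (g n) := by
    intro g hg n
    induction n with
    | zero => exact Reach.refl _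
    | succ n ih => exact ih.step (hg.2.2 n) (hg.2.1 _)
  refine ⟨L, gp (n + 1), gm (k + 1), hLr, hpray.2.1 _, hmray.2.1 _, hn2, hk2, hn1, hk1, ?_, ?_⟩
  · intro h
    apply hnr
    exact (rayreach gp hpray _).trans (h.trans ((rayreach gm hmray _).symm (hmray.2.1 _)))
  · -- go along `f`
    set S := (W ∩ Binf d L) ∪ {gp (n + 1), gm (k + 1)} ∪ E with hS
    have hin : ∀ i : ℤ, -T - (k + 1) ≤ i → i ≤ T + (n + 1) → f i ∈ S := by
      intro i hi1 hi2
      by_cases e1 : i = T + (n + 1)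
      · left; right; left; rw [e1, hgp]; push_cast; rfl
      by_cases e2 : i = -T - (k + 1)
      · left; right; right; rw [e2, hgm]; push_cast; rfl
      have hB : f i ∈ Binf d L := by
        by_cases e3 : |i| ≤ T
        · exact hL i e3
        · rw [not_le, lt_abs] at e3
          rcases e3 with e3 | e3
          · have := hn3 (i - T).toNat (by omega)
            simp only [hgp] at this
            rwa [Int.toNat_of_nonneg (by omega), add_sub_cancel] at this
          · have := hk3 (-i - T).toNat (by omega)
            simp only [hgm] at this
            rwa [Int.toNat_of_nonneg (by omega), show (-(T : ℤ) - (-i - T)) = i by ring] at this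
      rcases (hf i).1 with h | h
      · left; left; exact ⟨h, hB⟩
      · right; exact h
    have go : ∀ j : ℕ, (j : ℤ) ≤ (T + (n + 1)) - (-T - (k + 1)) →
        Reach S (gm (k + 1)) (f (-T - (k + 1) + j)) := by
      intro j
      induction j with
      | zero =>
        intro _
        have : gm (k + 1) = f (-T - (k + 1) + (0 : ℕ)) := by
          simp only [hgm]; push_cast; rw [add_zero]
        rw [this]; exact Reach.refl _
      | succ j ih =>
        intro hj
        push_cast at hj ⊢
        rw [← add_assoc]
        refine (ih (by omega)).step (hf _).2 (hin _ (by omega) (by omega))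
    have h3 := go (T + (n + 1) + T + (k + 1)) (by push_cast; omega)
    rw [show (-(T : ℤ) - (k + 1) + ((T + (n + 1) + T + (k + 1) : ℕ) : ℤ)) = T + ((n + 1 : ℕ) : ℤ) by
      push_cast; ring] at h3
    exact Reach.symm h3 (by left; right; right; rfl)

/-- The finite pattern that is activated by the enhancement at the origin. -/
lemma pattern_exists (hd : 2 ≤ d) {r' : ℤ} (hr' : 1 ≤ r')
    (E0 : Set (Fin d → ℤ) → Set (Fin d → ℤ))
    (hloc : ∀ ω ω' : Set (Fin d → ℤ), ω ∩ Binf d r' = ω' ∩ Binf d r' → E0 ω = E0 ω')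
    (hrange : ∀ ω : Set (Fin d → ℤ), E0 ω ⊆ Binf d r')
    (hess : ∃ ω : Set (Fin d → ℤ),
      ¬ HasDoublyInfinitePath ω ∧ HasDoublyInfinitePath (ω ∪ E0 ω)) :
    ∃ (m : ℤ) (S : Set (Fin d → ℤ)), 1 ≤ m ∧ d * r' < m ∧
      (∀ z ∈ S, norm1 z < m ∨ z = eVec d m ∨ z = eVec d (-m)) ∧
      eVec d m ∈ S ∧ eVec d (-m) ∈ S ∧ ¬ Reach S (eVec d m) (eVec d (-m)) ∧
      Reach (S ∪ E0 S) (eVec d m) (eVec d (-m)) := by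
  obtain ⟨W, hW1, hW2⟩ := hess
  obtain ⟨L, a, b, hLr, haW, hbW, haB, hbB, haL, hbL, hnr, hr⟩ :=
    exits hr' (hrange W) hW1 hW2
  have hab : 2 ≤ norm1 (a - b) := by
    by_contra hcon
    push Not at hcon
    have h0 := norm1_nonneg (a - b)
    have : norm1 (a - b) = 0 ∨ norm1 (a - b) = 1 := by omega
    rcases this with h | h
    · have : a = b := by
        funext i
        have := abs_le_norm1 (a - b) i
        rw [h, Pi.sub_apply] at this
        have := abs_eq_zero.1 (le_antisymm this (abs_nonneg _))
        omega
      rw [this] at hnr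
      exact hnr (Reach.refl _)
    · exact hnr (Reach.single h hbW)
  -- symmetric core
  have core : ∀ a b : Fin d → ℤ, a ∈ W → b ∈ W → a ∉ Binf d L → b ∉ Binf d L →
      ¬ Reach W a b → Reach ((W ∩ Binf d L) ∪ {a, b} ∪ E0 W) a b → Stage1 L a b →
      ∃ (m : ℤ) (S : Set (Fin d → ℤ)), 1 ≤ m ∧ d * r' < m ∧
      (∀ z ∈ S, norm1 z < m ∨ z = eVec d m ∨ z = eVec d (-m)) ∧
      eVec d m ∈ S ∧ eVec d (-m) ∈ S ∧ ¬ Reach S (eVec d m) (eVec d (-m)) ∧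
      Reach (S ∪ E0 S) (eVec d m) (eVec d (-m)) := by
    clear hr hnr hab haL hbL haB hbB haW hbW a b
    intro a b haW hbW haL hbL hnr hr hst
    obtain ⟨m, A, B, hm, hm1, haA, hbB, hrA, hrB, hA, hB, hAm, hBm, hAB⟩ :=
      route hd (by omega) hst (d * L)
    have hdL : (d : ℤ) * r' ≤ d * L := mul_le_mul_of_nonneg_left hLr (by positivity)
    have hAout : ∀ z ∈ A, z ∉ Binf d L := by
      intro z hz hzL
      rcases hA z hz with rfl | ⟨c, hc⟩
      · exact haL hzL
      · have := hzL c; omega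
    have hBout : ∀ z ∈ B, z ∉ Binf d L := by
      intro z hz hzL
      rcases hB z hz with rfl | ⟨c, hc⟩
      · exact hbL hzL
      · have := hzL c; omega
    have hnear : ∀ z w : Fin d → ℤ, (∃ c, L + 2 ≤ |z c|) → w ∈ Binf d L → ¬ Adj z w := by
      rintro z w ⟨c, hc⟩ hw hadj
      have h1 := hw c
      have h2 := (abs_le_norm1 _ c).trans hadj.le
      rw [Pi.sub_apply] at h2
      rw [abs_le] at h1 h2
      rw [le_abs] at hc
      omega
    set S : Set (Fin d → ℤ) := (W ∩ Binf d L) ∪ A ∪ B with hS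
    have hES : E0 S = E0 W := by
      apply hloc
      ext z
      constructor
      · rintro ⟨(h | h) | h, hz⟩
        · exact ⟨h.1, hz⟩
        · exact absurd (Binf_mono hLr hz) (hAout z h)
        · exact absurd (Binf_mono hLr hz) (hBout z h)
      · rintro ⟨h, hz⟩
        exact ⟨Or.inl (Or.inl ⟨h, Binf_mono hLr hz⟩), hz⟩
    have heA := hrA.mem haA
    have heB := hrB.mem hbB
    refine ⟨m, S, hm1, by omega, ?_, Or.inl (Or.inr heA), Or.inr heB, ?_, ?_⟩
    · rintro z ((h | h) | h)
      · left; exact lt_of_le_of_lt (norm1_le_of_mem_Binf h.2) hm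
      · rcases hAm z h with h | h <;> simp [h]
      · rcases hBm z h with h | h <;> simp [h]
    · intro hcon
      have hK := Reach.closed (K := ({z | Reach W a z} ∩ Binf d L) ∪ A) hcon (Or.inr heA) ?_
      · rcases hK with h | h
        · exact hBout _ heB h.2
        · have := hAB _ h _ heB
          simp [norm1_zero] at this
      · rintro u (hu | hu) w ((hw | hw) | hw) hadj
        · exact Or.inl ⟨Reach.step hu.1 hadj hw.1, hw.2⟩
        · exact Or.inr hw
        · exfalso
          rcases hB w hw with rfl | h
          · exact hnr (Reach.step hu.1 hadj hbW)
          · exact hnear _ _ h hu.2 hadj.symm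
        · left
          rcases hA u hu with rfl | h
          · exact ⟨Reach.single hadj hw.1, hw.2⟩
          · exact absurd hadj (hnear _ _ h hw.2)
        · exact Or.inr hw
        · exfalso
          have := hAB u hu w hw
          unfold Adj at hadj
          omega
    · rw [hES]
      have i1 : Reach (S ∪ E0 W) (eVec d m) a :=
        (hrA.symm haA).mono fun z hz => Or.inl (Or.inl (Or.inr hz))
      have i2 : Reach (S ∪ E0 W) b (eVec d (-m)) :=
        hrB.mono fun z hz => Or.inl (Or.inr hz)
      refine i1.trans (Reach.trans (hr.mono ?_) i2)
      rintro z ((h | h) | h)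
      · exact Or.inl (Or.inl (Or.inl h))
      · rcases h with rfl | h
        · exact Or.inl (Or.inl (Or.inr haA))
        · rw [Set.mem_singleton_iff] at h
          rw [h]; exact Or.inl (Or.inr hbB)
      · exact Or.inr h
  have hex : ∀ a : Fin d → ℤ, a ∉ Binf d L → ∃ i, L < |a i| := by
    intro a ha
    by_contra hcon
    push Not at hcon
    exact ha hcon
  rcases stage1_all (by omega) hab haB hbB (hex a haL) (hex b hbL) with hst | hst
  · exact core a b haW hbW haL hbL hnr hr hst
  · refine core b a hbW haW hbL haL (fun h => hnr (h.symm hbW)) ?_ hst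
    rw [Set.pair_comm]
    exact hr.symm (Or.inl (Or.inr (by simp)))

end Pattern

/-! ### The local modification lemma -/

section Modify
variable {d : ℕ}

/-- The path-modification property for a fixed pair of radii. -/
def PMP (d : ℕ) (m r : ℤ) : Prop :=
    ∀ (PR PG : List (Fin d → ℤ)) (hRne : PR ≠ []) (hGne : PG ≠ []),
      IsInducedPath PR → IsInducedPath PG →
      norm1 (PR.head hRne) > r + 2 → norm1 (PG.head hGne) > r + 2 →
      Adj (PR.getLast hRne) 0 → Adj (PG.getLast hGne) 0 →
      (0 : Fin d → ℤ) ∉ PR → (0 : Fin d → ℤ) ∉ PG →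
      (∀ x ∈ PR, ∀ y ∈ PG, ¬ Adj x y) →
      ∃ (QR QG : List (Fin d → ℤ)) (hQRne : QR ≠ []) (hQGne : QG ≠ []),
        IsInducedPath QR ∧ IsInducedPath QG ∧
        QR.head hQRne = PR.head hRne ∧
        QG.head hQGne = PG.head hGne ∧
        (∀ x : Fin d → ℤ, norm1 x > r → (x ∈ QR ↔ x ∈ PR)) ∧
        (∀ x : Fin d → ℤ, norm1 x > r → (x ∈ QG ↔ x ∈ PG)) ∧
        ((QR.getLast hQRne = eVec d m ∧ QG.getLast hQGne = eVec d (-m)) ∨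
          (QR.getLast hQRne = eVec d (-m) ∧ QG.getLast hQGne = eVec d m)) ∧
        (∀ x ∈ QR, norm1 x ≤ m → x = QR.getLast hQRne) ∧
        (∀ x ∈ QG, norm1 x ≤ m → x = QG.getLast hQGne) ∧
        (∀ x ∈ QR, ∀ y ∈ QG, ¬ Adj x y)

lemma PMP.of_property (h : PathModificationProperty d) {m : ℤ} (hm : 1 ≤ m) :
    ∃ r : ℤ, m ≤ r ∧ PMP d m r := by
  obtain ⟨r, hr, h⟩ := h m hm
  refine ⟨max r m, le_max_right _ _, ?_⟩
  intro PR PG hRne hGne h1 h2 h3 h4 h5 h6 h7 h8 h9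
  have := le_max_left r m
  obtain ⟨QR, QG, a, b, c1, c2, c3, c4, c5, c6, c7⟩ := h PR PG hRne hGne h1 h2 (by omega) (by omega)
    h5 h6 h7 h8 h9
  exact ⟨QR, QG, a, b, c1, c2, c3, c4, fun x hx => c5 x (by omega), fun x hx => c6 x (by omega), c7⟩

/-- The rewired configuration. -/
def rewire (r : ℤ) (x : Fin d → ℤ) (σ Q : Set (Fin d → ℤ)) : Set (Fin d → ℤ) :=
  {z | (r + 2 < norm1 (z - x) ∧ z ∈ σ) ∨ (norm1 (z - x) ≤ r + 2 ∧ z - x ∈ Q)}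

lemma modify_aux {m r n : ℤ} (hmr : m ≤ r) {S T : Set (Fin d → ℤ)} (hST : S ⊆ T)
    {eR eG : Fin d → ℤ}
    (hS : ∀ z ∈ S, norm1 z < m ∨ z = eR ∨ z = eG)
    (heR : eR ∈ S) (heG : eG ∈ S) (hnR : norm1 eR = m) (hnG : norm1 eG = m)
    (hno : ¬ Reach S eR eG) (hyes : Reach T eR eG) (hT : ∀ z ∈ T, norm1 z ≤ m)
    {x y : Fin d → ℤ} (hx1 : r + 2 < norm1 x) (hx2 : norm1 x + (r + 2) < n) (hy : norm1 y = n)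
    {σ CR CG : Set (Fin d → ℤ)} (h0 : 0 ∈ CR)
    (hCR : ∀ z ∈ CR, z ∈ σ ∧ norm1 z < n)
    (hCG : ∀ z ∈ CG, z ∈ σ ∧ norm1 z ≤ n)
    (hclosed : ∀ a ∈ CR, ∀ b ∈ σ, Adj a b → b ∈ CR)
    (hcross : ∀ a ∈ CR, ∀ b ∈ CG, ¬ Adj a b)
    {QR QG : List (Fin d → ℤ)} (hR : QR ≠ []) (hG : QG ≠ [])
    (hRc : QR.IsChain Adj) (hGc : QG.IsChain Adj)
    (hRh : QR.head hR = 0 - x) (hGh : QG.head hG = y - x)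
    (hRp : ∀ z ∈ QR, r < norm1 z → z + x ∈ CR)
    (hGp : ∀ z ∈ QG, r < norm1 z → z + x ∈ CG)
    (hRl : QR.getLast hR = eR) (hGl : QG.getLast hG = eG)
    (hRm : ∀ z ∈ QR, norm1 z ≤ m → z = eR)
    (hGm : ∀ z ∈ QG, norm1 z ≤ m → z = eG)
    (hQ : ∀ a ∈ QR, ∀ b ∈ QG, ¬ Adj a b) :
    ∃ Q : Set (Fin d → ℤ), S ⊆ Q ∧ (∀ z, norm1 z < m → (z ∈ Q ↔ z ∈ S)) ∧
      ¬ Arm n (rewire r x σ Q) ∧ Arm n (rewire r x σ Q ∪ (fun z => z + x) '' T) := by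
  have heRQ : eR ∈ QR := hRl ▸ List.getLast_mem hR
  have heGQ : eG ∈ QG := hGl ▸ List.getLast_mem hG
  set Q : Set (Fin d → ℤ) := {z | z ∈ QR ∨ z ∈ QG ∨ z ∈ S} with hQdef
  have hSm : ∀ z ∈ S, norm1 z ≤ m := by
    intro z hz
    rcases hS z hz with h | rfl | rfl <;> omega
  have hx0 : norm1 (0 - x) = norm1 x := by rw [zero_sub, norm1_neg]
  have hball : ∀ z, norm1 (z - x) ≤ r + 2 → norm1 z < n := by
    intro z hz
    have := norm1_tri z x
    omega
  have h0s : (0 : Fin d → ℤ) ∈ rewire r x σ Q := Or.inl ⟨by rw [hx0]; omega, (hCR 0 h0).1⟩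
  refine ⟨Q, fun z hz => Or.inr (Or.inr hz), ?_, ?_, ?_⟩
  · intro z hz
    constructor
    · rintro (h | h | h)
      · exact hRm z h hz.le ▸ heR
      · exact hGm z h hz.le ▸ heG
      · exact h
    · intro h; exact Or.inr (Or.inr h)
  · rintro ⟨-, y', hy', hreach⟩
    have hK := hreach.closed (K := {z | (r + 2 < norm1 (z - x) ∧ z ∈ CR) ∨
      (norm1 (z - x) ≤ r + 2 ∧ (z - x ∈ QR ∨ (z - x ∈ S ∧ Reach S eR (z - x))))})
      (Or.inl ⟨by rw [hx0]; omega, h0⟩) ?_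
    · rcases hK with ⟨-, h⟩ | ⟨h, -⟩
      · have := (hCR _ h).2; omega
      · have := hball _ h; omega
    · rintro a ha b ⟨hb, hbn⟩ hab
      have hab' := (adj_sub_iff x).2 hab
      have hn1 := hab'.norm_le
      have hn2 := hab'.symm.norm_le
      rcases ha with ⟨ha1, ha2⟩ | ⟨ha1, ha2⟩
      · rcases hb with ⟨hb1, hb2⟩ | ⟨hb1, hb2 | hb2 | hb2⟩
        · exact Or.inl ⟨hb1, hclosed a ha2 b hb2 hab⟩
        · exact Or.inr ⟨hb1, Or.inl hb2⟩
        · have := hGp _ hb2 (by omega)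
          rw [sub_add_cancel] at this
          exact absurd hab (hcross a ha2 b this)
        · have := hSm _ hb2; omega
      · rcases ha2 with ha2 | ⟨ha2, ha3⟩
        · rcases hb with ⟨hb1, hb2⟩ | ⟨hb1, hb2 | hb2 | hb2⟩
          · have := hRp _ ha2 (by omega)
            rw [sub_add_cancel] at this
            exact Or.inl ⟨hb1, hclosed a this b hb2 hab⟩
          · exact Or.inr ⟨hb1, Or.inl hb2⟩
          · exact absurd hab' (hQ _ ha2 _ hb2)
          · refine Or.inr ⟨hb1, ?_⟩
            rcases hS _ hb2 with h | h | h
            · have := hRm _ ha2 (by omega)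
              rw [this] at hab'
              exact Or.inr ⟨hb2, Reach.single hab' hb2⟩
            · exact Or.inl (h ▸ heRQ)
            · rw [h] at hab'
              exact absurd hab' (hQ _ ha2 _ heGQ)
        · rcases hb with ⟨hb1, hb2⟩ | ⟨hb1, hb2 | hb2 | hb2⟩
          · have := hSm _ ha2; omega
          · exact Or.inr ⟨hb1, Or.inl hb2⟩
          · exfalso
            by_cases hbm : norm1 (b - x) ≤ m
            · have := hGm _ hb2 hbm
              rw [this] at hab'
              exact hno (ha3.step hab' heG)
            · rcases hS _ ha2 with h | h | h
              · omega
              · rw [h] at hab'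
                exact hQ _ heRQ _ hb2 hab'
              · rw [h] at ha3; exact hno ha3
          · exact Or.inr ⟨hb1, Or.inr ⟨hb2, ha3.step hab' hb2⟩⟩
  · refine ⟨Or.inl h0s, y, hy, ?_⟩
    set Sg : Set (Fin d → ℤ) := (rewire r x σ Q ∪ (fun z => z + x) '' T) ∩ {z | norm1 z ≤ n}
    have hQRm : ∀ z ∈ QR, z + x ∈ Sg := by
      intro z hz
      by_cases h : norm1 z ≤ r + 2
      · exact ⟨Or.inl (Or.inr ⟨by simpa using h, by rw [add_sub_cancel_right]; exact Or.inl hz⟩),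
          (hball _ (by simpa using h)).le⟩
      · have := hRp z hz (by omega)
        exact ⟨Or.inl (Or.inl ⟨by simpa using h, (hCR _ this).1⟩), (hCR _ this).2.le⟩
    have hQGm : ∀ z ∈ QG, z + x ∈ Sg := by
      intro z hz
      by_cases h : norm1 z ≤ r + 2
      · exact ⟨Or.inl (Or.inr ⟨by simpa using h, by rw [add_sub_cancel_right]; exact Or.inr (Or.inl hz)⟩),
          (hball _ (by simpa using h)).le⟩
      · have := hGp z hz (by omega)
        exact ⟨Or.inl (Or.inl ⟨by simpa using h, (hCG _ this).1⟩), (hCG _ this).2⟩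
    have hTm : ∀ z ∈ T, z + x ∈ Sg := by
      intro z hz
      exact ⟨Or.inr ⟨z, hz, rfl⟩, (hball _ (by have := hT z hz; simp; omega)).le⟩
    have r1 := (reach_of_chain QR hR hRc (S := {z | z ∈ QR}) (fun z hz => hz) heRQ).translate x hQRm
    have r2 := hyes.translate x hTm
    have r3 := (reach_of_chain QG hG hGc (S := {z | z ∈ QG}) (fun z hz => hz) heGQ).translate x hQGm
    have r3' := r3.symm (hQGm _ (List.head_mem hG))
    rw [hRh] at r1
    rw [hGh] at r3'
    simp only [sub_add_cancel] at r1 r3'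
    exact (r1.trans r2).trans r3'

lemma local_modify {m r n : ℤ} (hd : 2 ≤ d) (hm : 1 ≤ m) (hmr : m ≤ r) (hP : PMP d m r)
    {S T : Set (Fin d → ℤ)} (hST : S ⊆ T)
    (hS : ∀ z ∈ S, norm1 z < m ∨ z = eVec d m ∨ z = eVec d (-m))
    (he1 : eVec d m ∈ S) (he2 : eVec d (-m) ∈ S)
    (hno : ¬ Reach S (eVec d m) (eVec d (-m))) (hyes : Reach T (eVec d m) (eVec d (-m)))
    (hT : ∀ z ∈ T, norm1 z ≤ m)
    {x : Fin d → ℤ} (hx1 : r + 2 < norm1 x) (hx2 : norm1 x + (r + 2) < n)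
    {σ : Set (Fin d → ℤ)} (hxσ : x ∉ σ) (h1 : Arm n (insert x σ)) (h0 : ¬ Arm n σ) :
    ∃ Q : Set (Fin d → ℤ), S ⊆ Q ∧ (∀ z, norm1 z < m → (z ∈ Q ↔ z ∈ S)) ∧
      ¬ Arm n (rewire r x σ Q) ∧ Arm n (rewire r x σ Q ∪ (fun z => z + x) '' T) := by
  obtain ⟨h00, y, hy, hreach⟩ := h1
  have h0σ : (0 : Fin d → ℤ) ∈ σ := by
    rcases h00 with h | h
    · rw [← h, norm1_zero] at hx1; omega
    · exact h
  have hxy : y ≠ x := by rintro rfl; omega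
  have hn0 : 0 ≤ n := by have := norm1_nonneg y; omega
  have h0B : (0 : Fin d → ℤ) ∈ σ ∩ {z | norm1 z ≤ n} := ⟨h0σ, by simpa [norm1_zero] using hn0⟩
  have hyB : y ∈ σ ∩ {z | norm1 z ≤ n} := by
    have := hreach.mem (by exact ⟨h00, by simpa [norm1_zero] using hn0⟩)
    exact ⟨this.1.resolve_left hxy, this.2⟩
  have hn : ∀ z, Reach (σ ∩ {z | norm1 z ≤ n}) 0 z → norm1 z ≠ n := fun z hz hzn =>
    h0 ⟨h0σ, z, hzn, hz⟩
  set CR : Set (Fin d → ℤ) := {z | Reach (σ ∩ {z | norm1 z ≤ n}) 0 z} with hCRd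
  set CG : Set (Fin d → ℤ) := {z | Reach (σ ∩ {z | norm1 z ≤ n}) y z} with hCGd
  have hCR : ∀ z ∈ CR, z ∈ σ ∧ norm1 z < n := by
    intro z hz
    have h1 := Reach.mem hz h0B
    have h2 := hn z hz
    have h3 : norm1 z ≤ n := h1.2
    exact ⟨h1.1, by omega⟩
  have hCG : ∀ z ∈ CG, z ∈ σ ∧ norm1 z ≤ n := fun z hz => Reach.mem hz hyB
  have hcross : ∀ a ∈ CR, ∀ b ∈ CG, ¬ Adj a b := by
    intro a ha b hb hab
    have : Reach (σ ∩ {z | norm1 z ≤ n}) 0 b := Reach.step ha hab (hCG b hb)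
    exact hn y (this.trans (Reach.symm hb hyB)) hy
  have hclosed : ∀ a ∈ CR, ∀ b ∈ σ, Adj a b → b ∈ CR := by
    intro a ha b hb hab
    have h1 := (hCR a ha).2
    have h2 := hab.symm.norm_le
    exact Reach.step ha hab ⟨hb, by simp only [Set.mem_ofPred_eq]; omega⟩
  have hxR : ∃ u ∈ CR, Adj u x := by
    by_contra hcon
    push Not at hcon
    have := hreach.closed (K := CR) (Reach.refl _) (by
      rintro a ha b ⟨hb | hb, hb2⟩ hab
      · exact absurd (hb ▸ hab) (hcon a ha)
      · exact hclosed a ha b hb hab)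
    exact hn y this hy
  have hxG : ∃ u ∈ CG, Adj u x := by
    by_contra hcon
    push Not at hcon
    have hs := hreach.symm ⟨h00, by simpa [norm1_zero] using hn0⟩
    have := hs.closed (K := CG) (Reach.refl _) (by
      rintro a ha b ⟨hb | hb, hb2⟩ hab
      · exact absurd (hb ▸ hab) (hcon a ha)
      · exact Reach.step ha hab ⟨hb, hb2⟩)
    exact hn y (Reach.symm this hyB) hy
  obtain ⟨u, hu, hux⟩ := hxR
  obtain ⟨v, hv, hvx⟩ := hxG
  have hu' : Reach CR 0 u := by
    have : ∀ z, Reach (σ ∩ {z | norm1 z ≤ n}) 0 z → Reach CR 0 z := by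
      intro z hz
      induction hz with
      | refl => exact Reach.refl _
      | tail hb hc ih => exact ih.step hc.1 (Reach.step hb hc.1 hc.2)
    exact this u hu
  have hv' : Reach CG y v := by
    have : ∀ z, Reach (σ ∩ {z | norm1 z ≤ n}) y z → Reach CG y z := by
      intro z hz
      induction hz with
      | refl => exact Reach.refl _
      | tail hb hc ih => exact ih.step hc.1 (Reach.step hb hc.1 hc.2)
    exact this v hv
  obtain ⟨PR, hPR, hPRi, hPRh, hPRl, hPRs⟩ := hu'.exists_ind (Reach.refl _)
  obtain ⟨PG, hPG, hPGi, hPGh, hPGl, hPGs⟩ := hv'.exists_ind (Reach.refl _)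
  have hyx : r + 2 < norm1 (y - x) := by have := norm1_tri y x; omega
  obtain ⟨QR, QG, hQR, hQG, hQRi, hQGi, hQRh, hQGh, hQRa, hQGa, hends, hQRm, hQGm, hQ⟩ :=
    hP (PR.map (· - x)) (PG.map (· - x)) (by simpa using hPR) (by simpa using hPG)
    ((hPRi.map_sub x).isInduced (by simpa using hPR))
    ((hPGi.map_sub x).isInduced (by simpa using hPG))
    (by rw [List.head_map, hPRh, zero_sub, norm1_neg]; exact hx1)
    (by rw [List.head_map, hPGh]; exact hyx)
    (by rw [List.getLast_map, hPRl, ← sub_self x, adj_sub_iff]; exact hux)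
    (by rw [List.getLast_map, hPGl, ← sub_self x, adj_sub_iff]; exact hvx)
    (by
      intro h
      obtain ⟨z, hz, hzx⟩ := List.mem_map.1 h
      rw [sub_eq_zero] at hzx
      exact hxσ (hzx ▸ (hCR z (hPRs z hz)).1))
    (by
      intro h
      obtain ⟨z, hz, hzx⟩ := List.mem_map.1 h
      rw [sub_eq_zero] at hzx
      exact hxσ (hzx ▸ (hCG z (hPGs z hz)).1))
    (by
      intro a ha b hb
      obtain ⟨a, ha', rfl⟩ := List.mem_map.1 ha
      obtain ⟨b, hb', rfl⟩ := List.mem_map.1 hb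
      rw [adj_sub_iff]
      exact hcross a (hPRs a ha') b (hPGs b hb'))
  rw [List.head_map, hPRh] at hQRh
  rw [List.head_map, hPGh] at hQGh
  have hRp : ∀ z ∈ QR, r < norm1 z → z + x ∈ CR := by
    intro z hz hzr
    obtain ⟨a, ha, rfl⟩ := List.mem_map.1 ((hQRa z hzr).1 hz)
    simpa using hPRs a ha
  have hGp : ∀ z ∈ QG, r < norm1 z → z + x ∈ CG := by
    intro z hz hzr
    obtain ⟨a, ha, rfl⟩ := List.mem_map.1 ((hQGa z hzr).1 hz)
    simpa using hPGs a ha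
  have hn1 : norm1 (eVec d m) = m := by rw [norm1_eVec hd, abs_of_nonneg (by omega)]
  have hn2 : norm1 (eVec d (-m)) = m := by rw [norm1_eVec hd, abs_neg, abs_of_nonneg (by omega)]
  rcases hends with ⟨e1, e2⟩ | ⟨e1, e2⟩
  · rw [e1] at hQRm
    rw [e2] at hQGm
    exact modify_aux hmr hST hS he1 he2 hn1 hn2 hno hyes hT hx1 hx2 hy (CR := CR) (CG := CG)
      (Reach.refl _) hCR hCG hclosed hcross hQR hQG hQRi.1.2.2 hQGi.1.2.2 hQRh hQGh hRp hGp e1 e2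
      hQRm hQGm hQ
  · rw [e1] at hQRm
    rw [e2] at hQGm
    exact modify_aux hmr hST (fun z hz => by rcases hS z hz with h | h | h <;> tauto)
      he2 he1 hn2 hn1 (fun h => hno (h.symm he2)) (hyes.symm (hST he1)) hT hx1 hx2 hy
      (CR := CR) (CG := CG)
      (Reach.refl _) hCR hCG hclosed hcross hQR hQG hQRi.1.2.2 hQGi.1.2.2 hQRh hQGh hRp hGp e1 e2
      hQRm hQGm hQ

end Modify

section Enh
variable {d : ℕ}

lemma mem_enh {E0 : Set (Fin d → ℤ) → Set (Fin d → ℤ)} {ω α : Set (Fin d → ℤ)}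
    {z : Fin d → ℤ} : z ∈ enhancedConfig E0 ω α ↔
      z ∈ ω ∨ ∃ v ∈ α, z - v ∈ E0 {u | u + v ∈ ω} := by
  have him : ∀ v : Fin d → ℤ, (fun x => x - v) '' ω = {u | u + v ∈ ω} := by
    intro v
    ext u
    constructor
    · rintro ⟨w, hw, rfl⟩; simpa using hw
    · intro hu; exact ⟨u + v, hu, by simp⟩
  unfold enhancedConfig
  simp only [him, Set.mem_union, Set.mem_iUnion, Set.mem_image, exists_prop]
  apply or_congr_right
  constructor
  · rintro ⟨v, hv, y, hy, rfl⟩; exact ⟨v, hv, by simpa using hy⟩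
  · rintro ⟨v, hv, h⟩; exact ⟨v, hv, _, h, by simp⟩

lemma enh_mono {E0 : Set (Fin d → ℤ) → Set (Fin d → ℤ)} {ω α β : Set (Fin d → ℤ)} (h : α ⊆ β) :
    enhancedConfig E0 ω α ⊆ enhancedConfig E0 ω β := by
  intro z hz
  rw [mem_enh] at *
  exact hz.imp_right fun ⟨v, hv, h'⟩ => ⟨v, h hv, h'⟩

lemma subset_enh {E0 : Set (Fin d → ℤ) → Set (Fin d → ℤ)} {ω α : Set (Fin d → ℤ)} :
    ω ⊆ enhancedConfig E0 ω α := fun _ hz => mem_enh.2 (Or.inl hz)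

lemma E0_local {r' : ℤ} {E0 : Set (Fin d → ℤ) → Set (Fin d → ℤ)}
    (hloc : ∀ ω ω' : Set (Fin d → ℤ), ω ∩ Binf d r' = ω' ∩ Binf d r' → E0 ω = E0 ω')
    {ω ω' : Set (Fin d → ℤ)} (h : ∀ z, norm1 z ≤ d * r' → (z ∈ ω ↔ z ∈ ω')) : E0 ω = E0 ω' := by
  apply hloc
  ext z
  constructor
  · rintro ⟨a, b⟩; exact ⟨(h z (norm1_le_of_mem_Binf b)).1 a, b⟩
  · rintro ⟨a, b⟩; exact ⟨(h z (norm1_le_of_mem_Binf b)).2 a, b⟩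

lemma peel {E0 : Set (Fin d → ℤ) → Set (Fin d → ℤ)} {ω α : Set (Fin d → ℤ)} {n : ℤ}
    (h1 : Arm n (enhancedConfig E0 ω α)) (F : Finset (Fin d → ℤ))
    (h0 : ¬ Arm n (enhancedConfig E0 ω (α \ F))) :
    ∃ y ∈ F, ∃ α' : Set (Fin d → ℤ), (∀ z ∉ F, (z ∈ α' ↔ z ∈ α)) ∧
      Arm n (enhancedConfig E0 ω (insert y α')) ∧ ¬ Arm n (enhancedConfig E0 ω (α' \ {y})) := by
  classical
  induction F using Finset.induction_on with
  | empty => simp at h0; exact absurd h1 h0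
  | @insert a F ha ih =>
    by_cases h : Arm n (enhancedConfig E0 ω (α \ F))
    · refine ⟨a, by simp, α \ F, ?_, h.mono (enh_mono (Set.subset_insert _ _)), ?_⟩
      · intro z hz
        simp at hz
        simp [hz.2]
      · intro h'
        apply h0
        convert h' using 2
        ext z; simp; tauto
    · obtain ⟨y, hy, α', hα, h2⟩ := ih h
      exact ⟨y, by simp [hy], α', fun z hz => hα z (by simp at hz; tauto), h2⟩

lemma pivot_transfer (hd : 2 ≤ d) (hpath : PathModificationProperty d) {r' : ℤ} (hr' : 1 ≤ r')
    (E0 : Set (Fin d → ℤ) → Set (Fin d → ℤ))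
    (hloc : ∀ ω ω' : Set (Fin d → ℤ), ω ∩ Binf d r' = ω' ∩ Binf d r' → E0 ω = E0 ω')
    (hrange : ∀ ω : Set (Fin d → ℤ), E0 ω ⊆ Binf d r')
    (hess : ∃ ω : Set (Fin d → ℤ),
      ¬ HasDoublyInfinitePath ω ∧ HasDoublyInfinitePath (ω ∪ E0 ω)) :
    ∃ D : ℤ, 0 < D ∧ ∀ (n : ℤ) (x : Fin d → ℤ) (ω α : Set (Fin d → ℤ)), D < norm1 x →
      norm1 x + D < n → Arm n (enhancedConfig E0 (insert x ω) α) →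
      ¬ Arm n (enhancedConfig E0 (ω \ {x}) α) →
      ∃ (y : Fin d → ℤ) (ω' α' : Set (Fin d → ℤ)), norm1 (y - x) ≤ D ∧
        (∀ z, D < norm1 (z - x) → (z ∈ ω' ↔ z ∈ ω) ∧ (z ∈ α' ↔ z ∈ α)) ∧
        Arm n (enhancedConfig E0 ω' (insert y α')) ∧ ¬ Arm n (enhancedConfig E0 ω' (α' \ {y})) := by
  obtain ⟨m, S, hm, hmr', hS, he1, he2, hno, hyes⟩ := pattern_exists hd hr' E0 hloc hrange hess
  obtain ⟨r, hmr, hP⟩ := PMP.of_property hpath hm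
  have hρ : 0 ≤ (d : ℤ) * r' := by positivity
  refine ⟨r + 2 + d * r', by omega, ?_⟩
  intro n x ω α hx1 hx2 h1 h0
  set D : ℤ := r + 2 + d * r' with hD
  classical
  set F : Finset (Fin d → ℤ) := (ballF d D).image (· + x) with hF
  have memF : ∀ z, z ∈ F ↔ norm1 (z - x) ≤ D := by
    intro z
    rw [hF, Finset.mem_image]
    constructor
    · rintro ⟨w, hw, rfl⟩; simpa using mem_ballF.1 hw
    · intro h; exact ⟨z - x, mem_ballF.2 h, by simp⟩
  by_cases hA : Arm n (enhancedConfig E0 (insert x ω) (α \ F))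
  swap
  · obtain ⟨y, hy, α', hα, h2, h3⟩ := peel h1 F hA
    refine ⟨y, insert x ω, α', (memF y).1 hy, ?_, h2, h3⟩
    intro z hz
    refine ⟨?_, hα z (by rw [memF]; omega)⟩
    have : z ≠ x := by rintro rfl; simp [norm1_zero] at hz; omega
    simp [this]
  have hB : ¬ Arm n (enhancedConfig E0 (ω \ {x}) (α \ F)) := fun h =>
    h0 (h.mono (enh_mono Set.sdiff_subset))
  -- the far-away enhancement is insensitive to local changes
  set U : Set (Fin d → ℤ) := {z | ∃ v ∈ α \ F, z - v ∈ E0 {u | u + v ∈ ω}} with hU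
  have hUfar : ∀ z ∈ U, r + 2 < norm1 (z - x) := by
    rintro z ⟨v, hv, hz⟩
    have h1 := norm1_le_of_mem_Binf (hrange _ hz)
    have h2 : ¬ norm1 (v - x) ≤ D := fun h => hv.2 ((memF v).2 h)
    have h3 := norm1_tri (v - x) (z - x)
    rw [sub_sub_sub_cancel_right, norm1_sub_comm v z] at h3
    omega
  have hEU : ∀ ω' : Set (Fin d → ℤ), (∀ z, r + 2 < norm1 (z - x) → (z ∈ ω' ↔ z ∈ ω)) →
      enhancedConfig E0 ω' (α \ F) = ω' ∪ U := by
    intro ω' hω'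
    ext z
    rw [mem_enh]
    apply or_congr_right
    apply exists_congr
    intro v
    refine and_congr_right fun hv => ?_
    have : E0 {u | u + v ∈ ω'} = E0 {u | u + v ∈ ω} := by
      apply E0_local hloc
      intro u hu
      apply hω'
      have h2 : ¬ norm1 (v - x) ≤ D := fun h => hv.2 ((memF v).2 h)
      have h3 := norm1_tri (v - x) (u + v - x)
      have h4 : v - x - (u + v - x) = -u := by abel
      rw [h4, norm1_neg] at h3
      omega
    rw [this]
  have hxne : ∀ z, r + 2 < norm1 (z - x) → z ≠ x := by
    rintro z hz rfl
    simp [norm1_zero] at hz; omega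
  have hxU : x ∉ U := fun h => hxne x (hUfar x h) rfl
  rw [hEU (insert x ω) (fun z hz => by simp [hxne z hz])] at hA
  rw [hEU (ω \ {x}) (fun z hz => by simp [hxne z hz])] at hB
  set σ : Set (Fin d → ℤ) := ω \ {x} ∪ U with hσ
  have hins : insert x ω ∪ U = insert x σ := by
    ext z
    by_cases hz : z = x <;> simp [hσ, hz]
  rw [hins] at hA
  obtain ⟨Q, hSQ, hQS, hoff, hon⟩ := local_modify hd hm hmr hP (T := S ∪ E0 S)
    Set.subset_union_left hS he1 he2 hno hyes
    (by
      rintro z (hz | hz)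
      · rcases hS z hz with h | rfl | rfl
        · exact h.le
        · rw [norm1_eVec hd, abs_of_nonneg (by omega)]
        · rw [norm1_eVec hd, abs_neg, abs_of_nonneg (by omega)]
      · exact (norm1_le_of_mem_Binf (hrange _ hz)).trans hmr'.le)
    (x := x) (n := n) (by omega) (by omega) (σ := σ) (by simp [hσ, hxU]) hA hB
  have hfar : ∀ z, r + 2 < norm1 (z - x) → (z ∈ rewire r x ω Q ↔ z ∈ ω) := by
    intro z hz
    simp only [rewire, Set.mem_ofPred_eq]
    constructor
    · rintro (h | h)
      · exact h.2
      · omega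
    · intro h; exact Or.inl ⟨hz, h⟩
  have hre : rewire r x ω Q ∪ U = rewire r x σ Q := by
    ext z
    by_cases hz : r + 2 < norm1 (z - x)
    · have h1 : ¬ norm1 (z - x) ≤ r + 2 := by omega
      simp [rewire, hz, h1, hσ, hxne z hz]
    · have h1 : norm1 (z - x) ≤ r + 2 := by omega
      have h2 : z ∉ U := fun h => hz (hUfar z h)
      simp [rewire, hz, h1, h2]
  refine ⟨x, rewire r x ω Q, α \ F, by simp [norm1_zero]; omega, ?_, ?_, ?_⟩
  · intro z hz
    refine ⟨hfar z (by omega), ?_⟩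
    have : z ∉ F := by rw [memF]; omega
    simp [this]
  · refine hon.mono ?_
    have hES : E0 {u | u + x ∈ rewire r x ω Q} = E0 S := by
      apply E0_local hloc
      intro u hu
      rw [← hQS u (by omega)]
      simp only [rewire, Set.mem_ofPred_eq, add_sub_cancel_right]
      constructor
      · rintro (h | h)
        · omega
        · exact h.2
      · intro h; exact Or.inr ⟨by omega, h⟩
    have hsub : rewire r x σ Q ⊆ enhancedConfig E0 (rewire r x ω Q) (insert x (α \ F)) := by
      rw [← hre, ← hEU _ hfar]
      exact enh_mono (Set.subset_insert _ _)
    rintro z (hz | ⟨w, hw | hw, rfl⟩)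
    · exact hsub hz
    · apply hsub
      right
      have : norm1 w ≤ m := by
        rcases hS w hw with h | rfl | rfl
        · exact h.le
        · rw [norm1_eVec hd, abs_of_nonneg (by omega)]
        · rw [norm1_eVec hd, abs_neg, abs_of_nonneg (by omega)]
      simp only [add_sub_cancel_right]
      exact ⟨by omega, hSQ hw⟩
    · rw [mem_enh]
      right
      refine ⟨x, Set.mem_insert _ _, ?_⟩
      rw [hES]
      simpa using hw
  · have : (α \ F) \ {x} = α \ F := by
      apply Set.sdiff_singleton_eq_self
      intro h
      exact h.2 (by simp only [Finset.mem_coe, memF, sub_self, norm1_zero]; omega)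
    rw [this, hEU _ hfar, hre]
    exact hoff

end Enh

/-! ### Finite product probability -/

section FinProb

open Classical in
/-- Real-valued indicator of a proposition. -/
noncomputable def indP (P : Prop) : ℝ := if P then 1 else 0

lemma indP_true {P : Prop} (h : P) : indP P = 1 := by simp [indP, h]
lemma indP_false {P : Prop} (h : ¬ P) : indP P = 0 := by simp [indP, h]
lemma indP_nonneg (P : Prop) : 0 ≤ indP P := by unfold indP; split_ifs <;> norm_num
lemma indP_mono {P Q : Prop} (h : P → Q) : indP P ≤ indP Q := by
  by_cases hp : P
  · rw [indP_true hp, indP_true (h hp)]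
  · rw [indP_false hp]; exact indP_nonneg _

variable {ι : Type*} [Fintype ι] [DecidableEq ι]

/-- The one-site weight. -/
def w1 (x : ℝ) (b : Bool) : ℝ := if b then x else 1 - x

/-- The weight of a configuration. -/
noncomputable def wt (q : ι → ℝ) (c : ι → Bool) : ℝ := ∏ i, w1 (q i) (c i)

/-- The probability of an event. -/
noncomputable def Pr (q : ι → ℝ) (A : (ι → Bool) → Prop) : ℝ := ∑ c, indP (A c) * wt q c

/-- Weight with one site omitted. -/
noncomputable def wtE (q : ι → ℝ) (i : ι) (c : ι → Bool) : ℝ :=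
  ∏ j ∈ Finset.univ.erase i, w1 (q j) (c j)

lemma w1_nonneg {x : ℝ} (h0 : 0 ≤ x) (h1 : x ≤ 1) (b : Bool) : 0 ≤ w1 x b := by
  cases b <;> simp [w1] <;> linarith

lemma wt_nonneg {q : ι → ℝ} (hq : ∀ i, 0 ≤ q i ∧ q i ≤ 1) (c : ι → Bool) : 0 ≤ wt q c :=
  Finset.prod_nonneg fun i _ => w1_nonneg (hq i).1 (hq i).2 _

lemma wtE_nonneg {q : ι → ℝ} (hq : ∀ i, 0 ≤ q i ∧ q i ≤ 1) (i : ι) (c : ι → Bool) :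
    0 ≤ wtE q i c :=
  Finset.prod_nonneg fun i _ => w1_nonneg (hq i).1 (hq i).2 _

lemma wtE_update (q : ι → ℝ) (i : ι) (c : ι → Bool) (b : Bool) :
    wtE q i (Function.update c i b) = wtE q i c := by
  unfold wtE
  refine Finset.prod_congr rfl fun j hj => ?_
  rw [Function.update_of_ne (Finset.ne_of_mem_erase hj)]

lemma wt_eq (q : ι → ℝ) (i : ι) (c : ι → Bool) : wt q c = w1 (q i) (c i) * wtE q i c :=
  (Finset.mul_prod_erase _ _ (Finset.mem_univ i)).symm

lemma wt_update (q : ι → ℝ) (i : ι) (c : ι → Bool) (b : Bool) :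
    wt q (Function.update c i b) = w1 (q i) b * wtE q i c := by
  rw [wt_eq q i, wtE_update, Function.update_self]

lemma Pr_nonneg {q : ι → ℝ} (hq : ∀ i, 0 ≤ q i ∧ q i ≤ 1) (A : (ι → Bool) → Prop) : 0 ≤ Pr q A :=
  Finset.sum_nonneg fun c _ => mul_nonneg (indP_nonneg _) (wt_nonneg hq c)

lemma Pr_mono {q : ι → ℝ} (hq : ∀ i, 0 ≤ q i ∧ q i ≤ 1) {A B : (ι → Bool) → Prop}
    (h : ∀ c, A c → B c) : Pr q A ≤ Pr q B :=
  Finset.sum_le_sum fun c _ => mul_le_mul_of_nonneg_right (indP_mono (h c)) (wt_nonneg hq c)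

lemma sum_pair (i : ι) (F : (ι → Bool) → ℝ) :
    2 * ∑ c, F c = ∑ c, (F (Function.update c i true) + F (Function.update c i false)) := by
  have hinv : Function.Involutive fun c : ι → Bool => Function.update c i (!c i) := by
    intro c; simp
  have h1 : ∑ c, F (Function.update c i (!c i)) = ∑ c, F c :=
    Equiv.sum_comp hinv.toPerm F
  rw [two_mul]
  nth_rewrite 2 [← h1]
  rw [← Finset.sum_add_distrib]
  refine Finset.sum_congr rfl fun c _ => ?_
  cases h : c i
  · have : Function.update c i false = c := by rw [← h]; simp
    rw [this, Bool.not_false, add_comm]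
  · have : Function.update c i true = c := by rw [← h]; simp
    rw [this, Bool.not_true]

/-- Event that some configuration agreeing off `N` lies in `B`. -/
def sat (N : Finset ι) (B : (ι → Bool) → Prop) (c : ι → Bool) : Prop :=
  ∃ c', (∀ k ∉ N, c' k = c k) ∧ B c'

lemma Pr_sat_one {q : ι → ℝ} (hq : ∀ i, 0 ≤ q i ∧ q i ≤ 1) {δ : ℝ} (i : ι) (h0 : δ ≤ q i)
    (h1 : δ ≤ 1 - q i) (B : (ι → Bool) → Prop) :
    δ * Pr q (fun c => ∃ b, B (Function.update c i b)) ≤ Pr q B := by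
  have e1 := sum_pair i (fun c => indP (B c) * wt q c)
  have e2 := sum_pair i (fun c => indP (∃ b, B (Function.update c i b)) * wt q c)
  have : δ * (2 * Pr q (fun c => ∃ b, B (Function.update c i b))) ≤ 2 * Pr q B := by
    unfold Pr
    rw [e1, e2, Finset.mul_sum]
    refine Finset.sum_le_sum fun c _ => ?_
    simp only [Function.update_idem, wt_update, w1, if_true, Bool.false_eq_true, if_false]
    have hw := wtE_nonneg hq i c
    have hq := hq i
    by_cases ht : B (Function.update c i true)
    · rw [indP_true ⟨true, ht⟩, indP_true ht]
      have := mul_nonneg (indP_nonneg (B (Function.update c i false)))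
        (mul_nonneg (sub_nonneg.2 hq.2) hw)
      have h3 : δ * wtE q i c ≤ q i * wtE q i c := mul_le_mul_of_nonneg_right h0 hw
      nlinarith
    · by_cases hf : B (Function.update c i false)
      · rw [indP_true ⟨false, hf⟩, indP_true hf, indP_false ht]
        have h3 : δ * wtE q i c ≤ (1 - q i) * wtE q i c := mul_le_mul_of_nonneg_right h1 hw
        nlinarith
      · have : ¬ ∃ b, B (Function.update c i b) := by
          rintro ⟨b, hb⟩; cases b <;> tauto
        rw [indP_false this, indP_false ht, indP_false hf]
        simp
  linarith

lemma Pr_sat {q : ι → ℝ} (hq : ∀ i, 0 ≤ q i ∧ q i ≤ 1) {δ : ℝ} (hδ : 0 ≤ δ) (N : Finset ι)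
    (hN : ∀ i ∈ N, δ ≤ q i ∧ δ ≤ 1 - q i) (B : (ι → Bool) → Prop) :
    δ ^ N.card * Pr q (sat N B) ≤ Pr q B := by
  induction N using Finset.induction_on with
  | empty =>
    simp only [Finset.card_empty, pow_zero, one_mul]
    apply Pr_mono hq
    rintro c ⟨c', h, hb⟩
    have : c' = c := funext fun k => h k (by simp)
    exact this ▸ hb
  | @insert i N hi ih =>
    have h1 := ih fun k hk => hN k (Finset.mem_insert_of_mem hk)
    have h2 := hN i (Finset.mem_insert_self _ _)
    have h3 := Pr_sat_one hq i h2.1 h2.2 (sat N B)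
    have h4 : Pr q (sat (insert i N) B) ≤ Pr q (fun c => ∃ b, sat N B (Function.update c i b)) := by
      apply Pr_mono hq
      rintro c ⟨c', h, hb⟩
      refine ⟨c' i, c', fun k hk => ?_, hb⟩
      by_cases hki : k = i
      · subst hki; simp
      · rw [Function.update_of_ne hki]
        exact h k (by simp [hki, hk])
    rw [Finset.card_insert_of_notMem hi, pow_succ, mul_assoc]
    calc δ ^ N.card * (δ * Pr q (sat (insert i N) B))
        ≤ δ ^ N.card * Pr q (sat N B) := by
          apply mul_le_mul_of_nonneg_left _ (pow_nonneg hδ _)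
          exact (mul_le_mul_of_nonneg_left h4 hδ).trans h3
      _ ≤ _ := h1

lemma Pr_irrel_one (q : ι → ℝ) (i : ι) (x : ℝ) (A : (ι → Bool) → Prop)
    (hA : ∀ c b, A (Function.update c i b) ↔ A c) : Pr (Function.update q i x) A = Pr q A := by
  have e1 := sum_pair i (fun c => indP (A c) * wt q c)
  have e2 := sum_pair i (fun c => indP (A c) * wt (Function.update q i x) c)
  have hw : ∀ c, wtE (Function.update q i x) i c = wtE q i c := by
    intro c
    unfold wtE
    refine Finset.prod_congr rfl fun j hj => ?_
    rw [Function.update_of_ne (Finset.ne_of_mem_erase hj)]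
  have : 2 * Pr (Function.update q i x) A = 2 * Pr q A := by
    unfold Pr
    rw [e1, e2]
    refine Finset.sum_congr rfl fun c _ => ?_
    simp only [wt_update, hA, hw, w1, if_true, Bool.false_eq_true, if_false]
    ring
  linarith

lemma Pr_irrel (A : (ι → Bool) → Prop) (F : Finset ι)
    (hA : ∀ i ∈ F, ∀ c b, A (Function.update c i b) ↔ A c) (q q' : ι → ℝ)
    (h : ∀ i ∉ F, q i = q' i) : Pr q A = Pr q' A := by
  induction F using Finset.induction_on generalizing q' with
  | empty => rw [show q = q' from funext fun i => h i (by simp)]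
  | @insert i F hi ih =>
    rw [← Pr_irrel_one q' i (q i) A (hA i (Finset.mem_insert_self _ _))]
    apply ih fun k hk => hA k (Finset.mem_insert_of_mem hk)
    intro k hk
    by_cases hki : k = i
    · subst hki; simp
    · rw [Function.update_of_ne hki]
      exact h k (by simp [hki, hk])

/-- Finite energy. -/
lemma Pr_finite_energy {q q' : ι → ℝ} (hq : ∀ i, 0 ≤ q i ∧ q i ≤ 1)
    (hq' : ∀ i, 0 ≤ q' i ∧ q' i ≤ 1) {δ : ℝ} (hδ : 0 ≤ δ) (F : Finset ι)
    (hF : ∀ i ∈ F, δ ≤ q' i ∧ δ ≤ 1 - q' i) (h : ∀ i ∉ F, q i = q' i) (A : (ι → Bool) → Prop) :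
    δ ^ F.card * Pr q A ≤ Pr q' A := by
  have h1 : Pr q A ≤ Pr q (sat F A) := Pr_mono hq fun c hc => ⟨c, fun _ _ => rfl, hc⟩
  have h2 : Pr q (sat F A) = Pr q' (sat F A) := by
    apply Pr_irrel _ F _ _ _ h
    intro i hi c b
    unfold sat
    apply exists_congr
    intro c'
    apply and_congr_left
    intro _
    apply forall₂_congr
    intro k hk
    rw [Function.update_of_ne (by rintro rfl; exact hk hi)]
  calc _ ≤ δ ^ F.card * Pr q' (sat F A) :=
        mul_le_mul_of_nonneg_left (h1.trans h2.le) (pow_nonneg hδ _)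
    _ ≤ _ := Pr_sat hq' hδ F hF A

/-- Discrete derivative. -/
noncomputable def Dv (q : ι → ℝ) (A : (ι → Bool) → Prop) (i : ι) : ℝ :=
  ∑ c, (indP (A (Function.update c i true)) - indP (A (Function.update c i false))) * wt q c

lemma Dv_eq (q : ι → ℝ) (A : (ι → Bool) → Prop) (i : ι) :
    ∑ c, indP (A c) * ((if c i then 1 else -1) * wtE q i c) = Dv q A i := by
  have e1 := sum_pair i (fun c => indP (A c) * ((if c i then 1 else -1) * wtE q i c))
  have e2 := sum_pair i (fun c =>
    (indP (A (Function.update c i true)) - indP (A (Function.update c i false))) * wt q c)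
  have : 2 * ∑ c, indP (A c) * ((if c i then 1 else -1) * wtE q i c) = 2 * Dv q A i := by
    unfold Dv
    rw [e1, e2]
    refine Finset.sum_congr rfl fun c _ => ?_
    simp only [Function.update_idem, wt_update, wtE_update, Function.update_self, w1, if_true,
      Bool.false_eq_true, if_false]
    ring
  linarith

lemma hasDerivAt_Pr (q0 Δ : ι → ℝ) (A : (ι → Bool) → Prop) (t : ℝ) :
    HasDerivAt (fun t : ℝ => Pr (fun i => q0 i + t * Δ i) A)
      (∑ i, Δ i * Dv (fun i => q0 i + t * Δ i) A i) t := by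
  have hone : ∀ (c : ι → Bool) (i : ι), HasDerivAt (fun t : ℝ => w1 (q0 i + t * Δ i) (c i))
      ((if c i then 1 else -1) * Δ i) t := by
    intro c i
    have h : HasDerivAt (fun t : ℝ => q0 i + t * Δ i) (Δ i) t := by
      simpa using ((hasDerivAt_id t).mul_const (Δ i)).const_add (q0 i)
    cases hc : c i
    · simpa [w1, hc] using h.const_sub 1
    · simpa [w1, hc] using h
  have hwt : ∀ c : ι → Bool, HasDerivAt (fun t : ℝ => wt (fun i => q0 i + t * Δ i) c)
      (∑ i, wtE (fun i => q0 i + t * Δ i) i c * ((if c i then 1 else -1) * Δ i)) t := by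
    intro c
    have := HasDerivAt.fun_finsetProd (u := Finset.univ)
      (f := fun i t => w1 (q0 i + t * Δ i) (c i)) (x := t) (fun i _ => hone c i)
    simpa [wt, wtE, smul_eq_mul] using this
  have hsum := HasDerivAt.fun_sum (u := Finset.univ) (x := t)
    (A := fun c t => indP (A c) * wt (fun i => q0 i + t * Δ i) c)
    (fun c _ => (hwt c).const_mul (indP (A c)))
  unfold Pr
  refine hsum.congr_deriv (Eq.symm ?_)
  have e : ∀ i, Δ i * Dv (fun i => q0 i + t * Δ i) A i = ∑ c : ι → Bool, Δ i *
      (indP (A c) * ((if c i then 1 else -1) * wtE (fun i => q0 i + t * Δ i) i c)) := by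
    intro i
    rw [← Dv_eq, Finset.mul_sum]
  rw [Finset.sum_congr rfl fun i _ => e i, Finset.sum_comm]
  refine Finset.sum_congr rfl fun c _ => ?_
  rw [Finset.mul_sum]
  refine Finset.sum_congr rfl fun i _ => ?_
  ring

/-- Pivotality. -/
def Piv (A : (ι → Bool) → Prop) (i : ι) (c : ι → Bool) : Prop :=
  A (Function.update c i true) ∧ ¬ A (Function.update c i false)

lemma Dv_le {q : ι → ℝ} (hq : ∀ i, 0 ≤ q i ∧ q i ≤ 1) (A : (ι → Bool) → Prop) (i : ι) :
    Dv q A i ≤ Pr q (Piv A i) := by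
  refine Finset.sum_le_sum fun c _ => mul_le_mul_of_nonneg_right ?_ (wt_nonneg hq c)
  by_cases h : Piv A i c
  · rw [indP_true h, indP_true h.1, indP_false h.2]; norm_num
  · rw [indP_false h]
    have : A (Function.update c i true) → A (Function.update c i false) := by
      unfold Piv at h; tauto
    linarith [indP_mono this]

lemma le_Dv {q : ι → ℝ} (hq : ∀ i, 0 ≤ q i ∧ q i ≤ 1) (A : (ι → Bool) → Prop) (i : ι)
    (hA : ∀ c, A (Function.update c i false) → A (Function.update c i true)) :
    Pr q (Piv A i) ≤ Dv q A i := by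
  refine Finset.sum_le_sum fun c _ => mul_le_mul_of_nonneg_right ?_ (wt_nonneg hq c)
  by_cases h : Piv A i c
  · rw [indP_true h, indP_true h.1, indP_false h.2]; norm_num
  · rw [indP_false h]
    linarith [indP_mono (hA c)]

lemma Pr_exists_le {q : ι → ℝ} (hq : ∀ i, 0 ≤ q i ∧ q i ≤ 1) {κ : Type*} (J : Finset κ)
    (B : κ → (ι → Bool) → Prop) : Pr q (fun c => ∃ j ∈ J, B j c) ≤ ∑ j ∈ J, Pr q (B j) := by
  unfold Pr
  rw [Finset.sum_comm]
  refine Finset.sum_le_sum fun c _ => ?_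
  rw [← Finset.sum_mul]
  refine mul_le_mul_of_nonneg_right ?_ (wt_nonneg hq c)
  by_cases h : ∃ j ∈ J, B j c
  · obtain ⟨j, hj, hb⟩ := h
    rw [indP_true ⟨j, hj, hb⟩, ← indP_true hb]
    exact Finset.single_le_sum (f := fun j => indP (B j c)) (fun _ _ => indP_nonneg _) hj
  · rw [indP_false h]
    exact Finset.sum_nonneg fun _ _ => indP_nonneg _

lemma pivotal_compare {q : ι → ℝ} {δ : ℝ} (hδ : 0 < δ) (hδ1 : δ ≤ 1) (hq : ∀ i, δ ≤ q i ∧ δ ≤ 1 - q i)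
    (A : (ι → Bool) → Prop) (I J : Finset ι) (N : ι → Finset ι) {b b' : ℕ}
    (hN : ∀ i ∈ I, (N i).card ≤ b) (hN' : ∀ j ∈ J, (I.filter fun i => j ∈ N i).card ≤ b')
    (hmono : ∀ j ∈ J, ∀ c, A (Function.update c j false) → A (Function.update c j true))
    (hpiv : ∀ i ∈ I, ∀ c, Piv A i c → ∃ j ∈ J, j ∈ N i ∧ ∃ c', (∀ k ∉ N i, c' k = c k) ∧ Piv A j c') :
    ∑ i ∈ I, Dv q A i ≤ (b' / δ ^ b) * ∑ j ∈ J, Dv q A j := by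
  have hq1 : ∀ i, 0 ≤ q i ∧ q i ≤ 1 := fun i => ⟨by linarith [(hq i).1], by linarith [(hq i).2]⟩
  have key : ∀ i ∈ I, δ ^ b * Dv q A i ≤ ∑ j ∈ J, if j ∈ N i then Pr q (Piv A j) else 0 := by
    intro i hi
    have h1 : Dv q A i ≤ Pr q (sat (N i) fun c => ∃ j ∈ J.filter (· ∈ N i), Piv A j c) := by
      refine (Dv_le hq1 A i).trans (Pr_mono hq1 ?_)
      intro c hc
      obtain ⟨j, hj, hjN, c', hc', hp⟩ := hpiv i hi c hc
      exact ⟨c', hc', j, by simp [hj, hjN], hp⟩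
    have h2 := Pr_sat hq1 hδ.le (N i) (fun k _ => hq k)
      (fun c => ∃ j ∈ J.filter (· ∈ N i), Piv A j c)
    have h3 := Pr_exists_le hq1 (J.filter (· ∈ N i)) (fun j => Piv A j)
    rw [Finset.sum_filter] at h3
    refine le_trans ?_ (h2.trans h3)
    calc δ ^ b * Dv q A i ≤ δ ^ b * Pr q (sat (N i) fun c => ∃ j ∈ J.filter (· ∈ N i), Piv A j c) :=
          mul_le_mul_of_nonneg_left h1 (by positivity)
      _ ≤ _ := mul_le_mul_of_nonneg_right (pow_le_pow_of_le_one hδ.le hδ1 (hN i hi))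
          (Pr_nonneg hq1 _)
  have h1 : δ ^ b * ∑ i ∈ I, Dv q A i ≤ b' * ∑ j ∈ J, Dv q A j := by
    rw [Finset.mul_sum]
    refine (Finset.sum_le_sum key).trans ?_
    rw [Finset.sum_comm, Finset.mul_sum]
    refine Finset.sum_le_sum fun j hj => ?_
    rw [← Finset.sum_filter, Finset.sum_const, nsmul_eq_mul]
    have h5 := le_Dv hq1 A j (hmono j hj)
    have h6 := Pr_nonneg hq1 (Piv A j)
    have h7 : ((I.filter fun i => j ∈ N i).card : ℝ) ≤ b' := by exact_mod_cast hN' j hj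
    exact mul_le_mul h7 h5 h6 (by positivity)
  rw [div_mul_eq_mul_div, le_div_iff₀ (by positivity), mul_comm]
  exact h1

/-- The trade-off lemma. -/
lemma tradeoff {q0 q1 : ι → ℝ} {δ ε : ℝ} (hδ : 0 < δ) (hδ1 : δ ≤ 1) (hε : 0 ≤ ε)
    (hq0 : ∀ i, δ ≤ q0 i ∧ δ ≤ 1 - q0 i) (hq1 : ∀ i, δ ≤ q1 i ∧ δ ≤ 1 - q1 i)
    (A : (ι → Bool) → Prop) (I J : Finset ι) (hIJ : Disjoint I J) (N : ι → Finset ι) {b b' : ℕ}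
    (hN : ∀ i ∈ I, (N i).card ≤ b) (hN' : ∀ j ∈ J, (I.filter fun i => j ∈ N i).card ≤ b')
    (hmono : ∀ j ∈ J, ∀ c, A (Function.update c j false) → A (Function.update c j true))
    (hpiv : ∀ i ∈ I, ∀ c, Piv A i c → ∃ j ∈ J, j ∈ N i ∧ ∃ c', (∀ k ∉ N i, c' k = c k) ∧ Piv A j c')
    (hI : ∀ i ∈ I, q1 i = q0 i - ε) (hJ : ∀ j ∈ J, q1 j = q0 j + (b' / δ ^ b) * ε)
    (hO : ∀ i, i ∉ I → i ∉ J → q1 i = q0 i) : Pr q0 A ≤ Pr q1 A := by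
  set Δ : ι → ℝ := fun i => q1 i - q0 i with hΔ
  have hmon : MonotoneOn (fun t : ℝ => Pr (fun i => q0 i + t * Δ i) A) (Set.Icc 0 1) := by
    apply monotoneOn_of_deriv_nonneg (convex_Icc 0 1)
    · exact fun t _ => (hasDerivAt_Pr q0 Δ A t).continuousAt.continuousWithinAt
    · exact fun t _ => (hasDerivAt_Pr q0 Δ A t).differentiableAt.differentiableWithinAt
    · intro t ht
      rw [interior_Icc] at ht
      rw [(hasDerivAt_Pr q0 Δ A t).deriv]
      have hqt : ∀ i, δ ≤ q0 i + t * Δ i ∧ δ ≤ 1 - (q0 i + t * Δ i) := by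
        intro i
        have h0 := hq0 i
        have h1 := hq1 i
        have e : q0 i + t * Δ i = (1 - t) * q0 i + t * q1 i := by simp only [hΔ]; ring
        rw [e]
        have t0 := ht.1
        have t1 := ht.2
        constructor <;> nlinarith
      have hc := pivotal_compare hδ hδ1 hqt A I J N hN hN' hmono hpiv
      have hsplit : ∑ i, Δ i * Dv (fun i => q0 i + t * Δ i) A i
          = ∑ i ∈ I, (-ε) * Dv (fun i => q0 i + t * Δ i) A i
            + ∑ j ∈ J, (b' / δ ^ b * ε) * Dv (fun i => q0 i + t * Δ i) A j := by
        have e1 : ∑ i ∈ I, (-ε) * Dv (fun i => q0 i + t * Δ i) A i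
            = ∑ i ∈ I, Δ i * Dv (fun i => q0 i + t * Δ i) A i :=
          Finset.sum_congr rfl fun i hi => by
            rw [show Δ i = -ε by simp only [hΔ]; rw [hI i hi]; ring]
        have e2 : ∑ j ∈ J, (b' / δ ^ b * ε) * Dv (fun i => q0 i + t * Δ i) A j
            = ∑ j ∈ J, Δ j * Dv (fun i => q0 i + t * Δ i) A j :=
          Finset.sum_congr rfl fun j hj => by
            rw [show Δ j = b' / δ ^ b * ε by simp only [hΔ]; rw [hJ j hj]; ring]
        rw [e1, e2, ← Finset.sum_union hIJ]
        symm
        apply Finset.sum_subset (Finset.subset_univ _)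
        intro i _ hi
        simp only [Finset.mem_union, not_or] at hi
        rw [show Δ i = 0 by simp only [hΔ]; rw [hO i hi.1 hi.2]; ring, zero_mul]
      rw [hsplit, ← Finset.mul_sum, ← Finset.mul_sum]
      nlinarith
  have := hmon (Set.left_mem_Icc.2 zero_le_one) (Set.right_mem_Icc.2 zero_le_one) zero_le_one
  simpa [hΔ] using this

end FinProb

open MeasureTheory

/-! ### From finite probability to the infinite product measures -/

section Bridge
variable {d : ℕ}

/-- Index set: two copies of a finite box. -/
abbrev Idx (Λ : Finset (Fin d → ℤ)) : Type := {x // x ∈ Λ} ⊕ {x // x ∈ Λ}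

/-- First configuration coded by `c`. -/
def cfgL (Λ : Finset (Fin d → ℤ)) (c : Idx Λ → Bool) : Set (Fin d → ℤ) :=
  {v | ∃ h : v ∈ Λ, c (Sum.inl ⟨v, h⟩) = true}

/-- Second configuration coded by `c`. -/
def cfgR (Λ : Finset (Fin d → ℤ)) (c : Idx Λ → Bool) : Set (Fin d → ℤ) :=
  {v | ∃ h : v ∈ Λ, c (Sum.inr ⟨v, h⟩) = true}

/-- Two-parameter density. -/
def qq (Λ : Finset (Fin d → ℤ)) (p s : ℝ) : Idx Λ → ℝ := Sum.elim (fun _ => p) (fun _ => s)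

/-- Dependence on a finite box only. -/
def DepOn (Λ : Finset (Fin d → ℤ)) (B : Set (Fin d → ℤ) → Set (Fin d → ℤ) → Prop) : Prop :=
  ∀ ω ω' α α' : Set (Fin d → ℤ), (∀ v ∈ Λ, (v ∈ ω ↔ v ∈ ω')) → (∀ v ∈ Λ, (v ∈ α ↔ v ∈ α')) →
    (B ω α ↔ B ω' α')

lemma measurableSet_cyl (F : Finset (Fin d → ℤ)) (g : (Fin d → ℤ) → Bool) :
    MeasurableSet {ω : (Fin d → ℤ) → Bool | ∀ v ∈ F, ω v = g v} := by
  have : {ω : (Fin d → ℤ) → Bool | ∀ v ∈ F, ω v = g v} =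
      ⋂ v ∈ F, (fun ω : (Fin d → ℤ) → Bool => ω v) ⁻¹' {g v} := by
    ext ω; simp
  rw [this]
  exact Finset.measurableSet_biInter _ fun v _ =>
    (measurable_pi_apply v) (measurableSet_singleton _)

/-- Extend by `false`. -/
def extB (Λ : Finset (Fin d → ℤ)) (f : {x // x ∈ Λ} → Bool) (v : Fin d → ℤ) : Bool :=
  if h : v ∈ Λ then f ⟨v, h⟩ else false

/-- Cylinder of a pair of finite configurations. -/
def cyl2 (Λ : Finset (Fin d → ℤ)) (c : Idx Λ → Bool) :
    Set (((Fin d → ℤ) → Bool) × ((Fin d → ℤ) → Bool)) :=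
  {ω | ∀ v ∈ Λ, ω v = extB Λ (fun v => c (Sum.inl v)) v} ×ˢ
    {ω | ∀ v ∈ Λ, ω v = extB Λ (fun v => c (Sum.inr v)) v}

lemma measurableSet_cyl2 (Λ : Finset (Fin d → ℤ)) (c : Idx Λ → Bool) :
    MeasurableSet (cyl2 Λ c) := (measurableSet_cyl _ _).prod (measurableSet_cyl _ _)

lemma mem_cyl2 {Λ : Finset (Fin d → ℤ)} {c : Idx Λ → Bool}
    {x : ((Fin d → ℤ) → Bool) × ((Fin d → ℤ) → Bool)} :
    x ∈ cyl2 Λ c ↔ c = Sum.elim (fun v => x.1 v.1) (fun v => x.2 v.1) := by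
  constructor
  · rintro ⟨h1, h2⟩
    funext k
    rcases k with ⟨v, hv⟩ | ⟨v, hv⟩
    · have := h1 v hv
      simp only [extB, hv, dif_pos] at this
      simpa using this.symm
    · have := h2 v hv
      simp only [extB, hv, dif_pos] at this
      simpa using this.symm
  · rintro rfl
    constructor
    · intro v hv; simp [extB, hv]
    · intro v hv; simp [extB, hv]

lemma event_eq {Λ : Finset (Fin d → ℤ)} {B : Set (Fin d → ℤ) → Set (Fin d → ℤ) → Prop}
    (hB : DepOn Λ B) :
    {x : ((Fin d → ℤ) → Bool) × ((Fin d → ℤ) → Bool) | B (toConfig x.1) (toConfig x.2)} =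
      ⋃ c ∈ {c : Idx Λ → Bool | B (cfgL Λ c) (cfgR Λ c)}, cyl2 Λ c := by
  ext x
  simp only [Set.mem_iUnion, mem_cyl2, Set.mem_ofPred_eq, exists_prop]
  have key : B (toConfig x.1) (toConfig x.2) ↔
      B (cfgL Λ (Sum.elim (fun v => x.1 v.1) (fun v => x.2 v.1)))
        (cfgR Λ (Sum.elim (fun v => x.1 v.1) (fun v => x.2 v.1))) := by
    apply hB
    · intro v hv; simp [toConfig, cfgL, hv]
    · intro v hv; simp [toConfig, cfgR, hv]
  rw [key]
  constructor
  · intro h; exact ⟨_, h, rfl⟩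
  · rintro ⟨c, h, rfl⟩; exact h

lemma measurableSet_event {Λ : Finset (Fin d → ℤ)} {B : Set (Fin d → ℤ) → Set (Fin d → ℤ) → Prop}
    (hB : DepOn Λ B) :
    MeasurableSet {x : ((Fin d → ℤ) → Bool) × ((Fin d → ℤ) → Bool) |
      B (toConfig x.1) (toConfig x.2)} := by
  rw [event_eq hB]
  exact MeasurableSet.biUnion (Set.to_countable _) fun c _ => measurableSet_cyl2 Λ c

lemma cyl_prob {Λ : Finset (Fin d → ℤ)} {p : ℝ} (hp0 : 0 ≤ p) (hp1 : p ≤ 1)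
    {μ : Measure ((Fin d → ℤ) → Bool)} (hμ : IsBernoulliProduct d p μ) (f : {x // x ∈ Λ} → Bool) :
    μ {ω | ∀ v ∈ Λ, ω v = extB Λ f v} = ENNReal.ofReal (∏ v : {x // x ∈ Λ}, w1 p (f v)) := by
  rw [hμ.2, ENNReal.ofReal_prod_of_nonneg fun v _ => w1_nonneg hp0 hp1 _, ← Finset.prod_coe_sort]
  refine Finset.prod_congr rfl fun v _ => ?_
  simp only [extB, v.2, dif_pos, w1]
  split_ifs <;> rfl

lemma bridge {Λ : Finset (Fin d → ℤ)} {B : Set (Fin d → ℤ) → Set (Fin d → ℤ) → Prop}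
    (hB : DepOn Λ B) {p s : ℝ} (hp0 : 0 ≤ p) (hp1 : p ≤ 1) (hs0 : 0 ≤ s) (hs1 : s ≤ 1)
    {μ ν : Measure ((Fin d → ℤ) → Bool)} (hμ : IsBernoulliProduct d p μ)
    (hν : IsBernoulliProduct d s ν) :
    (μ.prod ν) {x | B (toConfig x.1) (toConfig x.2)} =
      ENNReal.ofReal (Pr (qq Λ p s) fun c => B (cfgL Λ c) (cfgR Λ c)) := by
  classical
  haveI := hμ.1
  haveI := hν.1
  have hq : ∀ i, 0 ≤ qq Λ p s i ∧ qq Λ p s i ≤ 1 := by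
    rintro (i | i)
    · exact ⟨hp0, hp1⟩
    · exact ⟨hs0, hs1⟩
  rw [event_eq hB]
  have e1 : (⋃ c ∈ {c : Idx Λ → Bool | B (cfgL Λ c) (cfgR Λ c)}, cyl2 Λ c) =
      ⋃ c ∈ (Finset.univ.filter fun c : Idx Λ → Bool => B (cfgL Λ c) (cfgR Λ c)), cyl2 Λ c := by
    ext x; simp
  rw [e1, measure_biUnion_finset]
  · have e2 : ∀ c : Idx Λ → Bool, (μ.prod ν) (cyl2 Λ c) = ENNReal.ofReal (wt (qq Λ p s) c) := by
      intro c
      rw [cyl2, Measure.prod_prod, cyl_prob hp0 hp1 hμ, cyl_prob hs0 hs1 hν,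
        ← ENNReal.ofReal_mul (Finset.prod_nonneg fun v _ => w1_nonneg hp0 hp1 _)]
      congr 1
      unfold wt
      rw [Fintype.prod_sum_type]
      rfl
    rw [Finset.sum_congr rfl fun c _ => e2 c,
      ← ENNReal.ofReal_sum_of_nonneg fun c _ => wt_nonneg hq c]
    congr 1
    unfold Pr
    rw [Finset.sum_filter]
    refine Finset.sum_congr rfl fun c _ => ?_
    split_ifs with h
    · rw [indP_true h, one_mul]
    · rw [indP_false h, zero_mul]
  · intro c _ c' _ hne
    refine Set.disjoint_left.2 fun x hx hx' => hne ?_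
    rw [mem_cyl2.1 hx, mem_cyl2.1 hx']
  · exact fun c _ => measurableSet_cyl2 Λ c

lemma arm_enh_congr {r' : ℤ} (hr' : 0 ≤ r') {E0 : Set (Fin d → ℤ) → Set (Fin d → ℤ)}
    (hloc : ∀ ω ω' : Set (Fin d → ℤ), ω ∩ Binf d r' = ω' ∩ Binf d r' → E0 ω = E0 ω')
    (hrange : ∀ ω : Set (Fin d → ℤ), E0 ω ⊆ Binf d r') {n : ℤ} (hn : 0 ≤ n)
    {ω ω' α α' : Set (Fin d → ℤ)}
    (h1 : ∀ v, norm1 v ≤ n + 2 * (d * r') → (v ∈ ω ↔ v ∈ ω'))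
    (h2 : ∀ v, norm1 v ≤ n + 2 * (d * r') → (v ∈ α ↔ v ∈ α')) :
    Arm n (enhancedConfig E0 ω α) ↔ Arm n (enhancedConfig E0 ω' α') := by
  have hρ : 0 ≤ (d : ℤ) * r' := by positivity
  apply arm_congr hn
  intro z hz
  rw [mem_enh, mem_enh, h1 z (by omega)]
  apply or_congr_right
  have key : ∀ (η η' : Set (Fin d → ℤ)) v, (∀ v, norm1 v ≤ n + 2 * (d * r') → (v ∈ η ↔ v ∈ η')) →
      z - v ∈ E0 {u | u + v ∈ η} → norm1 v ≤ n + d * r' ∧ z - v ∈ E0 {u | u + v ∈ η'} := by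
    intro η η' v hη hv
    have a1 := norm1_le_of_mem_Binf (hrange _ hv)
    have a2 := norm1_tri v z
    rw [norm1_sub_comm v z] at a2
    refine ⟨by omega, ?_⟩
    have : E0 {u | u + v ∈ η} = E0 {u | u + v ∈ η'} := by
      apply E0_local hloc
      intro u hu
      apply hη
      have := norm1_add_le u v
      omega
    rwa [← this]
  constructor
  · rintro ⟨v, hv, h⟩
    obtain ⟨k1, k2⟩ := key ω ω' v h1 h
    exact ⟨v, (h2 v (by omega)).1 hv, k2⟩
  · rintro ⟨v, hv, h⟩
    obtain ⟨k1, k2⟩ := key ω' ω v (fun v hv => (h1 v hv).symm) h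
    exact ⟨v, (h2 v (by omega)).2 hv, k2⟩

end Bridge

open MeasureTheory

/-! ### The comparison of probabilities of crossing events -/

section Compare
variable {d : ℕ}

/-- The site underlying an index. -/
def pt {Λ : Finset (Fin d → ℤ)} : Idx Λ → (Fin d → ℤ) := Sum.elim (fun v => v.1) (fun v => v.1)

lemma card_near {Λ : Finset (Fin d → ℤ)} (D : ℤ) (v : Fin d → ℤ) (s : Finset (Idx Λ))
    (hs : ∀ k ∈ s, norm1 (pt k - v) ≤ D) : s.card ≤ 2 * (ballF d D).card := by
  classical
  have : s.card ≤ ((Finset.univ : Finset Bool) ×ˢ ballF d D).card := by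
    apply Finset.card_le_card_of_injOn (fun k => (k.isLeft, pt k - v))
    · intro k hk
      simp only [Finset.coe_product, Set.mem_prod, Finset.mem_coe, Finset.mem_univ, true_and]
      exact mem_ballF.2 (hs k hk)
    · intro k _ k' _ h
      simp only [Prod.mk.injEq, sub_left_inj] at h
      rcases k with ⟨a, ha⟩ | ⟨a, ha⟩ <;> rcases k' with ⟨b, hb⟩ | ⟨b, hb⟩ <;> simp_all [pt]
  simpa using this

lemma mem_cfgL_update {Λ : Finset (Fin d → ℤ)} (c : Idx Λ → Bool) (k : Idx Λ) (b : Bool)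
    {v : Fin d → ℤ} (hv : v ∈ Λ) (hk : k ≠ Sum.inl ⟨v, hv⟩) :
    v ∈ cfgL Λ (Function.update c k b) ↔ v ∈ cfgL Λ c := by
  classical
  simp only [cfgL, Set.mem_ofPred_eq]
  constructor
  · rintro ⟨h, e⟩; exact ⟨h, by rwa [Function.update_of_ne hk.symm] at e⟩
  · rintro ⟨h, e⟩; exact ⟨h, by rwa [Function.update_of_ne hk.symm]⟩

lemma mem_cfgR_update {Λ : Finset (Fin d → ℤ)} (c : Idx Λ → Bool) (k : Idx Λ) (b : Bool)
    {v : Fin d → ℤ} (hv : v ∈ Λ) (hk : k ≠ Sum.inr ⟨v, hv⟩) :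
    v ∈ cfgR Λ (Function.update c k b) ↔ v ∈ cfgR Λ c := by
  simp only [cfgR, Set.mem_ofPred_eq]
  constructor
  · rintro ⟨h, e⟩; exact ⟨h, by rwa [Function.update_of_ne hk.symm] at e⟩
  · rintro ⟨h, e⟩; exact ⟨h, by rwa [Function.update_of_ne hk.symm]⟩

lemma mem_cfgL_self {Λ : Finset (Fin d → ℤ)} (c : Idx Λ → Bool) (b : Bool)
    {v : Fin d → ℤ} (hv : v ∈ Λ) :
    v ∈ cfgL Λ (Function.update c (Sum.inl ⟨v, hv⟩) b) ↔ b = true := by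
  simp [cfgL, hv]

lemma mem_cfgR_self {Λ : Finset (Fin d → ℤ)} (c : Idx Λ → Bool) (b : Bool)
    {v : Fin d → ℤ} (hv : v ∈ Λ) :
    v ∈ cfgR Λ (Function.update c (Sum.inr ⟨v, hv⟩) b) ↔ b = true := by
  simp [cfgR, hv]

lemma finite_compare {r' : ℤ} (hr' : 1 ≤ r')
    {E0 : Set (Fin d → ℤ) → Set (Fin d → ℤ)}
    (hloc : ∀ ω ω' : Set (Fin d → ℤ), ω ∩ Binf d r' = ω' ∩ Binf d r' → E0 ω = E0 ω')
    (hrange : ∀ ω : Set (Fin d → ℤ), E0 ω ⊆ Binf d r') {D : ℤ} (hD : 0 < D)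
    (hpt : ∀ (n : ℤ) (x : Fin d → ℤ) (ω α : Set (Fin d → ℤ)), D < norm1 x →
      norm1 x + D < n → Arm n (enhancedConfig E0 (insert x ω) α) →
      ¬ Arm n (enhancedConfig E0 (ω \ {x}) α) →
      ∃ (y : Fin d → ℤ) (ω' α' : Set (Fin d → ℤ)), norm1 (y - x) ≤ D ∧
        (∀ z, D < norm1 (z - x) → (z ∈ ω' ↔ z ∈ ω) ∧ (z ∈ α' ↔ z ∈ α)) ∧
        Arm n (enhancedConfig E0 ω' (insert y α')) ∧ ¬ Arm n (enhancedConfig E0 ω' (α' \ {y})))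
    {δ p p1 s s1 : ℝ} (hδ : 0 < δ) (hδ1 : δ ≤ 1)
    (hp : δ ≤ p ∧ δ ≤ 1 - p) (hp1 : δ ≤ p1 ∧ δ ≤ 1 - p1) (hs : δ ≤ s ∧ δ ≤ 1 - s)
    (hs1 : δ ≤ s1 ∧ δ ≤ 1 - s1) (hpp : p ≤ p1) {b : ℕ} (hb : b = 2 * (ballF d D).card)
    (hss : s = s1 + b / δ ^ b * (p1 - p)) {μp μp1 μs μs1 : Measure ((Fin d → ℤ) → Bool)}
    (hμp : IsBernoulliProduct d p μp) (hμp1 : IsBernoulliProduct d p1 μp1)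
    (hμs : IsBernoulliProduct d s μs) (hμs1 : IsBernoulliProduct d s1 μs1) (n' : ℕ) :
    ENNReal.ofReal (δ ^ b) * theta0 μp1 ≤
      (μp.prod μs) {x | Arm n' (enhancedConfig E0 (toConfig x.1) (toConfig x.2))} := by
  classical
  have hρ : 0 ≤ (d : ℤ) * r' := by positivity
  have := hμp.1
  have := hμp1.1
  have := hμs.1
  have := hμs1.1
  set n : ℤ := n' + 2 * (d * r') + D + 1 with hn
  set Λ : Finset (Fin d → ℤ) := ballF d (n + 2 * (d * r')) with hΛ
  have memΛ : ∀ v, v ∈ Λ ↔ norm1 v ≤ n + 2 * (d * r') := fun v => mem_ballF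
  have hdep : ∀ m : ℤ, 0 ≤ m → m ≤ n → DepOn Λ fun ω α => Arm m (enhancedConfig E0 ω α) := by
    intro m hm hmn ω ω' α α' h1 h2
    exact arm_enh_congr (by omega) hloc hrange hm (fun v hv => h1 v ((memΛ v).2 (by omega)))
      (fun v hv => h2 v ((memΛ v).2 (by omega)))
  have hdep0 : DepOn Λ fun ω _ => Arm n ω := by
    intro ω ω' α α' h1 h2
    exact arm_congr (by omega) (fun v hv => h1 v ((memΛ v).2 (by omega)))
  -- step 1
  have hq0 : ∀ i, δ ≤ qq Λ p1 s1 i ∧ δ ≤ 1 - qq Λ p1 s1 i := by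
    rintro (i | i)
    · exact hp1
    · exact hs1
  have unit : ∀ q : Idx Λ → ℝ, (∀ i, δ ≤ q i ∧ δ ≤ 1 - q i) → ∀ i, 0 ≤ q i ∧ q i ≤ 1 :=
    fun q h i => ⟨by linarith [(h i).1], by linarith [(h i).2]⟩
  set A : (Idx Λ → Bool) → Prop := fun c => Arm n (enhancedConfig E0 (cfgL Λ c) (cfgR Λ c)) with hA
  set A' : (Idx Λ → Bool) → Prop :=
    fun c => Arm (n' : ℤ) (enhancedConfig E0 (cfgL Λ c) (cfgR Λ c)) with hA'
  have st1 : theta0 μp1 ≤ ENNReal.ofReal (Pr (qq Λ p1 s1) A) := by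
    have h1 := bridge hdep0 (by linarith : 0 ≤ p1) (by linarith) (by linarith : 0 ≤ s1) (by linarith)
      hμp1 hμs1
    have h2 : theta0 μp1 ≤ (μp1.prod μs1) {x | Arm n (toConfig x.1)} := by
      have e : {x : ((Fin d → ℤ) → Bool) × ((Fin d → ℤ) → Bool) | Arm n (toConfig x.1)} =
          {ω | Arm n (toConfig ω)} ×ˢ Set.univ := by
        ext x; simp
      rw [e, Measure.prod_prod, measure_univ, mul_one]
      apply measure_mono
      intro ω hω
      have := origin_iff_arm.1 hω n.toNat
      rwa [Int.toNat_of_nonneg (by omega)] at this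
    rw [h1] at h2
    refine h2.trans (ENNReal.ofReal_le_ofReal (Pr_mono (unit _ hq0) fun c hc => ?_))
    exact hc.mono subset_enh
  -- step 2
  set q1 : Idx Λ → ℝ := Sum.elim
    (fun v => if D < norm1 v.1 ∧ norm1 v.1 + D < n then p else p1) (fun _ => s) with hq1d
  have hq1 : ∀ i, δ ≤ q1 i ∧ δ ≤ 1 - q1 i := by
    rintro (i | i)
    · simp only [hq1d, Sum.elim_inl]
      split_ifs
      · exact hp
      · exact hp1
    · exact hs
  set I : Finset (Idx Λ) := Finset.univ.filter fun k =>
    k.isLeft = true ∧ D < norm1 (pt k) ∧ norm1 (pt k) + D < n with hI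
  set J : Finset (Idx Λ) := Finset.univ.filter fun k => k.isLeft = false with hJ
  set N : Idx Λ → Finset (Idx Λ) := fun i => Finset.univ.filter fun k => norm1 (pt k - pt i) ≤ D
    with hN
  have st2 : Pr (qq Λ p1 s1) A ≤ Pr q1 A := by
    refine tradeoff (q0 := qq Λ p1 s1) (q1 := q1) hδ hδ1 (ε := p1 - p) (by linarith) hq0 hq1 A I J
      ?_ N (b := b) (b' := b) ?_ ?_ ?_ ?_ ?_ ?_ ?_
    · rw [Finset.disjoint_left]
      intro k hk hk'
      simp only [hI, hJ, Finset.mem_filter] at hk hk'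
      simp [hk.2.1] at hk'
    · intro i _
      rw [hb]
      exact card_near D (pt i) _ fun k hk => (Finset.mem_filter.1 hk).2
    · intro j _
      rw [hb]
      refine card_near D (pt j) _ fun k hk => ?_
      have := (Finset.mem_filter.1 (Finset.mem_filter.1 hk).2).2
      rwa [norm1_sub_comm] at this
    · intro j hj c hc
      rcases j with j | j
      · simp [hJ] at hj
      have hL : ∀ b b' : Bool, ∀ v ∈ Λ, (v ∈ cfgL Λ (Function.update c (Sum.inr j) b) ↔
          v ∈ cfgL Λ (Function.update c (Sum.inr j) b')) := fun b b' v hv => by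
        rw [mem_cfgL_update _ _ _ hv (by simp), mem_cfgL_update _ _ _ hv (by simp)]
      have : cfgR Λ (Function.update c (Sum.inr j) false) ⊆
          cfgR Λ (Function.update c (Sum.inr j) true) := by
        rintro v ⟨hv, h⟩
        refine ⟨hv, ?_⟩
        by_cases hvj : (Sum.inr ⟨v, hv⟩ : Idx Λ) = Sum.inr j
        · rw [hvj, Function.update_self]
        · rw [Function.update_of_ne hvj] at h ⊢; exact h
      have h2 := hc.mono (enh_mono this)
      exact (hdep n (by omega) le_rfl _ _ _ _ (hL false true) (fun _ _ => Iff.rfl)).1 h2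
    · intro i hi c hc
      simp only [hI, Finset.mem_filter, Finset.mem_univ, true_and] at hi
      obtain ⟨hl, hx1, hx2⟩ := hi
      rcases i with ⟨x, hx⟩ | i
      swap
      · simp at hl
      change D < norm1 x at hx1
      change norm1 x + D < n at hx2
      have c1 : Arm n (enhancedConfig E0 (insert x (cfgL Λ c)) (cfgR Λ c)) := by
        refine (hdep n (by omega) le_rfl _ _ _ _ ?_ ?_).1 hc.1
        · intro v hv
          by_cases hvx : v = x
          · subst hvx
            simp [mem_cfgL_self]
          · rw [mem_cfgL_update _ _ _ hv (by simpa using Ne.symm hvx)]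
            simp [hvx]
        · intro v hv
          rw [mem_cfgR_update _ _ _ hv (by simp)]
      have c2 : ¬ Arm n (enhancedConfig E0 (cfgL Λ c \ {x}) (cfgR Λ c)) := by
        intro h
        refine hc.2 ((hdep n (by omega) le_rfl _ _ _ _ ?_ ?_).2 h)
        · intro v hv
          by_cases hvx : v = x
          · subst hvx
            simp [mem_cfgL_self]
          · rw [mem_cfgL_update _ _ _ hv (by simpa using Ne.symm hvx)]
            simp [hvx]
        · intro v hv
          rw [mem_cfgR_update _ _ _ hv (by simp)]
      obtain ⟨y, ω', α', hy, hag, h1, h0⟩ := hpt n x _ _ hx1 hx2 c1 c2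
      have hyΛ : y ∈ Λ := (memΛ y).2 (by have := norm1_tri y x; omega)
      refine ⟨Sum.inr ⟨y, hyΛ⟩, by simp [hJ], Finset.mem_filter.2 ⟨Finset.mem_univ _, hy⟩,
        Sum.elim (fun v => decide (v.1 ∈ ω')) (fun v => decide (v.1 ∈ α')), ?_, ?_, ?_⟩
      · rintro (⟨k, hk⟩ | ⟨k, hk⟩) hkN
        · have : D < norm1 (k - x) := by
            by_contra h
            exact hkN (Finset.mem_filter.2 ⟨Finset.mem_univ _, not_lt.1 h⟩)
          have := (hag k this).1
          simp only [Sum.elim_inl, this]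
          rw [Bool.eq_iff_iff]
          simp [cfgL, hk]
        · have : D < norm1 (k - x) := by
            by_contra h
            exact hkN (Finset.mem_filter.2 ⟨Finset.mem_univ _, not_lt.1 h⟩)
          have := (hag k this).2
          simp only [Sum.elim_inr, this]
          rw [Bool.eq_iff_iff]
          simp [cfgR, hk]
      · refine (hdep n (by omega) le_rfl _ _ _ _ ?_ ?_).2 h1
        · intro v hv
          rw [mem_cfgL_update _ _ _ hv (by simp)]
          simp [cfgL, hv]
        · intro v hv
          by_cases hvx : v = y
          · subst hvx
            exact iff_of_true ((mem_cfgR_self _ _ hv).2 rfl) (Set.mem_insert _ _)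
          · rw [mem_cfgR_update _ _ _ hv (by simpa using Ne.symm hvx)]
            simp [cfgR, hv, hvx]
      · intro h
        refine h0 ((hdep n (by omega) le_rfl _ _ _ _ ?_ ?_).1 h)
        · intro v hv
          rw [mem_cfgL_update _ _ _ hv (by simp)]
          simp [cfgL, hv]
        · intro v hv
          by_cases hvx : v = y
          · subst hvx
            exact iff_of_false (fun h => Bool.false_ne_true ((mem_cfgR_self _ _ hv).1 h)) (fun h => h.2 rfl)
          · rw [mem_cfgR_update _ _ _ hv (by simpa using Ne.symm hvx)]
            simp [cfgR, hv, hvx]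
    · intro i hi
      simp only [hI, Finset.mem_filter, Finset.mem_univ, true_and] at hi
      rcases i with i | i
      · have h1 : D < norm1 i.1 := hi.2.1
        have h2 : norm1 i.1 + D < n := hi.2.2
        simp [hq1d, qq, h1, h2]
      · simp at hi
    · intro j hj
      rcases j with j | j
      · simp [hJ] at hj
      · simpa [hq1d, qq] using hss
    · intro i hi hj
      rcases i with i | i
      · have : ¬ (D < norm1 i.1 ∧ norm1 i.1 + D < n) := by
          intro h
          exact hi (Finset.mem_filter.2 ⟨Finset.mem_univ _, rfl, h⟩)
        simp only [hq1d, qq, Sum.elim_inl, if_neg this]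
      · simp [hJ] at hj
  -- step 3
  have st3 : Pr q1 A ≤ Pr q1 A' := Pr_mono (unit _ hq1) fun c hc => hc.anti (by omega) (by omega)
  set q2 : Idx Λ → ℝ := Sum.elim
    (fun v => if D < norm1 v.1 then p else p1) (fun _ => s) with hq2d
  have hq2 : ∀ i, δ ≤ q2 i ∧ δ ≤ 1 - q2 i := by
    rintro (i | i)
    · simp only [hq2d, Sum.elim_inl]
      split_ifs
      · exact hp
      · exact hp1
    · exact hs
  have st4 : Pr q1 A' = Pr q2 A' := by
    apply Pr_irrel A' (Finset.univ.filter fun k : Idx Λ => k.isLeft = true ∧ n ≤ norm1 (pt k) + D)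
    · intro k hk c b
      simp only [Finset.mem_filter, Finset.mem_univ, true_and] at hk
      rcases k with k | k
      swap
      · simp at hk
      have hk2 : n ≤ norm1 k.1 + D := hk.2
      apply arm_enh_congr (by omega) hloc hrange (by omega)
      · intro v hv
        apply mem_cfgL_update _ _ _ ((memΛ v).2 (by omega))
        simp only [ne_eq, Sum.inl.injEq]
        intro h
        have := congrArg Subtype.val h
        simp only at this
        rw [← this] at hv
        omega
      · intro v hv
        exact mem_cfgR_update _ _ _ ((memΛ v).2 (by omega)) (by simp)
    · intro k hk
      rcases k with k | k
      · have : norm1 k.1 + D < n := by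
          by_contra h
          exact hk (Finset.mem_filter.2 ⟨Finset.mem_univ _, rfl, not_lt.1 h⟩)
        simp [hq1d, hq2d, this]
      · simp [hq1d, hq2d]
  have hq3 : ∀ i, δ ≤ qq Λ p s i ∧ δ ≤ 1 - qq Λ p s i := by
    rintro (i | i)
    · exact hp
    · exact hs
  have st5 : δ ^ b * Pr q2 A' ≤ Pr (qq Λ p s) A' := by
    have h := Pr_finite_energy (unit _ hq2) (unit _ hq3) hδ.le
      (Finset.univ.filter fun k : Idx Λ => norm1 (pt k - 0) ≤ D) (fun i _ => hq3 i) ?_ A'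
    · refine le_trans (mul_le_mul_of_nonneg_right ?_ (Pr_nonneg (unit _ hq2) _)) h
      apply pow_le_pow_of_le_one hδ.le hδ1
      rw [hb]
      exact card_near D 0 _ fun k hk => (Finset.mem_filter.1 hk).2
    · intro i hi
      rcases i with i | i
      · have : D < norm1 i.1 := by simpa [pt] using hi
        simp [hq2d, qq, this]
      · simp [hq2d, qq]
  rw [bridge (hdep n' (by omega) (by omega)) (by linarith : 0 ≤ p) (by linarith)
    (by linarith : 0 ≤ s) (by linarith) hμp hμs]
  calc ENNReal.ofReal (δ ^ b) * theta0 μp1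
      ≤ ENNReal.ofReal (δ ^ b) * ENNReal.ofReal (Pr (qq Λ p1 s1) A) := by gcongr
    _ = ENNReal.ofReal (δ ^ b * Pr (qq Λ p1 s1) A) := by
        rw [ENNReal.ofReal_mul (by positivity)]
    _ ≤ _ := by
        apply ENNReal.ofReal_le_ofReal
        refine le_trans ?_ st5
        apply mul_le_mul_of_nonneg_left _ (by positivity)
        exact st2.trans (st3.trans st4.le)

lemma theta_ge {r' : ℤ} (hr' : 1 ≤ r')
    {E0 : Set (Fin d → ℤ) → Set (Fin d → ℤ)}
    (hloc : ∀ ω ω' : Set (Fin d → ℤ), ω ∩ Binf d r' = ω' ∩ Binf d r' → E0 ω = E0 ω')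
    (hrange : ∀ ω : Set (Fin d → ℤ), E0 ω ⊆ Binf d r')
    {μ ν : Measure ((Fin d → ℤ) → Bool)} [IsProbabilityMeasure μ] [IsProbabilityMeasure ν]
    {κ : ENNReal} (h : ∀ n : ℕ, κ ≤
      (μ.prod ν) {x | Arm n (enhancedConfig E0 (toConfig x.1) (toConfig x.2))}) :
    κ ≤ theta E0 μ ν := by
  have hρ : 0 ≤ (d : ℤ) * r' := by positivity
  have e : {ωα : ((Fin d → ℤ) → Bool) × ((Fin d → ℤ) → Bool) |
      OriginInInfiniteCluster (enhancedConfig E0 (toConfig ωα.1) (toConfig ωα.2))} =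
      ⋂ n : ℕ, {x | Arm n (enhancedConfig E0 (toConfig x.1) (toConfig x.2))} := by
    ext x
    simp only [Set.mem_ofPred_eq, Set.mem_iInter]
    exact origin_iff_arm
  unfold theta
  rw [e, Antitone.measure_iInter]
  · exact le_iInf h
  · intro m n hmn x hx
    exact Arm.anti (by omega) (by exact_mod_cast hmn) hx
  · intro n
    apply MeasurableSet.nullMeasurableSet
    apply measurableSet_event (Λ := ballF d (n + 2 * (d * r')))
      (B := fun ω α => Arm n (enhancedConfig E0 ω α))
    intro ω ω' α α' h1 h2
    exact arm_enh_congr (by omega) hloc hrange (by omega) (fun v hv => h1 v (mem_ballF.2 hv))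
      (fun v hv => h2 v (mem_ballF.2 hv))
  · exact ⟨0, measure_ne_top _ _⟩

end Compare

open MeasureTheory

/-! ### The critical probability is positive -/

section pcpos
variable {d : ℕ}

/-- Lists of `n + 1` points starting at `x` with increments of norm at most one. -/
noncomputable def Wk (d : ℕ) : ℕ → (Fin d → ℤ) → Finset (List (Fin d → ℤ))
  | 0, x => {[x]}
  | n + 1, x => (ballF d 1).biUnion fun e => (Wk d n (x + e)).image fun L => x :: L

lemma card_Wk (n : ℕ) : ∀ x : Fin d → ℤ, (Wk d n x).card ≤ (ballF d 1).card ^ n := by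
  induction n with
  | zero => intro x; simp [Wk]
  | succ n ih =>
    intro x
    rw [Wk, pow_succ']
    exact Finset.card_biUnion_le_card_mul _ _ _ fun e _ => Finset.card_image_le.trans (ih _)

lemma length_Wk (n : ℕ) : ∀ x : Fin d → ℤ, ∀ L ∈ Wk d n x, L.length = n + 1 := by
  induction n with
  | zero => intro x L hL; simp [Wk] at hL; simp [hL]
  | succ n ih =>
    intro x L hL
    simp only [Wk, Finset.mem_biUnion, Finset.mem_image] at hL
    obtain ⟨e, _, M, hM, rfl⟩ := hL
    simp [ih _ M hM]

lemma take_mem_Wk (n : ℕ) : ∀ (x : Fin d → ℤ) (t : List (Fin d → ℤ)),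
    List.IsChain Adj (x :: t) → n ≤ t.length → x :: t.take n ∈ Wk d n x := by
  induction n with
  | zero => intro x t _ _; simp [Wk]
  | succ n ih =>
    intro x t hc hl
    rcases t with _ | ⟨y, t⟩
    · simp at hl
    · rw [List.isChain_cons_cons] at hc
      simp only [Wk, Finset.mem_biUnion, Finset.mem_image]
      refine ⟨y - x, mem_ballF.2 ?_, y :: t.take n, ?_, by simp⟩
      · have := hc.1.symm
        unfold Adj at this
        omega
      · rw [add_sub_cancel]
        exact ih y t hc.2 (by simpa using hl)

lemma chain_norm : ∀ (t : List (Fin d → ℤ)) (x : Fin d → ℤ),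
    List.IsChain Adj (x :: t) →
    norm1 ((x :: t).getLast (List.cons_ne_nil _ _)) ≤ norm1 x + t.length := by
  intro t
  induction t with
  | nil => intro x _; simp
  | cons y t ih =>
    intro x hc
    rw [List.isChain_cons_cons] at hc
    have h1 := ih y hc.2
    have h2 := hc.1.symm
    unfold Adj at h2
    have h3 := norm1_tri y x
    rw [List.getLast_cons (List.cons_ne_nil _ _)]
    simp only [List.length_cons, Nat.cast_add, Nat.cast_one]
    omega

lemma theta0_eq_zero {p : ℝ} (hp0 : 0 ≤ p) (hp : p * (ballF d 1).card < 1)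
    {μ : Measure ((Fin d → ℤ) → Bool)} (hμ : IsBernoulliProduct d p μ) : theta0 μ = 0 := by
  classical
  set K := (ballF d 1).card with hK
  set q := ENNReal.ofReal p with hq
  have hKpos : 1 ≤ K := Finset.card_pos.2 ⟨0, mem_ballF.2 (by simp [norm1_zero])⟩
  have hKR : (1 : ℝ) ≤ K := by exact_mod_cast hKpos
  have hp1 : p ≤ 1 := by nlinarith
  have hq1 : q ≤ 1 := by rw [hq]; exact ENNReal.ofReal_le_one.2 hp1
  have bound : ∀ n : ℕ, theta0 μ ≤ (q * K) ^ n := by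
    intro n
    have hsub : {ω : (Fin d → ℤ) → Bool | OriginInInfiniteCluster (toConfig ω)} ⊆
        ⋃ L ∈ (Wk d n 0).filter List.Nodup, {ω | ∀ v ∈ L.toFinset, ω v = (fun _ => true) v} := by
      intro ω hω
      obtain ⟨h0, y, hy, hr⟩ := origin_iff_arm.1 hω n
      obtain ⟨L, hL, hnd, hch, hmem, hhead, hlast⟩ :=
        hasPathJoining_iff.2 ⟨h0, hr.mono Set.inter_subset_left⟩
      rcases L with _ | ⟨x, t⟩
      · exact absurd rfl hL
      simp only [List.head_cons] at hhead
      subst hhead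
      have hlen := chain_norm t _ hch
      rw [hlast, hy, norm1_zero] at hlen
      have hlen' : n ≤ t.length := by omega
      simp only [Set.mem_iUnion]
      refine ⟨0 :: t.take n, Finset.mem_filter.2 ⟨take_mem_Wk n 0 t hch hlen', ?_⟩, ?_⟩
      · have : (0 :: t.take n) = ((0 : Fin d → ℤ) :: t).take (n + 1) := by simp
        rw [this]
        exact hnd.sublist (List.take_sublist _ _)
      · intro v hv
        rw [List.mem_toFinset] at hv
        have : v ∈ (0 : Fin d → ℤ) :: t := by
          rcases List.mem_cons.1 hv with h | h
          · exact List.mem_cons.2 (Or.inl h)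
          · exact List.mem_cons.2 (Or.inr (List.mem_of_mem_take h))
        exact hmem v this
    calc theta0 μ ≤ μ (⋃ L ∈ (Wk d n 0).filter List.Nodup,
          {ω | ∀ v ∈ L.toFinset, ω v = (fun _ => true) v}) := measure_mono hsub
      _ ≤ ∑ L ∈ (Wk d n 0).filter List.Nodup, μ {ω | ∀ v ∈ L.toFinset, ω v = (fun _ => true) v} :=
          measure_biUnion_finset_le _ _
      _ ≤ ∑ L ∈ (Wk d n 0).filter List.Nodup, q ^ n := by
          apply Finset.sum_le_sum
          intro L hL
          rw [Finset.mem_filter] at hL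
          rw [hμ.2 L.toFinset (fun _ => true)]
          simp only [if_true, Finset.prod_const]
          rw [List.toFinset_card_of_nodup hL.2, length_Wk n 0 L hL.1]
          exact pow_le_pow_of_le_one (zero_le) hq1 (by omega)
      _ ≤ (q * K) ^ n := by
          rw [Finset.sum_const, nsmul_eq_mul, mul_pow, mul_comm]
          gcongr
          exact_mod_cast (Finset.card_filter_le _ _).trans (card_Wk n 0)
  have hlt : q * K < 1 := by
    have : (K : ENNReal) = ENNReal.ofReal K := by simp
    rw [hq, this, ← ENNReal.ofReal_mul hp0]
    rw [← ENNReal.ofReal_one]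
    exact (ENNReal.ofReal_lt_ofReal_iff (by norm_num)).2 hp
  have := ge_of_tendsto' (ENNReal.tendsto_pow_atTop_nhds_zero_of_lt_one hlt) bound
  exact le_antisymm this (zero_le)

end pcpos

/-! ### The critical probability is smaller than one -/

section pclt

/-- The sub-box `3 z + i`. -/
def sb (z : ℕ × ℕ) (i : Fin 3 × Fin 3) : ℕ × ℕ := (3 * z.1 + i.1, 3 * z.2 + i.2)

/-- Multiscale bad boxes. -/
def Bad (o : Set (ℕ × ℕ)) : ℕ → ℕ × ℕ → Prop
  | 0, z => z ∉ o
  | n + 1, z => ∃ i j : Fin 3 × Fin 3, i ≠ j ∧ Bad o n (sb z i) ∧ Bad o n (sb z j)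

/-- One step to the right or up between good boxes. -/
def Gs (o : Set (ℕ × ℕ)) (n : ℕ) (z w : ℕ × ℕ) : Prop :=
  ¬ Bad o n z ∧ ¬ Bad o n w ∧ (w = (z.1 + 1, z.2) ∨ w = (z.1, z.2 + 1))

def Gc (o : Set (ℕ × ℕ)) (n : ℕ) : ℕ × ℕ → ℕ × ℕ → Prop := Relation.EqvGen (Gs o n)

lemma good_exc {o : Set (ℕ × ℕ)} {n : ℕ} {z : ℕ × ℕ} (h : ¬ Bad o (n + 1) z) :
    ∃ k : Fin 3 × Fin 3, ∀ i, i ≠ k → ¬ Bad o n (sb z i) := by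
  by_cases hk : ∃ k, Bad o n (sb z k)
  · obtain ⟨k, hk⟩ := hk
    exact ⟨k, fun i hi hb => h ⟨i, k, hi, hb, hk⟩⟩
  · push Not at hk
    exact ⟨0, fun i _ => hk i⟩

def a3 (i j : Fin 3 × Fin 3) : Prop :=
  ((j.1 : ℕ) = i.1 + 1 ∧ j.2 = i.2) ∨ (j.1 = i.1 ∧ (j.2 : ℕ) = i.2 + 1)

instance : DecidableRel a3 := fun i j => by unfold a3; infer_instance

def rk (k i : Fin 3 × Fin 3) : ℕ :=
  if k = (1, 1) then i.1 + i.2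
  else ((i.1 : ℤ) - 1).natAbs + ((i.2 : ℤ) - 1).natAbs

def hub (k : Fin 3 × Fin 3) : Fin 3 × Fin 3 := if k = (1, 1) then (0, 0) else (1, 1)

lemma rk_dec : ∀ k i : Fin 3 × Fin 3, i ≠ k → i = hub k ∨
    ∃ x, x ≠ k ∧ (a3 i x ∨ a3 x i) ∧ rk k x < rk k i := by
  decide

lemma a3_sb {o : Set (ℕ × ℕ)} {n : ℕ} {z : ℕ × ℕ} {i j : Fin 3 × Fin 3} (h : a3 i j)
    (hi : ¬ Bad o n (sb z i)) (hj : ¬ Bad o n (sb z j)) : Gc o n (sb z i) (sb z j) := by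
  refine Relation.EqvGen.rel _ _ ⟨hi, hj, ?_⟩
  rcases h with ⟨h1, h2⟩ | ⟨h1, h2⟩
  · left; simp only [sb, h1, h2]; rfl
  · right; simp only [sb, h1, h2]; rfl

lemma to_hub {o : Set (ℕ × ℕ)} {n : ℕ} {z : ℕ × ℕ} {k : Fin 3 × Fin 3}
    (hk : ∀ i, i ≠ k → ¬ Bad o n (sb z i)) : ∀ m : ℕ, ∀ i, i ≠ k → rk k i ≤ m →
    Gc o n (sb z i) (sb z (hub k)) := by
  intro m
  induction m with
  | zero =>
    intro i hi hm
    rcases rk_dec k i hi with rfl | ⟨x, _, _, h⟩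
    · exact Relation.EqvGen.refl _
    · omega
  | succ m ih =>
    intro i hi hm
    rcases rk_dec k i hi with rfl | ⟨x, hx, ha, h⟩
    · exact Relation.EqvGen.refl _
    · refine Relation.EqvGen.trans _ _ _ ?_ (ih x hx (by omega))
      rcases ha with ha | ha
      · exact a3_sb ha (hk i hi) (hk x hx)
      · exact (a3_sb ha (hk x hx) (hk i hi)).symm

lemma within {o : Set (ℕ × ℕ)} {n : ℕ} {z : ℕ × ℕ} (h : ¬ Bad o (n + 1) z)
    {i j : Fin 3 × Fin 3} (hi : ¬ Bad o n (sb z i)) (hj : ¬ Bad o n (sb z j)) :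
    Gc o n (sb z i) (sb z j) := by
  by_cases hex : ∃ k, Bad o n (sb z k)
  · obtain ⟨k, hkb⟩ := hex
    have hk : ∀ i, i ≠ k → ¬ Bad o n (sb z i) := fun i hi hb => h ⟨i, k, hi, hb, hkb⟩
    have hik : i ≠ k := by rintro rfl; exact hi hkb
    have hjk : j ≠ k := by rintro rfl; exact hj hkb
    exact Relation.EqvGen.trans _ _ _ (to_hub hk _ i hik le_rfl) (to_hub hk _ j hjk le_rfl).symm
  · push Not at hex
    have : ∀ i j : Fin 3 × Fin 3, ∃ k, i ≠ k ∧ j ≠ k := by decide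
    obtain ⟨k, hik, hjk⟩ := this i j
    have hk : ∀ i, i ≠ k → ¬ Bad o n (sb z i) := fun i _ => hex i
    exact Relation.EqvGen.trans _ _ _ (to_hub hk _ i hik le_rfl) (to_hub hk _ j hjk le_rfl).symm

lemma ex1 : ∀ k k' : Fin 3 × Fin 3, ∃ t : Fin 3, ((2, t) : Fin 3 × Fin 3) ≠ k ∧ (0, t) ≠ k' := by
  decide
lemma ex2 : ∀ k k' : Fin 3 × Fin 3, ∃ t : Fin 3, ((t, 2) : Fin 3 × Fin 3) ≠ k ∧ (t, 0) ≠ k' := by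
  decide

lemma across {o : Set (ℕ × ℕ)} {n : ℕ} {z w : ℕ × ℕ} (h : Gs o (n + 1) z w) :
    ∃ i j, ¬ Bad o n (sb z i) ∧ ¬ Bad o n (sb w j) ∧ Gc o n (sb z i) (sb w j) := by
  obtain ⟨hz, hw, h⟩ := h
  obtain ⟨k, hk⟩ := good_exc hz
  obtain ⟨k', hk'⟩ := good_exc hw
  rcases h with rfl | rfl
  · obtain ⟨t, h1, h2⟩ := ex1 k k'
    refine ⟨_, _, hk _ h1, hk' _ h2, Relation.EqvGen.rel _ _ ⟨hk _ h1, hk' _ h2, Or.inl ?_⟩⟩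
    simp [sb]; ring
  · obtain ⟨t, h1, h2⟩ := ex2 k k'
    refine ⟨_, _, hk _ h1, hk' _ h2, Relation.EqvGen.rel _ _ ⟨hk _ h1, hk' _ h2, Or.inr ?_⟩⟩
    simp [sb]; ring

lemma good_sub {o : Set (ℕ × ℕ)} {n : ℕ} {z : ℕ × ℕ} (h : ¬ Bad o (n + 1) z) :
    ∃ i, ¬ Bad o n (sb z i) := by
  obtain ⟨k, hk⟩ := good_exc h
  have : ∀ k : Fin 3 × Fin 3, ∃ i, i ≠ k := by decide
  obtain ⟨i, hi⟩ := this k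
  exact ⟨i, hk i hi⟩

lemma descend {o : Set (ℕ × ℕ)} {n : ℕ} {z w : ℕ × ℕ} (h : Gc o (n + 1) z w) :
    (¬ Bad o (n + 1) z ↔ ¬ Bad o (n + 1) w) ∧ (¬ Bad o (n + 1) z → ∀ i j, ¬ Bad o n (sb z i) →
      ¬ Bad o n (sb w j) → Gc o n (sb z i) (sb w j)) := by
  induction h with
  | rel z w h =>
    refine ⟨iff_of_true h.1 h.2.1, fun _ i j hi hj => ?_⟩
    obtain ⟨i', j', hi', hj', hc⟩ := across h
    exact Relation.EqvGen.trans _ _ _ (within h.1 hi hi')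
      (Relation.EqvGen.trans _ _ _ hc (within h.2.1 hj' hj))
  | refl z => exact ⟨Iff.rfl, fun h i j hi hj => within h hi hj⟩
  | symm z w _ ih =>
    exact ⟨ih.1.symm, fun h i j hi hj => (ih.2 (ih.1.2 h) j i hj hi).symm⟩
  | trans x y z _ _ h1 h2 =>
    refine ⟨h1.1.trans h2.1, fun h i j hi hj => ?_⟩
    obtain ⟨k, hk⟩ := good_sub (h1.1.1 h)
    exact Relation.EqvGen.trans _ _ _ (h1.2 h i k hi hk) (h2.2 (h1.1.1 h) k j hk hj)

lemma descend_all {o : Set (ℕ × ℕ)} (h0 : ∀ n, ¬ Bad o n (0, 0)) (n : ℕ) : ∀ (w : ℕ × ℕ),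
    Gc o n (0, 0) w → ¬ Bad o n w → ∃ u ∈ o, Gc o 0 (0, 0) u ∧ 3 ^ n * w.1 ≤ u.1 := by
  induction n with
  | zero => intro w h hw; exact ⟨w, by simpa [Bad] using hw, h, by simp⟩
  | succ n ih =>
    intro w h hw
    obtain ⟨i, hi⟩ := good_sub hw
    have := (descend h).2 (h0 _) (0, 0) i (h0 n) hi
    obtain ⟨u, hu, hc, hle⟩ := ih (sb w i) this hi
    refine ⟨u, hu, hc, le_trans ?_ hle⟩
    rw [pow_succ, mul_assoc]
    exact Nat.mul_le_mul_left _ (Nat.le_add_right _ _)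

lemma far {o : Set (ℕ × ℕ)} (h0 : ∀ n, ¬ Bad o n (0, 0)) (n : ℕ) :
    ∃ u ∈ o, Gc o 0 (0, 0) u ∧ n ≤ u.1 := by
  obtain ⟨k, hk⟩ := good_exc (h0 (n + 1))
  have : ∀ k : Fin 3 × Fin 3, ∃ t : Fin 3, ((2, t) : Fin 3 × Fin 3) ≠ k := by decide
  obtain ⟨t, ht⟩ := this k
  have hg := hk _ ht
  have hc := within (h0 (n + 1)) (i := (0, 0)) (h0 n) hg
  obtain ⟨u, hu, hc, hle⟩ := descend_all h0 n _ hc hg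
  refine ⟨u, hu, hc, le_trans ?_ hle⟩
  have : n < 3 ^ n := Nat.lt_pow_self (by norm_num)
  simp only [sb]
  nlinarith [Nat.zero_le (t : ℕ), show ((2 : Fin 3) : ℕ) = 2 from rfl]

/-- Witness sets for bad boxes. -/
def Wit : ℕ → ℕ × ℕ → Finset (Finset (ℕ × ℕ))
  | 0, z => {{z}}
  | n + 1, z => ((Finset.univ : Finset ((Fin 3 × Fin 3) × (Fin 3 × Fin 3))).filter
      fun ij => ij.1 ≠ ij.2).biUnion fun ij =>
        ((Wit n (sb z ij.1)) ×ˢ (Wit n (sb z ij.2))).image fun T => T.1 ∪ T.2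

lemma card_Wit (n : ℕ) : ∀ z, 81 * (Wit n z).card ≤ 81 ^ (2 ^ n) := by
  induction n with
  | zero => intro z; simp [Wit]
  | succ n ih =>
    intro z
    have h : (Wit (n + 1) z).card ≤ ∑ ij : (Fin 3 × Fin 3) × (Fin 3 × Fin 3),
        (Wit n (sb z ij.1)).card * (Wit n (sb z ij.2)).card := by
      rw [Wit]
      refine Finset.card_biUnion_le.trans ?_
      refine (Finset.sum_le_sum fun ij _ => Finset.card_image_le).trans ?_
      simp only [Finset.card_product]
      exact Finset.sum_le_sum_of_subset (Finset.filter_subset _ _)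
    have h2 : ∀ ij : (Fin 3 × Fin 3) × (Fin 3 × Fin 3),
        81 * 81 * ((Wit n (sb z ij.1)).card * (Wit n (sb z ij.2)).card) ≤ 81 ^ (2 ^ (n + 1)) := by
      intro ij
      have := Nat.mul_le_mul (ih (sb z ij.1)) (ih (sb z ij.2))
      rw [← pow_add, ← two_mul, ← pow_succ'] at this
      calc _ = _ := by ring
        _ ≤ _ := this
    have h3 := Finset.sum_le_sum fun (ij : (Fin 3 × Fin 3) × (Fin 3 × Fin 3))
      (_ : ij ∈ Finset.univ) => h2 ij
    rw [← Finset.mul_sum] at h3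
    simp only [Finset.sum_const, Finset.card_univ, Fintype.card_prod, Fintype.card_fin,
      smul_eq_mul] at h3
    omega

lemma Wit_box (n : ℕ) : ∀ z, ∀ T ∈ Wit n z, ∀ t ∈ T, t.1 / 3 ^ n = z.1 ∧ t.2 / 3 ^ n = z.2 := by
  induction n with
  | zero => intro z T hT t ht; simp [Wit] at hT; subst hT; simp at ht; simp [ht]
  | succ n ih =>
    intro z T hT t ht
    simp only [Wit, Finset.mem_biUnion, Finset.mem_image, Finset.mem_product] at hT
    obtain ⟨ij, _, U, ⟨hU1, hU2⟩, rfl⟩ := hT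
    have key : ∀ i, t.1 / 3 ^ n = (sb z i).1 ∧ t.2 / 3 ^ n = (sb z i).2 →
        t.1 / 3 ^ (n + 1) = z.1 ∧ t.2 / 3 ^ (n + 1) = z.2 := by
      rintro i ⟨h1, h2⟩
      rw [pow_succ, ← Nat.div_div_eq_div_mul, ← Nat.div_div_eq_div_mul, h1, h2]
      have := i.1.2
      have := i.2.2
      simp only [sb]
      omega
    rcases Finset.mem_union.1 ht with h | h
    · exact key _ (ih _ _ hU1 t h)
    · exact key _ (ih _ _ hU2 t h)

lemma sb_inj {z : ℕ × ℕ} {i j : Fin 3 × Fin 3} (h : sb z i = sb z j) : i = j := by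
  simp only [sb, Prod.mk.injEq, add_right_inj] at h
  exact Prod.ext (Fin.ext h.1) (Fin.ext h.2)

lemma Wit_card (n : ℕ) : ∀ z, ∀ T ∈ Wit n z, T.card = 2 ^ n := by
  induction n with
  | zero => intro z T hT; simp [Wit] at hT; simp [hT]
  | succ n ih =>
    intro z T hT
    simp only [Wit, Finset.mem_biUnion, Finset.mem_image, Finset.mem_product,
      Finset.mem_filter] at hT
    obtain ⟨ij, hij, U, ⟨hU1, hU2⟩, rfl⟩ := hT
    rw [Finset.card_union_of_disjoint, ih _ _ hU1, ih _ _ hU2, pow_succ]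
    · ring
    · rw [Finset.disjoint_left]
      intro t h1 h2
      have e1 := Wit_box n _ _ hU1 t h1
      have e2 := Wit_box n _ _ hU2 t h2
      exact hij.2 (sb_inj (Prod.ext (e1.1.symm.trans e2.1) (e1.2.symm.trans e2.2)))

lemma Bad_wit {o : Set (ℕ × ℕ)} (n : ℕ) : ∀ z, Bad o n z → ∃ T ∈ Wit n z, ∀ t ∈ T, t ∉ o := by
  induction n with
  | zero => intro z h; exact ⟨{z}, by simp [Wit], by simpa [Bad] using h⟩
  | succ n ih =>
    rintro z ⟨i, j, hij, h1, h2⟩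
    obtain ⟨T, hT, hT'⟩ := ih _ h1
    obtain ⟨U, hU, hU'⟩ := ih _ h2
    refine ⟨T ∪ U, ?_, ?_⟩
    · simp only [Wit, Finset.mem_biUnion, Finset.mem_image, Finset.mem_product,
        Finset.mem_filter]
      exact ⟨(i, j), ⟨Finset.mem_univ _, hij⟩, (T, U), ⟨hT, hU⟩, rfl⟩
    · intro t ht
      rcases Finset.mem_union.1 ht with h | h
      · exact hT' t h
      · exact hU' t h

/-- Embedding of the quadrant. -/
def emb (d : ℕ) (z : ℕ × ℕ) : Fin d → ℤ :=
  fun i => if (i : ℕ) = 0 then (z.1 : ℤ) else if (i : ℕ) = 1 then (z.2 : ℤ) else 0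

variable {d : ℕ}

lemma emb_inj (hd : 2 ≤ d) : Function.Injective (emb d) := by
  intro z w h
  have h0 := congrFun h ⟨0, by omega⟩
  have h1 := congrFun h ⟨1, by omega⟩
  simp [emb] at h0 h1
  exact Prod.ext h0 h1

lemma emb_adj (hd : 2 ≤ d) {z w : ℕ × ℕ}
    (h : w = (z.1 + 1, z.2) ∨ w = (z.1, z.2 + 1)) : Adj (emb d z) (emb d w) := by
  unfold Adj norm1
  rcases h with rfl | rfl
  · rw [Finset.sum_eq_single (⟨0, by omega⟩ : Fin d)]
    · simp [emb]
    · intro i _ hi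
      have : (i : ℕ) ≠ 0 := fun h => hi (Fin.ext h)
      simp [emb, this]
    · simp
  · rw [Finset.sum_eq_single (⟨1, by omega⟩ : Fin d)]
    · simp [emb]
    · intro i _ hi
      have : (i : ℕ) ≠ 1 := fun h => hi (Fin.ext h)
      simp [emb, this]
    · simp

lemma Gc_reach (hd : 2 ≤ d) {S : Set (Fin d → ℤ)} {z w : ℕ × ℕ}
    (h : Gc {z | emb d z ∈ S} 0 z w) :
    (emb d z ∈ S ↔ emb d w ∈ S) ∧ (emb d z ∈ S → Reach S (emb d z) (emb d w)) := by
  induction h with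
  | rel z w h =>
    have h1 : emb d z ∈ S := by simpa [Bad] using h.1
    have h2 : emb d w ∈ S := by simpa [Bad] using h.2.1
    exact ⟨iff_of_true h1 h2, fun _ => Reach.single (emb_adj hd h.2.2) h2⟩
  | refl z => exact ⟨Iff.rfl, fun h => Reach.refl _⟩
  | symm z w _ ih => exact ⟨ih.1.symm, fun h => (ih.2 (ih.1.2 h)).symm (ih.1.2 h)⟩
  | trans x y z _ _ h1 h2 =>
    exact ⟨h1.1.trans h2.1, fun h => (h1.2 h).trans (h2.2 (h1.1.1 h))⟩

lemma origin_of_good (hd : 2 ≤ d) {S : Set (Fin d → ℤ)}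
    (h : ∀ n, ¬ Bad {z | emb d z ∈ S} n (0, 0)) : OriginInInfiniteCluster S := by
  have e0 : emb d (0, 0) = 0 := by ext i; simp [emb]
  have h0 : emb d (0, 0) ∈ S := by simpa [Bad] using h 0
  rw [origin_iff_arm]
  intro n
  obtain ⟨u, hu, hc, hle⟩ := far h n
  have hr := (Gc_reach hd hc).2 h0
  rw [e0] at hr h0
  refine arm_of_reach (by omega) h0 ?_ hr
  have := abs_le_norm1 (emb d u) ⟨0, by omega⟩
  have h2 : emb d u ⟨0, by omega⟩ = (u.1 : ℤ) := by simp [emb]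
  rw [h2] at this
  have := le_abs_self (u.1 : ℤ)
  omega

lemma theta0_pos (hd : 2 ≤ d) {p : ℝ} (hp : p = 1 - 1 / 324)
    {μ : Measure ((Fin d → ℤ) → Bool)} (hμ : IsBernoulliProduct d p μ) : 0 < theta0 μ := by
  classical
  have := hμ.1
  by_contra hcon
  have hz : theta0 μ = 0 := by simpa using hcon
  set e := ENNReal.ofReal (1 - p) with he
  have h81 : 81 * e = 4⁻¹ := by
    rw [he, hp]
    rw [show (81 : ENNReal) = ENNReal.ofReal 81 by norm_num, ← ENNReal.ofReal_mul (by norm_num)]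
    norm_num
    rw [one_div, ENNReal.ofReal_inv_of_pos (by norm_num)]
    norm_num
  have hbad : ∀ n : ℕ, μ {ω | Bad {z | emb d z ∈ toConfig ω} n (0, 0)} ≤ 4⁻¹ ^ (n + 1) := by
    intro n
    have hsub : {ω | Bad {z | emb d z ∈ toConfig ω} n (0, 0)} ⊆
        ⋃ T ∈ Wit n (0, 0), {ω | ∀ v ∈ T.image (emb d), ω v = (fun _ => false) v} := by
      intro ω hω
      obtain ⟨T, hT, hT'⟩ := Bad_wit n _ hω
      simp only [Set.mem_iUnion]
      refine ⟨T, hT, ?_⟩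
      intro v hv
      obtain ⟨t, ht, rfl⟩ := Finset.mem_image.1 hv
      have := hT' t ht
      simpa [toConfig] using this
    calc _ ≤ _ := measure_mono hsub
      _ ≤ ∑ T ∈ Wit n (0, 0), μ {ω | ∀ v ∈ T.image (emb d), ω v = (fun _ => false) v} :=
          measure_biUnion_finset_le _ _
      _ = ∑ T ∈ Wit n (0, 0), e ^ (2 ^ n) := by
          apply Finset.sum_congr rfl
          intro T hT
          rw [hμ.2 (T.image (emb d)) (fun _ => false)]
          simp only [Finset.prod_const, Bool.false_eq_true, if_false]
          rw [Finset.card_image_of_injective _ (emb_inj hd), Wit_card n _ T hT]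
      _ ≤ (81 * e) ^ (2 ^ n) := by
          rw [Finset.sum_const, nsmul_eq_mul, mul_pow]
          gcongr
          have := card_Wit n (0, 0)
          exact_mod_cast (by omega : (Wit n (0, 0)).card ≤ 81 ^ 2 ^ n)
      _ ≤ _ := by
          rw [h81]
          apply pow_le_pow_of_le_one (zero_le)
          · rw [ENNReal.inv_le_one]; norm_num
          · exact Nat.lt_two_pow_self
  have huniv : (Set.univ : Set ((Fin d → ℤ) → Bool)) ⊆
      {ω | OriginInInfiniteCluster (toConfig ω)} ∪
        ⋃ n, {ω | Bad {z | emb d z ∈ toConfig ω} n (0, 0)} := by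
    intro ω _
    by_cases h : ∃ n, Bad {z | emb d z ∈ toConfig ω} n (0, 0)
    · exact Or.inr (Set.mem_iUnion.2 h)
    · push Not at h
      exact Or.inl (origin_of_good hd h)
  have h1 : (1 : ENNReal) ≤ 3⁻¹ := by
    calc (1 : ENNReal) = μ Set.univ := measure_univ.symm
      _ ≤ _ := measure_mono huniv
      _ ≤ _ := measure_union_le _ _
      _ = 0 + μ (⋃ n, {ω | Bad {z | emb d z ∈ toConfig ω} n (0, 0)}) := by
          congr 1
      _ ≤ 0 + ∑' n, μ {ω | Bad {z | emb d z ∈ toConfig ω} n (0, 0)} := by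
          gcongr
          exact measure_iUnion_le _
      _ ≤ 0 + ∑' n, 4⁻¹ ^ (n + 1) := by
          gcongr with n
          exact hbad n
      _ = 3⁻¹ := by
          rw [zero_add]
          simp only [pow_succ]
          rw [ENNReal.tsum_mul_right, ENNReal.tsum_geometric]
          rw [← ENNReal.mul_inv (by simp) (by simp)]
          congr 1
          rw [ENNReal.sub_mul (by simp), ENNReal.inv_mul_cancel (by simp) (by simp)]
          rw [one_mul]
          exact (ENNReal.sub_eq_of_eq_add (by simp) (by norm_num))
  rw [ENNReal.le_inv_iff_mul_le] at h1
  norm_num at h1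

end pclt

open MeasureTheory

lemma pc_bounds {d : ℕ} (hd : 2 ≤ d) (μ : ℝ → Measure ((Fin d → ℤ) → Bool))
    (hμ : ∀ p ∈ Set.Icc (0 : ℝ) 1, IsBernoulliProduct d p (μ p)) :
    0 < pc μ ∧ pc μ < 1 ∧ {p : ℝ | p ∈ Set.Icc (0 : ℝ) 1 ∧ 0 < theta0 (μ p)}.Nonempty := by
  have hmem : (1 - 1 / 324 : ℝ) ∈ {p : ℝ | p ∈ Set.Icc (0 : ℝ) 1 ∧ 0 < theta0 (μ p)} := by
    have hI : (1 - 1 / 324 : ℝ) ∈ Set.Icc (0 : ℝ) 1 := by constructor <;> norm_num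
    exact ⟨hI, theta0_pos hd rfl (hμ _ hI)⟩
  have hK : (0 : ℝ) < (ballF d 1).card := by
    have : 0 < (ballF d 1).card :=
      Finset.card_pos.2 ⟨0, mem_ballF.2 (by rw [norm1_zero]; omega)⟩
    exact_mod_cast this
  refine ⟨?_, ?_, ⟨_, hmem⟩⟩
  · refine lt_of_lt_of_le (show (0 : ℝ) < 1 / (ballF d 1).card by positivity)
      (le_csInf ⟨_, hmem⟩ fun p hp => ?_)
    by_contra h
    push Not at h
    rw [lt_div_iff₀ hK] at h
    have := theta0_eq_zero hp.1.1 h (hμ p hp.1)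
    exact hp.2.ne' this
  · exact lt_of_le_of_lt (csInf_le ⟨0, fun x hx => hx.1.1⟩ hmem) (by norm_num)

theorem statement15 (d : ℕ) (hd : 2 ≤ d)
    (hpath : PathModificationProperty d)
    (r' : ℤ) (hr' : 1 ≤ r')
    (E0 : Set (Fin d → ℤ) → Set (Fin d → ℤ))
    (hloc : ∀ ω ω' : Set (Fin d → ℤ), ω ∩ Binf d r' = ω' ∩ Binf d r' → E0 ω = E0 ω')
    (hrange : ∀ ω : Set (Fin d → ℤ), E0 ω ⊆ Binf d r')
    (hess : ∃ ω : Set (Fin d → ℤ),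
      ¬ HasDoublyInfinitePath ω ∧ HasDoublyInfinitePath (ω ∪ E0 ω))
    (μ : ℝ → Measure ((Fin d → ℤ) → Bool))
    (hμ : ∀ p ∈ Set.Icc (0 : ℝ) 1, IsBernoulliProduct d p (μ p))
    (s : ℝ) (hs0 : 0 < s) (hs1 : s < 1) :
    ∃ π : ℝ, π < pc μ ∧
      ∀ p : ℝ, π < p → p < pc μ → 0 < theta E0 (μ p) (μ s) := by
  obtain ⟨D, hD, hpt⟩ := pivot_transfer hd hpath hr' E0 hloc hrange hess
  obtain ⟨hpc0, hpc1, hne⟩ := pc_bounds hd μ hμ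
  set a : ℝ := pc μ with ha
  set b : ℕ := 2 * (ballF d D).card with hb
  have hK : 0 < (ballF d D).card :=
    Finset.card_pos.2 ⟨0, mem_ballF.2 (by rw [norm1_zero]; omega)⟩
  have hbpos : (0 : ℝ) < b := by
    have : 0 < b := by omega
    exact_mod_cast this
  obtain ⟨δ, hδ, hδa, hδb, hδs, hδs'⟩ : ∃ δ : ℝ, 0 < δ ∧ δ ≤ a / 2 ∧ δ ≤ (1 - a) / 2 ∧
      δ ≤ s / 2 ∧ δ ≤ 1 - s := by
    refine ⟨min (min (a / 2) ((1 - a) / 2)) (min (s / 2) (1 - s)), ?_, ?_, ?_, ?_, ?_⟩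
    · refine lt_min (lt_min ?_ ?_) (lt_min ?_ ?_) <;> linarith
    · exact (min_le_left _ _).trans (min_le_left _ _)
    · exact (min_le_left _ _).trans (min_le_right _ _)
    · exact (min_le_right _ _).trans (min_le_left _ _)
    · exact (min_le_right _ _).trans (min_le_right _ _)
  set C : ℝ := b / δ ^ b with hC
  have hCpos : 0 < C := by positivity
  set η : ℝ := s / (4 * C) with hη
  have hηpos : 0 < η := by positivity
  have hCη : C * η = s / 4 := by rw [hη]; field_simp
  refine ⟨max (a / 2) (a - η), max_lt (by linarith) (by linarith), fun p hp hpa => ?_⟩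
  have hpl : a / 2 < p := lt_of_le_of_lt (le_max_left _ _) hp
  have hpl' : a - η < p := lt_of_le_of_lt (le_max_right _ _) hp
  obtain ⟨p1, ⟨hp1I, hp1pos⟩, hp1lt⟩ := exists_lt_of_csInf_lt hne
    (show pc μ < a + min η ((1 - a) / 2) from by
      have : 0 < min η ((1 - a) / 2) := lt_min hηpos (by linarith)
      linarith)
  have hp1ge : a ≤ p1 := csInf_le ⟨0, fun x hx => hx.1.1⟩ ⟨hp1I, hp1pos⟩
  have h1 : p1 < a + η := lt_of_lt_of_le hp1lt (by linarith [min_le_left η ((1 - a) / 2)])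
  have h2 : p1 < a + (1 - a) / 2 :=
    lt_of_lt_of_le hp1lt (by linarith [min_le_right η ((1 - a) / 2)])
  have h3 : C * (p1 - p) ≤ C * (η + η) := mul_le_mul_of_nonneg_left (by linarith) hCpos.le
  have h4 : 0 ≤ C * (p1 - p) := mul_nonneg hCpos.le (by linarith)
  have hμp := hμ p ⟨by linarith, by linarith⟩
  have hμs := hμ s ⟨by linarith, by linarith⟩
  have hμp1 := hμ p1 hp1I
  have hμs1 := hμ (s - C * (p1 - p)) ⟨by linarith, by linarith⟩
  have := hμp.1
  have := hμs.1
  have hκ : 0 < ENNReal.ofReal (δ ^ b) * theta0 (μ p1) := by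
    refine pos_iff_ne_zero.2 (mul_ne_zero ?_ hp1pos.ne')
    exact (ENNReal.ofReal_pos.2 (by positivity)).ne'
  refine lt_of_lt_of_le hκ (theta_ge hr' hloc hrange fun n => ?_)
  exact finite_compare hr' hloc hrange hD hpt hδ (by linarith) ⟨by linarith, by linarith⟩
    ⟨by linarith, by linarith⟩ ⟨by linarith, by linarith⟩ ⟨by linarith, by linarith⟩
    (by linarith) hb (by rw [← hC]; ring) hμp hμp1 hμs hμs1 n
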